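/- For every real λ < λ* there exists n ∈ ℕ such that every symmetric matrix A with integer entries and all diagonal entries zero that has a (real) eigenvalue less than −λ also has a principal submatrix of order at most n with an eigenvalue less than −λ. Moreover, for every real λ ≥ λ* this fails: for every n ∈ ℕ there exists a symmetric integer matrix A with zero diagonal having an eigenvalue less than −λ, all of whose principal submatrices of order at most n have all eigenvalues at least −λ. -/

import Mathlib

open Classical

/-- An eigenvalue of a real matrix indexed by a finite type. -/
def IsEigenvalue {V : Type*} [Fintype V] (A : Matrix V V ℝ) (μ : ℝ) : Prop :=
  ∃ v : V → ℝ, v ≠ 0 ∧ A.mulVec v = μ • v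

set_option linter.unusedSectionVars false

/-- The bilinear form of an integer matrix with its diagonal increased by `d`. -/
noncomputable def wform {V : Type*} [Fintype V] [DecidableEq V] (A : Matrix V V ℤ) (d : V → ℝ) :
    LinearMap.BilinForm ℝ (V → ℝ) :=
  Matrix.toBilin' (Matrix.diagonal d + A.map (Int.cast : ℤ → ℝ))

/-- Nonnegativity of the form on the vectors supported in `S`. -/
def PSDOn {V : Type*} [Fintype V] [DecidableEq V] (A : Matrix V V ℤ) (d : V → ℝ)
    (S : Finset V) : Prop :=
  ∀ z : V → ℝ, (∀ i, i ∉ S → z i = 0) → 0 ≤ wform A d z z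

section core
variable {V : Type*} [Fintype V] [DecidableEq V] {A : Matrix V V ℤ} {d : V → ℝ}

theorem wform_apply (x y : V → ℝ) :
    wform A d x y = ∑ i, d i * x i * y i + ∑ i, ∑ j, (A i j : ℝ) * x i * y j := by
  unfold wform
  rw [Matrix.toBilin'_apply']
  simp only [Matrix.add_mulVec, dotProduct_add]
  congr 1
  · simp only [dotProduct]
    exact Finset.sum_congr rfl fun i _ => by simp only [Matrix.mulVec_diagonal]; ring
  · simp only [dotProduct, Matrix.mulVec, Finset.mul_sum, Matrix.map_apply]
    exact Finset.sum_congr rfl fun i _ => Finset.sum_congr rfl fun j _ => by ring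

theorem wform_symm (hA : A.IsSymm) (x y : V → ℝ) : wform A d x y = wform A d y x := by
  rw [wform_apply, wform_apply]
  congr 1
  · exact Finset.sum_congr rfl fun i _ => by ring
  · rw [Finset.sum_comm]
    refine Finset.sum_congr rfl fun i _ => Finset.sum_congr rfl fun j _ => ?_
    rw [hA.apply i j]; ring

theorem wform_single_right (x : V → ℝ) (j : V) :
    wform A d x (Pi.single j 1) = d j * x j + ∑ i, (A i j : ℝ) * x i := by
  rw [wform_apply]
  congr 1
  · rw [Finset.sum_eq_single j] <;> simp +contextual
  · refine Finset.sum_congr rfl fun i _ => ?_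
    rw [Finset.sum_eq_single j] <;> simp +contextual

theorem wform_single_left (hA : A.IsSymm) (x : V → ℝ) (j : V) :
    wform A d (Pi.single j 1) x = d j * x j + ∑ i, (A j i : ℝ) * x i := by
  rw [wform_symm hA, wform_single_right]
  simp only [hA.apply]

theorem wform_single_single (i j : V) :
    wform A d (Pi.single i 1) (Pi.single j 1) = (if i = j then d j else 0) + A i j := by
  rw [wform_single_right]
  congr 1
  · by_cases h : i = j
    · subst h; simp
    · simp [h, Ne.symm h]
  · rw [Finset.sum_eq_single i] <;> simp +contextual

theorem wform_self_add (hA : A.IsSymm) (x y : V → ℝ) :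
    wform A d (x + y) (x + y) = wform A d x x + 2 * wform A d x y + wform A d y y := by
  simp only [map_add, LinearMap.add_apply]
  rw [wform_symm hA y x]; ring

theorem wform_diag_change (d' : V → ℝ) (x y : V → ℝ) :
    wform A d' x y = wform A d x y + ∑ i, (d' i - d i) * x i * y i := by
  rw [wform_apply, wform_apply]
  simp only [sub_mul, Finset.sum_sub_distrib]; ring

theorem PSDOn.mono {S T : Finset V} (h : PSDOn A d S) (hT : T ⊆ S) : PSDOn A d T :=
  fun z hz => h z fun i hi => hz i fun h' => hi (hT h')

theorem PSDOn.mono_diag {S : Finset V} {d' : V → ℝ} (h : PSDOn A d S)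
    (hd : ∀ i ∈ S, d i ≤ d' i) : PSDOn A d' S := by
  intro z hz
  rw [wform_diag_change (d := d)]
  refine add_nonneg (h z hz) (Finset.sum_nonneg fun i _ => ?_)
  by_cases hi : i ∈ S
  · have := hd i hi
    rw [mul_assoc]
    exact mul_nonneg (by linarith) (mul_self_nonneg _)
  · simp [hz i hi]

/-- A vector of norm zero is orthogonal to everything the form is nonnegative on. -/
theorem PSDOn.null (hA : A.IsSymm) {S : Finset V} (h : PSDOn A d S) {x y : V → ℝ}
    (hx : ∀ i, i ∉ S → x i = 0) (hy : ∀ i, i ∉ S → y i = 0) (h0 : wform A d y y = 0) :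
    wform A d x y = 0 := by
  by_contra hne
  have key : ∀ t : ℝ, 0 ≤ wform A d x x + 2 * t * wform A d x y := by
    intro t
    have := h (x + t • y) fun i hi => by simp [hx i hi, hy i hi]
    rw [wform_self_add hA] at this
    simp only [map_smul, LinearMap.smul_apply, smul_eq_mul, h0] at this
    linarith
  have := key (-(wform A d x x + 1) / (2 * wform A d x y))
  have e : 2 * (-(wform A d x x + 1) / (2 * wform A d x y)) * wform A d x y
      = -(wform A d x x + 1) := by field_simp
  rw [e] at this; linarith

end core

/-- The Rayleigh characterisation of a matrix with an eigenvalue below `-lam`. -/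
theorem exists_eigenvalue_lt_iff {V : Type*} [Fintype V] [DecidableEq V] {A : Matrix V V ℤ}
    (hA : A.IsSymm) (lam : ℝ) :
    (∃ μ : ℝ, IsEigenvalue (A.map (Int.cast : ℤ → ℝ)) μ ∧ μ < -lam) ↔
      ¬ PSDOn A (fun _ => lam) Finset.univ := by
  have hq : ∀ z : V → ℝ, wform A (fun _ => lam) z z
      = lam * (z ⬝ᵥ z) + z ⬝ᵥ (A.map (Int.cast : ℤ → ℝ)).mulVec z := by
    intro z
    unfold wform
    rw [Matrix.toBilin'_apply', Matrix.add_mulVec, dotProduct_add]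
    congr 1
    simp only [dotProduct, Finset.mul_sum, Matrix.mulVec_diagonal]
    exact Finset.sum_congr rfl fun i _ => by ring
  have hH : (A.map (Int.cast : ℤ → ℝ)).IsHermitian := by
    ext i j
    simp [Matrix.conjTranspose_apply, hA.apply]
  constructor
  · rintro ⟨μ, ⟨v, hv, hAv⟩, hμ⟩ hpsd
    have h1 := hpsd v (by simp)
    rw [hq, hAv, dotProduct_smul, smul_eq_mul, ← add_mul] at h1
    have h2 : 0 < v ⬝ᵥ v := by
      refine lt_of_le_of_ne (Finset.sum_nonneg fun i _ => mul_self_nonneg _) fun h => hv ?_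
      exact dotProduct_self_eq_zero.1 h.symm
    nlinarith
  · intro hn
    by_contra hcon
    push Not at hcon
    apply hn
    have hps : ((A.map (Int.cast : ℤ → ℝ)) + Matrix.diagonal (fun _ => lam)).PosSemidef := by
      have hH2 : ((A.map (Int.cast : ℤ → ℝ)) + Matrix.diagonal (fun _ => lam)).IsHermitian :=
        hH.add (Matrix.isHermitian_diagonal _)
      rw [hH2.posSemidef_iff_eigenvalues_nonneg]
      intro i
      have hne := hH2.eigenvectorBasis.toBasis.ne_zero i
      have hm := hH2.mulVec_eigenvectorBasis i
      have := hcon (hH2.eigenvalues i - lam) ⟨(hH2.eigenvectorBasis i : V → ℝ), ?_, ?_⟩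
      · simp only [Pi.zero_apply]; linarith
      · intro h0
        apply hne
        ext j
        simpa using congrFun h0 j
      · rw [Matrix.add_mulVec] at hm
        rw [sub_smul, ← hm]
        ext j
        simp
    intro z _
    have := hps.dotProduct_mulVec_nonneg z
    rw [hq]
    rw [Matrix.add_mulVec, dotProduct_add] at this
    have e : z ⬝ᵥ (Matrix.diagonal (fun _ : V => lam)).mulVec z = lam * (z ⬝ᵥ z) := by
      simp only [dotProduct, Finset.mul_sum, Matrix.mulVec_diagonal]
      exact Finset.sum_congr rfl fun i _ => by ring
    simp only [star_trivial] at this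
    linarith

/-- The constant diagonal `θ` with the entry at the root `v` replaced by `X`. -/
noncomputable def rootDiag {V : Type*} [DecidableEq V] (v : V) (X θ : ℝ) : V → ℝ :=
  Function.update (fun _ => θ) v X

/-- Some subset of `S` with at most `M` elements is not nonnegative for the rooted form. -/
def Fails {V : Type*} [Fintype V] [DecidableEq V] (A : Matrix V V ℤ) (θ X : ℝ) (v : V)
    (S : Finset V) (M : ℕ) : Prop :=
  ∃ U ⊆ S, U.card ≤ M ∧ ¬ PSDOn A (rootDiag v X θ) U

/-- `S` is connected and contains `v`. -/
def Conn {V : Type*} (A : Matrix V V ℤ) (v : V) (S : Finset V) : Prop :=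
  v ∈ S ∧ ∀ x ∈ S, Relation.ReflTransGen (fun a b => b ∈ S ∧ A a b ≠ 0) v x

section rooted
variable {V : Type*} [Fintype V] [DecidableEq V] {A : Matrix V V ℤ} {d : V → ℝ}

@[simp] theorem rootDiag_self (v : V) (X θ : ℝ) : rootDiag v X θ v = X := by
  simp [rootDiag]

theorem rootDiag_of_ne {v x : V} (h : x ≠ v) (X θ : ℝ) : rootDiag v X θ x = θ := by
  simp [rootDiag, h]

theorem PSDOn.rootDiag_mono {S : Finset V} {v : V} {X X' θ θ' : ℝ}
    (h : PSDOn A (rootDiag v X θ) S) (hX : X ≤ X') (hθ : θ ≤ θ') :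
    PSDOn A (rootDiag v X' θ') S := by
  refine h.mono_diag fun i _ => ?_
  by_cases hi : i = v
  · subst hi; simpa
  · simpa [rootDiag_of_ne hi]

theorem PSDOn.congr_diag {S : Finset V} {d' : V → ℝ} (h : PSDOn A d S)
    (hd : ∀ i ∈ S, d i = d' i) : PSDOn A d' S :=
  h.mono_diag fun i hi => (hd i hi).le

theorem wform_single_of_unique {S : Finset V} {v w : V} {z : V → ℝ}
    (hw : ∀ x ∈ S, x ≠ w → A v x = 0) (hz : ∀ i, i ∉ S → z i = 0) :
    ∑ i, (A v i : ℝ) * z i = A v w * z w := by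
  refine Finset.sum_eq_single w (fun b _ hb => ?_) (by simp)
  by_cases hbS : b ∈ S
  · simp [hw b hbS hb]
  · simp [hz b hbS]

/-- Removing a vertex with a single neighbour. -/
theorem PSDOn.contract_iff (hA : A.IsSymm) (h0 : ∀ i, A i i = 0) {S : Finset V} {v w : V}
    (hvS : v ∉ S) (hw : A v w ^ 2 = 1) (hx : ∀ x ∈ S, x ≠ w → A v x = 0) (hd : 0 < d v) :
    PSDOn A d (insert v S) ↔ PSDOn A (Function.update d w (d w - 1 / d v)) S := by
  have hw' : (A v w : ℝ) ^ 2 = 1 := by exact_mod_cast hw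
  have key : ∀ (z : V → ℝ) (t : ℝ), (∀ i, i ∉ S → z i = 0) →
      wform A d (z + t • Pi.single v 1) (z + t • Pi.single v 1)
        = wform A (Function.update d w (d w - 1 / d v)) z z + d v * (t + A v w * z w / d v) ^ 2 := by
    intro z t hz
    rw [wform_self_add hA, wform_diag_change (d := d) (d' := Function.update d w (d w - 1 / d v))]
    have e1 : wform A d z (Pi.single v 1) = A v w * z w := by
      rw [wform_symm hA, wform_single_left hA, hz v hvS, wform_single_of_unique hx hz]
      ring
    have e2 : wform A d (Pi.single v 1) (Pi.single v 1) = d v := by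
      rw [wform_single_single]; simp [h0]
    have e3 : ∑ i, (Function.update d w (d w - 1 / d v) i - d i) * z i * z i
        = - (z w ^ 2 / d v) := by
      rw [Finset.sum_eq_single w]
      · simp; ring
      · intro b _ hb; simp [hb]
      · simp
    simp only [map_smul, LinearMap.smul_apply, smul_eq_mul, e1, e2, e3]
    field_simp
    linear_combination (-(z w) ^ 2) * hw'
  constructor
  · intro h z hz
    have := h (z + (-(A v w * z w / d v)) • Pi.single v 1) fun i hi => by
      rw [Finset.mem_insert, not_or] at hi
      simp [hz i hi.2, hi.1]
    rw [key _ _ hz] at this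
    simpa using this
  · intro h z hz
    have e : z = Function.update z v 0 + z v • Pi.single v 1 := by
      ext i
      by_cases hi : i = v
      · subst hi; simp
      · simp [hi]
    have hz' : ∀ i, i ∉ S → Function.update z v 0 i = 0 := by
      intro i hi
      by_cases hiv : i = v
      · subst hiv; simp
      · simp [hiv, hz i (by simp [hiv, hi])]
    rw [e, key _ _ hz']
    have := h _ hz'
    positivity

theorem Fails.step (hA : A.IsSymm) (h0 : ∀ i, A i i = 0) {θ t t' : ℝ} {S : Finset V} {v w : V}
    {M : ℕ} (hvS : v ∉ S) (hwS : w ∈ S) (hw : A v w ^ 2 = 1)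
    (hx : ∀ x ∈ S, x ≠ w → A v x = 0) (ht' : 0 < t') (htt : θ - 1 / t' ≤ t)
    (h : Fails A θ t w S M) : Fails A θ t' v (insert v S) (M + 1) := by
  obtain ⟨U, hU, hM, hf⟩ := h
  refine ⟨insert v U, Finset.insert_subset_insert _ hU,
    (Finset.card_insert_le _ _).trans (by omega), fun hp => hf ?_⟩
  have hwv : w ≠ v := fun h => hvS (h ▸ hwS)
  rw [PSDOn.contract_iff hA h0 (fun h => hvS (hU h)) hw (fun x hxU => hx x (hU hxU))
    (by simpa using ht')] at hp
  refine hp.mono_diag fun i hi => ?_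
  by_cases hiw : i = w
  · subst hiw; simpa [rootDiag_of_ne hwv] using htt
  · have hiv : i ≠ v := fun h => hvS (h ▸ hU hi)
    simp [hiw, rootDiag_of_ne hiv, rootDiag_of_ne hiw]

theorem Fails.mono {θ X X' : ℝ} {v : V} {S S' : Finset V} {M M' : ℕ} (h : Fails A θ X v S M)
    (hX : X' ≤ X) (hS : S ⊆ S') (hM : M ≤ M') : Fails A θ X' v S' M' := by
  obtain ⟨U, hU, hc, hf⟩ := h
  exact ⟨U, hU.trans hS, hc.trans hM, fun hp => hf (hp.rootDiag_mono hX le_rfl)⟩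

theorem Conn.ssubset_ind {P : V → Finset V → Prop}
    (h : ∀ v S, (∀ w S', S' ⊂ S → P w S') → P v S) : ∀ v S, P v S := by
  intro v S
  induction S using Finset.strongInduction generalizing v with
  | H S ih => exact h v S fun w S' hS' => ih S' hS' w

/-- The reduction of the rooted problem to sets from which no vertex can be contracted. -/
theorem fails_of_irreducible (hA : A.IsSymm) (h0 : ∀ i, A i i = 0) {θ X : ℝ} {B L : ℕ}
    (hX : 1 ≤ X) (hXθ : θ < X + 1 / X) (hL : θ ≤ X + L * (X + 1 / X - θ))
    (base : ∀ v S, Conn A v S → ¬ PSDOn A (rootDiag v 1 2) S →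
      (∀ S', S' ⊂ S → Conn A v S' → PSDOn A (rootDiag v 1 2) S') →
      (∃ w ∈ S, A v w ^ 2 = 1 ∧ ∀ x ∈ S, x ≠ w → A v x = 0) ∨ Fails A θ X v S B)
    (v : V) (S : Finset V) (hc : Conn A v S) (hS : ¬ PSDOn A (rootDiag v 1 2) S) :
    Fails A θ X v S (B + L) := by
  set ε := X + 1 / X - θ with hε
  have hεp : 0 < ε := by linarith
  have main : ∀ v S, Conn A v S → ¬ PSDOn A (rootDiag v 1 2) S →
      ∃ j : ℕ, j ≤ L ∧ Fails A θ (X + j * ε) v S (B + j) := by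
    refine Conn.ssubset_ind fun v S ih hc hS => ?_
    by_cases hP : ∀ S', S' ⊂ S → Conn A v S' → PSDOn A (rootDiag v 1 2) S'
    swap
    · push Not at hP
      obtain ⟨S', h1, h2, h3⟩ := hP
      obtain ⟨j, hj, hf⟩ := ih v S' h1 h2 h3
      exact ⟨j, hj, hf.mono le_rfl h1.subset le_rfl⟩
    rcases base v S hc hS hP with ⟨w, hwS, hw, hx⟩ | hf
    swap
    · exact ⟨0, Nat.zero_le _, by simpa using hf⟩
    have hwv : w ≠ v := by rintro rfl; simp [h0] at hw
    have hvS := hc.1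
    have hins : insert v (S.erase v) = S := Finset.insert_erase hvS
    have hx' : ∀ x ∈ S.erase v, x ≠ w → A v x = 0 := fun x hxS => hx x (Finset.mem_of_mem_erase hxS)
    have hn : ¬ PSDOn A (rootDiag w 1 2) (S.erase v) := by
      intro hp
      apply hS
      rw [← hins, PSDOn.contract_iff hA h0 (Finset.notMem_erase v S) hw hx' (by simp)]
      refine hp.congr_diag fun i hi => ?_
      have hiv := Finset.ne_of_mem_erase hi
      by_cases hiw : i = w
      · subst hiw; rw [rootDiag_self, Function.update_self, rootDiag_of_ne hiv, rootDiag_self]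
        norm_num
      · rw [rootDiag_of_ne hiw, Function.update_of_ne hiw, rootDiag_of_ne hiv]
    have hcw : Conn A w (S.erase v) := by
      refine ⟨Finset.mem_erase.2 ⟨hwv, hwS⟩, ?_⟩
      have : ∀ x, Relation.ReflTransGen (fun a b => b ∈ S ∧ A a b ≠ 0) v x →
          x = v ∨ Relation.ReflTransGen (fun a b => b ∈ S.erase v ∧ A a b ≠ 0) w x := by
        intro x hx1
        induction hx1 with
        | refl => exact Or.inl rfl
        | tail _ h2 ih2 =>
          rename_i b c _
          by_cases hcv : c = v
          · exact Or.inl hcv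
          right
          rcases ih2 with rfl | h3
          · have : c = w := by by_contra hne; exact h2.2 (hx c h2.1 hne)
            subst this; exact .refl
          · exact h3.tail ⟨Finset.mem_erase.2 ⟨hcv, h2.1⟩, h2.2⟩
      intro x hxS
      exact (this x (hc.2 x (Finset.mem_of_mem_erase hxS))).resolve_left (Finset.ne_of_mem_erase hxS)
    obtain ⟨j, hj, hf⟩ := ih w _ (Finset.erase_ssubset hvS) hcw hn
    have hjε : 0 ≤ (j : ℝ) * ε := by positivity
    rcases hj.lt_or_eq with hj | rfl
    · refine ⟨j + 1, hj, ?_⟩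
      rw [← hins]
      refine Fails.step hA h0 (Finset.notMem_erase v S) hcw.1 hw hx' ?_ ?_ hf
      · push_cast; positivity
      · push_cast
        set t := X + (j + 1) * ε with ht
        have htX : X ≤ t := by rw [ht]; nlinarith
        have : X + 1 / X ≤ t + 1 / t := by
          have h1 : 0 < X := by linarith
          have h2 : 0 < t := by linarith
          rw [← sub_nonneg]
          have : t + 1 / t - (X + 1 / X) = (t - X) * (t * X - 1) / (t * X) := by field_simp; ring
          rw [this]
          exact div_nonneg (mul_nonneg (by linarith) (by nlinarith)) (by positivity)
        have : X + (j : ℝ) * ε = t - ε := by rw [ht]; ring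
        rw [this]; linarith
    · refine ⟨j, le_rfl, ?_⟩
      obtain ⟨U, hU, hM, hfU⟩ := hf
      refine ⟨U, hU.trans (Finset.erase_subset _ _), hM, fun hp => hfU (hp.mono_diag fun i hi => ?_)⟩
      rw [rootDiag_of_ne (Finset.ne_of_mem_erase (hU hi))]
      by_cases hiw : i = w
      · subst hiw; simpa using hL
      · rw [rootDiag_of_ne hiw]
  obtain ⟨j, hj, hf⟩ := main v S hc hS
  exact hf.mono (by have : 0 ≤ (j : ℝ) * ε := by positivity
                    linarith) subset_rfl (by omega)

end rooted

/-- A shortest chain between two sets is induced. -/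
theorem exists_shortest_chain {α : Type*} {R : α → α → Prop} {P Q : α → Prop} {a b : α}
    (ha : P a) (hb : Q b) (h : Relation.ReflTransGen R a b) :
    ∃ (n : ℕ) (p : ℕ → α), P (p 0) ∧ Q (p n) ∧ (∀ i < n, R (p i) (p (i + 1))) ∧
      (∀ i j, i < j → j ≤ n → p i ≠ p j) ∧ (∀ i j, i + 1 < j → j ≤ n → ¬ R (p i) (p j)) ∧
      (∀ i < n, ¬ Q (p i)) ∧ (∀ i, 0 < i → i ≤ n → ¬ P (p i)) := by
  let C : ℕ → Prop := fun n => ∃ p : ℕ → α, P (p 0) ∧ Q (p n) ∧ ∀ i < n, R (p i) (p (i + 1))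
  have hC : ∃ n, C n := by
    suffices h_all : ∀ c, Relation.ReflTransGen R a c →
        ∃ n, ∃ p : ℕ → α, P (p 0) ∧ p n = c ∧ ∀ i < n, R (p i) (p (i + 1)) by
      obtain ⟨n, p, h1, h2, h3⟩ := h_all b h
      exact ⟨n, p, h1, h2 ▸ hb, h3⟩
    intro c hc
    induction hc with
    | refl => exact ⟨0, fun _ => a, ha, rfl, by simp⟩
    | @tail x y _ hxy ih =>
      obtain ⟨n, p, h1, h2, h3⟩ := ih
      refine ⟨n + 1, fun i => if i ≤ n then p i else y, by simpa, by simp, fun i hi => ?_⟩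
      rcases Nat.lt_succ_iff_lt_or_eq.1 hi with hi | rfl
      · simp only [hi.le, if_true, Nat.succ_le_iff, hi]
        exact h3 i hi
      · simpa [h2] using hxy
  obtain ⟨p, h1, h2, h3⟩ := Nat.find_spec hC
  set n := Nat.find hC with hn
  have hmin : ∀ m < n, ¬ C m := fun m hm => Nat.find_min hC hm
  have cut : ∀ i j, i ≤ j → j ≤ n → ∀ k, (∃ q : ℕ → α, P (q 0) ∧ q k = p j ∧
      ∀ i < k, R (q i) (q (i + 1))) → j ≤ k := by
    rintro i j hij hj k ⟨q, q1, q2, q3⟩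
    by_contra hlt
    push Not at hlt
    refine hmin (k + (n - j)) (by omega)
      ⟨fun t => if t ≤ k then q t else p (t + j - k), by simpa, ?_, fun t ht => ?_⟩
    · by_cases h : n = j
      · subst h; simpa [q2] using h2
      · have : ¬ (k + (n - j) ≤ k) := by omega
        simp only [this, if_false]
        have : k + (n - j) + j - k = n := by omega
        rwa [this]
    · rcases lt_trichotomy t k with h | rfl | h
      · simp only [h.le, if_true, Nat.succ_le_iff, h]; exact q3 t h
      · simp only [le_refl, if_true, Nat.not_succ_le_self, if_false, q2]
        have : t + 1 + j - t = j + 1 := by omega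
        rw [this]; exact h3 j (by omega)
      · simp only [not_le.2 h, if_false, not_le.2 (h.trans (Nat.lt_succ_self t))]
        have : t + 1 + j - k = (t + j - k) + 1 := by omega
        rw [this]; exact h3 _ (by omega)
  refine ⟨n, p, h1, h2, h3, fun i j hij hj he => ?_, fun i j hij hj he => ?_,
    fun i hi hq => ?_, fun i hi hin hp => ?_⟩
  · have := cut i j hij.le hj i ⟨p, h1, he, fun t ht => h3 t (by omega)⟩
    omega
  · have := cut i j (by omega) hj (i + 1) ⟨fun t => if t ≤ i then p t else p j, by simpa,
      by simp, fun t ht => ?_⟩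
    · omega
    · rcases Nat.lt_succ_iff_lt_or_eq.1 ht with h | rfl
      · simp only [h.le, if_true, Nat.succ_le_iff, h]; exact h3 t (by omega)
      · simpa using he
  · exact hmin i hi ⟨p, h1, hq, fun t ht => h3 t (by omega)⟩
  · have := cut 0 i (by omega) hin 0 ⟨fun _ => p i, hp, rfl, by simp⟩
    omega

section rooted
variable {V : Type*} [Fintype V] [DecidableEq V] {A : Matrix V V ℤ} {d : V → ℝ}

/-- The restriction of a vector to a finite set. -/
noncomputable def vrestrict (K : Finset V) (z : V → ℝ) : V → ℝ := fun i => if i ∈ K then z i else 0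

theorem wform_vrestrict (x : V → ℝ) (K : Finset V) (z : V → ℝ) :
    wform A d x (vrestrict K z) = ∑ i ∈ K, z i * wform A d x (Pi.single i 1) := by
  have : vrestrict K z = ∑ i ∈ K, z i • Pi.single i (1 : ℝ) := by
    ext j
    simp [vrestrict, Finset.sum_apply, Pi.single_apply]
  rw [this]
  simp

/-- If the root sees two parts of the rest only through a common rank one term, then
nonnegativity is inherited from the two parts. -/
theorem psdOn_of_split (hA : A.IsSymm) (h0 : ∀ i, A i i = 0) {v : V} {K R : Finset V}
    (hd : d v = 1) (hKR : Disjoint K R) (hvK : v ∉ K) (hvR : v ∉ R)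
    (hx : ∀ x ∈ K, ∀ y ∈ R, A x y = A v x * A v y)
    (hK : PSDOn A d (insert v K)) (hR : PSDOn A d (insert v R)) :
    PSDOn A d (insert v (K ∪ R)) := by
  intro z hz
  have hvv : wform A d (Pi.single v 1) (Pi.single v 1) = 1 := by
    rw [wform_single_single]; simp [h0, hd]
  have hside : ∀ T : Finset V, v ∉ T → PSDOn A d (insert v T) →
      (wform A d (Pi.single v 1) (vrestrict T z)) ^ 2
        ≤ wform A d (vrestrict T z) (vrestrict T z) := by
    intro T hvT hT
    have := hT (vrestrict T z + (-(wform A d (Pi.single v 1) (vrestrict T z))) • Pi.single v 1)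
      fun i hi => by
        rw [Finset.mem_insert, not_or] at hi
        simp [vrestrict, hi]
    rw [wform_self_add hA] at this
    simp only [map_smul, LinearMap.smul_apply, smul_eq_mul, hvv,
      wform_symm hA _ (Pi.single v 1)] at this
    nlinarith
  have hvl : ∀ T : Finset V, v ∉ T → wform A d (Pi.single v 1) (vrestrict T z)
      = ∑ i ∈ T, z i * A v i := by
    intro T hvT
    rw [wform_vrestrict]
    refine Finset.sum_congr rfl fun i hi => ?_
    rw [wform_single_single]
    have : v ≠ i := by rintro rfl; exact hvT hi
    simp [this]
  have hcross : wform A d (vrestrict K z) (vrestrict R z)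
      = wform A d (Pi.single v 1) (vrestrict K z) * wform A d (Pi.single v 1) (vrestrict R z) := by
    rw [hvl K hvK, hvl R hvR, wform_vrestrict, Finset.sum_mul_sum, Finset.sum_comm]
    refine Finset.sum_congr rfl fun j hj => ?_
    rw [wform_symm hA, wform_vrestrict, Finset.mul_sum]
    refine Finset.sum_congr rfl fun i hi => ?_
    rw [wform_single_single]
    have : j ≠ i := by rintro rfl; exact Finset.disjoint_left.1 hKR hi hj
    have e : A j i = A v i * A v j := by rw [← hx i hi j hj]; exact hA.apply i j
    simp only [this, if_false, zero_add, e]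
    push_cast; ring
  have hz' : z = (vrestrict K z + vrestrict R z) + z v • Pi.single v 1 := by
    ext i
    by_cases hi : i = v
    · subst hi; simp [vrestrict, hvK, hvR]
    · by_cases hiK : i ∈ K
      · simp [vrestrict, hi, hiK, Finset.disjoint_left.1 hKR hiK]
      · by_cases hiR : i ∈ R
        · simp [vrestrict, hi, hiK, hiR]
        · simp [vrestrict, hi, hiK, hiR, hz i (by simp [hi, hiK, hiR])]
  have h1 := hside K hvK hK
  have h2 := hside R hvR hR
  rw [hz', wform_self_add hA, wform_self_add hA, hcross]
  simp only [map_smul, LinearMap.smul_apply, smul_eq_mul, hvv, LinearMap.add_apply, map_add,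
      wform_symm hA _ (Pi.single v 1)]
  nlinarith [sq_nonneg (z v + wform A d (Pi.single v 1) (vrestrict K z)
    + wform A d (Pi.single v 1) (vrestrict R z))]

theorem Conn.of_step {v : V} {S : Finset V} {P : V → Prop} (hc : Conn A v S) (hv : P v)
    (hstep : ∀ a b, P a → b ∈ S → A a b ≠ 0 → P b) : ∀ x ∈ S, P x := by
  intro x hx
  have h := hc.2 x hx
  clear hx
  induction h with
  | refl => exact hv
  | tail _ h2 ih => exact hstep _ _ ih h2.1 h2.2

/-- The neighbourhood of the root in a minimal bad set. -/
theorem single_neighbour_or_path (hA : A.IsSymm) (h0 : ∀ i, A i i = 0) {v : V} {S : Finset V}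
    (hd : d v = 1) (hc : Conn A v S) (hS : ¬ PSDOn A d S)
    (hP : ∀ S', S' ⊂ S → Conn A v S' → PSDOn A d S')
    (hnb : ∀ x ∈ S, ∀ y ∈ S, x ≠ y → A v x ≠ 0 → A v y ≠ 0 → A x y = A v x * A v y) :
    (∃ w ∈ S, A v w ≠ 0 ∧ ∀ x ∈ S, x ≠ w → A v x = 0) ∨
    ∃ (n : ℕ) (p : ℕ → V), 2 ≤ n ∧ (∀ i ≤ n, p i ∈ S ∧ p i ≠ v) ∧
      (∀ i j, i < j → j ≤ n → p i ≠ p j) ∧ A v (p 0) ≠ 0 ∧ A v (p n) ≠ 0 ∧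
      (∀ i, 0 < i → i < n → A v (p i) = 0) ∧ (∀ i < n, A (p i) (p (i + 1)) ≠ 0) ∧
      (∀ i j, i + 1 < j → j ≤ n → (0 < i ∨ j < n) → A (p i) (p j) = 0) := by
  have hvS := hc.1
  by_cases h1 : ∃ w ∈ S, A v w ≠ 0
  swap
  · exfalso
    push Not at h1
    have : ∀ x ∈ S, x = v := hc.of_step rfl fun a b ha hb hab => absurd (h1 b hb) (ha ▸ hab)
    apply hS
    intro z hz
    have e : z = z v • Pi.single v 1 := by
      ext i
      by_cases hi : i = v
      · subst hi; simp
      · simp [hi, hz i fun h => hi (this i h)]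
    rw [e]
    simp only [map_smul, LinearMap.smul_apply, smul_eq_mul, wform_single_single]
    simp only [if_true, hd, h0]
    push_cast
    nlinarith [mul_self_nonneg (z v)]
  obtain ⟨w, hwS, hw⟩ := h1
  by_cases h2 : ∀ x ∈ S, x ≠ w → A v x = 0
  · exact Or.inl ⟨w, hwS, hw, h2⟩
  right
  push Not at h2
  obtain ⟨u, huS, huw, hu⟩ := h2
  have hwv : w ≠ v := by rintro rfl; exact hw (h0 _)
  have huv : u ≠ v := by rintro rfl; exact hu (h0 _)
  let R : V → V → Prop := fun a b => a ∈ S.erase v ∧ b ∈ S.erase v ∧ A a b ≠ 0 ∧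
    ¬ (A v a ≠ 0 ∧ A v b ≠ 0)
  have hR : ∀ x ∈ S.erase v, Relation.ReflTransGen R w x := by
    by_contra hcon
    push Not at hcon
    obtain ⟨x₀, hx₀, hx₀'⟩ := hcon
    set K := (S.erase v).filter fun x => Relation.ReflTransGen R w x with hK
    set T := (S.erase v).filter fun x => ¬ Relation.ReflTransGen R w x with hT
    have hKT : K ∪ T = S.erase v := Finset.filter_union_filter_not_eq _ _
    have hwK : w ∈ K := by simp [hK, hwv, hwS, Relation.ReflTransGen.refl]
    have hKS : insert v K ⊂ S := by
      refine Finset.ssubset_iff_subset_ne.2 ⟨Finset.insert_subset hvS fun y hy => ?_, fun he => ?_⟩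
      · exact Finset.mem_of_mem_erase (Finset.mem_filter.1 hy).1
      · have := Finset.mem_of_mem_erase hx₀
        rw [← he, Finset.mem_insert, hK, Finset.mem_filter] at this
        rcases this with h | h
        · exact Finset.ne_of_mem_erase hx₀ h
        · exact hx₀' h.2
    have hTS : insert v T ⊂ S := by
      refine Finset.ssubset_iff_subset_ne.2 ⟨Finset.insert_subset hvS fun y hy => ?_, fun he => ?_⟩
      · exact Finset.mem_of_mem_erase (Finset.mem_filter.1 hy).1
      · rw [← he, Finset.mem_insert, hT, Finset.mem_filter] at hwS
        rcases hwS with h | h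
        · exact hwv h
        · exact h.2 .refl
    have hcK : Conn A v (insert v K) := by
      refine ⟨Finset.mem_insert_self _ _, fun x hx => ?_⟩
      rcases Finset.mem_insert.1 hx with rfl | hxK
      · exact .refl
      have h := (Finset.mem_filter.1 hxK).2
      clear hx hxK
      induction h with
      | refl => exact .single ⟨Finset.mem_insert_of_mem hwK, hw⟩
      | tail h3 h4 ih =>
        refine ih.tail ⟨Finset.mem_insert_of_mem ?_, h4.2.2.1⟩
        exact Finset.mem_filter.2 ⟨h4.2.1, h3.tail h4⟩
    have hcT : Conn A v (insert v T) := by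
      refine ⟨Finset.mem_insert_self _ _, ?_⟩
      have : ∀ x ∈ S, x ∈ K ∨ Relation.ReflTransGen
          (fun a b => b ∈ insert v T ∧ A a b ≠ 0) v x := by
        refine hc.of_step (Or.inr .refl) fun a b ha hb hab => ?_
        by_cases hbv : b = v
        · subst hbv; exact Or.inr .refl
        have hbS : b ∈ S.erase v := Finset.mem_erase.2 ⟨hbv, hb⟩
        by_cases hbK : b ∈ K
        · exact Or.inl hbK
        have hbT : b ∈ insert v T := Finset.mem_insert_of_mem (by
          rw [← hKT, Finset.mem_union] at hbS
          exact hbS.resolve_left hbK)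
        right
        rcases ha with ha | ha
        · by_cases hvb : A v b = 0
          · exfalso
            apply hbK
            have ha' := Finset.mem_filter.1 ha
            exact Finset.mem_filter.2 ⟨hbS, ha'.2.tail ⟨ha'.1, hbS, hab, fun h => h.2 hvb⟩⟩
          · exact .single ⟨hbT, hvb⟩
        · exact ha.tail ⟨hbT, hab⟩
      intro x hx
      rcases Finset.mem_insert.1 hx with rfl | hx
      · exact .refl
      have hx' := Finset.mem_filter.1 hx
      refine (this x (Finset.mem_of_mem_erase hx'.1)).resolve_left fun h => ?_
      exact hx'.2 (Finset.mem_filter.1 h).2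
    apply hS
    rw [← Finset.insert_erase hvS, ← hKT]
    refine psdOn_of_split hA h0 hd (Finset.disjoint_filter_filter_not _ _ _) ?_ ?_ ?_
      (hP _ hKS hcK) (hP _ hTS hcT)
    · simp [hK]
    · simp [hT]
    · intro x hx y hy
      have hx' := Finset.mem_filter.1 hx
      have hy' := Finset.mem_filter.1 hy
      have hxy : x ≠ y := by rintro rfl; exact hy'.2 hx'.2
      by_cases hb : A v x ≠ 0 ∧ A v y ≠ 0
      · exact hnb x (Finset.mem_of_mem_erase hx'.1) y (Finset.mem_of_mem_erase hy'.1) hxy hb.1 hb.2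
      · have : A x y = 0 := by
          by_contra hne
          exact hy'.2 (hx'.2.tail ⟨hx'.1, hy'.1, hne, hb⟩)
        rw [this]
        by_cases h : A v x = 0
        · simp [h]
        · have : A v y = 0 := by by_contra h'; exact hb ⟨h, h'⟩
          simp [this]
  obtain ⟨n, p, p1, p2, p3, p4, p5, p6, p7⟩ := exists_shortest_chain (P := fun x => x = w)
    (Q := fun x => A v x ≠ 0 ∧ x ≠ w ∧ x ∈ S.erase v) rfl
    ⟨hu, huw, Finset.mem_erase.2 ⟨huv, huS⟩⟩ (hR u (Finset.mem_erase.2 ⟨huv, huS⟩))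
  have hn0 : n ≠ 0 := by rintro rfl; exact p2.2.1 p1
  have hn1 : n ≠ 1 := by rintro rfl; exact (p3 0 one_pos).2.2.2 ⟨p1 ▸ hw, p2.1⟩
  have hmem : ∀ i ≤ n, p i ∈ S.erase v := by
    intro i hi
    rcases hi.lt_or_eq with hi | rfl
    · exact (p3 i hi).1
    · exact p2.2.2
  have hmid : ∀ i, 0 < i → i < n → A v (p i) = 0 := by
    intro i hi hin
    by_contra hne
    exact p6 i hin ⟨hne, p7 i hi hin.le, hmem i hin.le⟩
  refine ⟨n, p, by omega, fun i hi => ?_, p4, p1 ▸ hw, p2.1, hmid, fun i hi => (p3 i hi).2.2.1,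
    fun i j hij hj hor => ?_⟩
  · exact (Finset.mem_erase.1 (hmem i hi)).symm
  · by_contra hne
    refine p5 i j hij hj ⟨hmem i (by omega), hmem j hj, hne, fun hb => ?_⟩
    rcases hor with h | h
    · exact hb.1 (hmid i h (by omega))
    · exact hb.2 (hmid j (by omega) h)

end rooted

section rooted
variable {V : Type*} [Fintype V] [DecidableEq V] {A : Matrix V V ℤ} {d : V → ℝ}

theorem wform_sum_sum {ι : Type*} (s : Finset ι) (f : ι → V → ℝ) (c : ι → ℝ) :
    wform A d (∑ i ∈ s, c i • f i) (∑ i ∈ s, c i • f i)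
      = ∑ i ∈ s, ∑ j ∈ s, c i * c j * wform A d (f i) (f j) := by
  simp only [map_sum, LinearMap.sum_apply, map_smul, LinearMap.smul_apply, smul_eq_mul,
    Finset.mul_sum]
  rw [Finset.sum_comm]
  exact Finset.sum_congr rfl fun i _ => Finset.sum_congr rfl fun j _ => by ring

theorem not_psdOn_of_cert {m : ℕ} {f : Fin m → V} (hf : Function.Injective f) {S : Finset V}
    (hS : ∀ i, f i ∈ S) (c : Fin m → ℝ)
    (h : ∑ i, d (f i) * c i ^ 2 + ∑ i, ∑ j, (A (f i) (f j) : ℝ) * (c i * c j) < 0) :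
    ¬ PSDOn A d S := by
  intro hp
  have := hp (∑ i, c i • Pi.single (f i) 1) fun x hx => by
    rw [Finset.sum_apply]
    refine Finset.sum_eq_zero fun i _ => ?_
    have : x ≠ f i := fun h => hx (h ▸ hS i)
    simp [this]
  rw [wform_sum_sum] at this
  simp only [wform_single_single, hf.eq_iff, mul_add, Finset.sum_add_distrib, mul_ite, mul_zero,
    Finset.sum_ite_eq, Finset.mem_univ, if_true] at this
  have e1 : ∑ i, c i * c i * d (f i) = ∑ i, d (f i) * c i ^ 2 :=
    Finset.sum_congr rfl fun i _ => by ring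
  have e2 : ∑ i, ∑ j, c i * c j * (A (f i) (f j) : ℝ) = ∑ i, ∑ j, (A (f i) (f j) : ℝ) * (c i * c j) :=
    Finset.sum_congr rfl fun i _ => Finset.sum_congr rfl fun j _ => by ring
  rw [e1, e2] at this
  linarith

theorem Fails.of_cert {m : ℕ} {f : Fin m → V} (hf : Function.Injective f) {θ X : ℝ} {v : V}
    {S : Finset V} (hS : ∀ i, f i ∈ S) (c : Fin m → ℝ)
    (h : ∑ i, rootDiag v X θ (f i) * c i ^ 2
      + ∑ i, ∑ j, (A (f i) (f j) : ℝ) * (c i * c j) < 0) : Fails A θ X v S m := by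
  refine ⟨Finset.univ.image f, ?_, ?_, not_psdOn_of_cert hf (by simp) c h⟩
  · intro x hx
    obtain ⟨i, _, rfl⟩ := Finset.mem_image.1 hx
    exact hS i
  · exact Finset.card_image_le.trans (by simp)

/-- A large entry gives a bad pair. -/
theorem not_psdOn_pair (hA : A.IsSymm) (h0 : ∀ i, A i i = 0) {x y : V} (hxy : x ≠ y) {S : Finset V}
    (hx : x ∈ S) (hy : y ∈ S) (h : d x + d y < 2 * |(A x y : ℝ)|) : ¬ PSDOn A d S := by
  have hf : Function.Injective ![x, y] := by
    intro i j; fin_cases i <;> fin_cases j <;> simp [hxy, hxy.symm]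
  have hmem : ∀ i, ![x, y] i ∈ S := by intro i; fin_cases i <;> simpa
  have hs : A y x = A x y := hA.apply x y
  rcases le_total 0 (A x y : ℝ) with h' | h'
  · rw [abs_of_nonneg h'] at h
    refine not_psdOn_of_cert hf hmem ![1, -1] ?_
    simp [Fin.sum_univ_succ, h0, hs]; linarith
  · rw [abs_of_nonpos h'] at h
    refine not_psdOn_of_cert hf hmem ![1, 1] ?_
    simp [Fin.sum_univ_succ, h0, hs]; linarith

theorem Fails.of_pair (hA : A.IsSymm) (h0 : ∀ i, A i i = 0) {x y v : V} (hxy : x ≠ y)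
    {S : Finset V} {θ X : ℝ} (hx : x ∈ S) (hy : y ∈ S)
    (h : rootDiag v X θ x + rootDiag v X θ y < 2 * |(A x y : ℝ)|) : Fails A θ X v S 2 :=
  ⟨{x, y}, by simp [Finset.insert_subset_iff, hx, hy], Finset.card_le_two,
    not_psdOn_pair hA h0 hxy (by simp) (by simp) h⟩

/-- A minimal bad set carries no vector in the kernel of the form. -/
theorem psdOn_of_null (hA : A.IsSymm) {v : V} {S : Finset V} (hc : Conn A v S)
    (hP : ∀ S', S' ⊂ S → Conn A v S' → PSDOn A d S') {y : V → ℝ} (hy : ∀ i, i ∉ S → y i = 0)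
    (horth : ∀ x ∈ S, wform A d (Pi.single x 1) y = 0) {s : V} (hs : s ∈ S) (hsv : s ≠ v)
    (hys : y s ≠ 0)
    (hreach : ∀ x, y x ≠ 0 → x ≠ s →
      Relation.ReflTransGen (fun a b => b ∈ S.erase s ∧ A a b ≠ 0) v x) : PSDOn A d S := by
  have hcs : Conn A v (S.erase s) := by
    refine ⟨Finset.mem_erase.2 ⟨hsv.symm, hc.1⟩, ?_⟩
    have : ∀ x ∈ S, x = s ∨ Relation.ReflTransGen (fun a b => b ∈ S.erase s ∧ A a b ≠ 0) v x := by
      refine hc.of_step (Or.inr .refl) fun a b ha hb hab => ?_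
      by_cases hbs : b = s
      · exact Or.inl hbs
      right
      have hbS : b ∈ S.erase s := Finset.mem_erase.2 ⟨hbs, hb⟩
      rcases ha with rfl | ha
      · by_cases hyb : y b = 0
        · have h1 := horth b hb
          rw [wform_single_left hA, hyb, mul_zero, zero_add,
            ← Finset.add_sum_erase _ _ (Finset.mem_univ a)] at h1
          have h2 : ∑ i ∈ Finset.univ.erase a, (A b i : ℝ) * y i ≠ 0 := by
            intro h2
            rw [h2, add_zero] at h1
            have : A b a = A a b := hA.apply a b
            rw [this] at h1
            exact mul_ne_zero (Int.cast_ne_zero.2 hab) hys h1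
          obtain ⟨x, hx, hx'⟩ := Finset.exists_ne_zero_of_sum_ne_zero h2
          have hxa := Finset.ne_of_mem_erase hx
          refine (hreach x (right_ne_zero_of_mul hx') hxa).tail ⟨hbS, ?_⟩
          have := left_ne_zero_of_mul hx'
          rw [← hA.apply]
          exact_mod_cast this
        · exact hreach b hyb hbs
      · exact ha.tail ⟨hbS, hab⟩
    exact fun x hx => (this x (Finset.mem_of_mem_erase hx)).resolve_left (Finset.ne_of_mem_erase hx)
  have hp := hP _ (Finset.erase_ssubset hs) hcs
  have hzy : ∀ z : V → ℝ, (∀ i, i ∉ S → z i = 0) → wform A d z y = 0 := by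
    intro z hz
    have hz' : z = vrestrict S z := by
      ext i; by_cases hi : i ∈ S <;> simp [vrestrict, hi, hz i]
    rw [hz', wform_symm hA, wform_vrestrict]
    exact Finset.sum_eq_zero fun i hi => by rw [wform_symm hA, horth i hi, mul_zero]
  intro z hz
  have h1 := hp (z + (-(z s / y s)) • y) fun i hi => by
    by_cases his : i = s
    · subst his; simp [hys]
    · have : i ∉ S := fun h => hi (Finset.mem_erase.2 ⟨his, h⟩)
      simp [hz i this, hy i this]
  rw [wform_self_add hA] at h1
  simpa [hzy z hz, hzy y hy] using h1

end rooted

section rooted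
variable {V : Type*} [Fintype V] [DecidableEq V] {A : Matrix V V ℤ} {d : V → ℝ}

theorem Fails.of_cert_three (hA : A.IsSymm) (h0 : ∀ i, A i i = 0) {θ X : ℝ} {v : V} {S : Finset V}
    {x y q : V} (hx : x ∈ S) (hy : y ∈ S) (hq : q ∈ S) (hxy : x ≠ y) (hxq : x ≠ q) (hyq : y ≠ q)
    (a b c : ℝ)
    (h : rootDiag v X θ x * a ^ 2 + rootDiag v X θ y * b ^ 2 + rootDiag v X θ q * c ^ 2
      + 2 * (A x y * (a * b) + A x q * (a * c) + A y q * (b * c)) < 0) : Fails A θ X v S 3 := by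
  have hf : Function.Injective ![x, y, q] := by
    intro i j
    fin_cases i <;> fin_cases j <;> simp [hxy, hxy.symm, hxq, hxq.symm, hyq, hyq.symm]
  refine Fails.of_cert hf (by intro i; fin_cases i <;> simpa) ![a, b, c] ?_
  have e1 : A y x = A x y := hA.apply x y
  have e2 : A q x = A x q := hA.apply x q
  have e3 : A q y = A y q := hA.apply y q
  simp [Fin.sum_univ_succ, h0, e1, e2, e3]
  linarith

theorem Fails.of_cert_four (hA : A.IsSymm) (h0 : ∀ i, A i i = 0) {θ X : ℝ} {v : V} {S : Finset V}
    {x y q : V} (hv : v ∈ S) (hx : x ∈ S) (hy : y ∈ S) (hq : q ∈ S) (hvx : x ≠ v) (hvy : y ≠ v)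
    (hvq : q ≠ v) (hxy : x ≠ y) (hxq : x ≠ q) (hyq : y ≠ q) (r a b c : ℝ)
    (h : X * r ^ 2 + θ * a ^ 2 + θ * b ^ 2 + θ * c ^ 2
      + 2 * (A v x * (r * a) + A v y * (r * b) + A v q * (r * c)
        + A x y * (a * b) + A x q * (a * c) + A y q * (b * c)) < 0) : Fails A θ X v S 4 := by
  have hf : Function.Injective ![v, x, y, q] := by
    intro i j
    fin_cases i <;> fin_cases j <;>
      simp [hxy, hxy.symm, hxq, hxq.symm, hyq, hyq.symm, hvx, hvx.symm, hvy, hvy.symm, hvq,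
        hvq.symm]
  refine Fails.of_cert hf (by intro i; fin_cases i <;> simpa) ![r, a, b, c] ?_
  have e1 : A y x = A x y := hA.apply x y
  have e2 : A q x = A x q := hA.apply x q
  have e3 : A q y = A y q := hA.apply y q
  have e4 : A x v = A v x := hA.apply v x
  have e5 : A y v = A v y := hA.apply v y
  have e6 : A q v = A v q := hA.apply v q
  simp [Fin.sum_univ_succ, h0, e1, e2, e3, e4, e5, e6, rootDiag_of_ne hvx, rootDiag_of_ne hvy,
    rootDiag_of_ne hvq]
  linarith

theorem Conn.reach_or {v : V} {S : Finset V} (hc : Conn A v S) {x y : V} (hx : x ∈ S) (hy : y ∈ S)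
    (hxv : x ≠ v) (hyv : y ≠ v) (hxy : x ≠ y) :
    Relation.ReflTransGen (fun a b => b ∈ S.erase y ∧ A a b ≠ 0) v x ∨
    Relation.ReflTransGen (fun a b => b ∈ S.erase x ∧ A a b ≠ 0) v y := by
  by_contra hcon
  push Not at hcon
  have : ∀ u ∈ S, u ≠ x ∧ u ≠ y ∧
      Relation.ReflTransGen (fun a b => b ∈ (S.erase y).erase x ∧ A a b ≠ 0) v u := by
    refine hc.of_step ⟨hxv.symm, hyv.symm, .refl⟩ fun a b ⟨_, _, ha⟩ hb hab => ?_
    have hbx : b ≠ x := by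
      rintro rfl
      refine hcon.1 (.tail ?_ ⟨Finset.mem_erase.2 ⟨hxy, hb⟩, hab⟩)
      exact Relation.ReflTransGen.mono (fun c e h => ⟨Finset.mem_of_mem_erase h.1, h.2⟩) _ _ ha
    have hby : b ≠ y := by
      rintro rfl
      refine hcon.2 (.tail ?_ ⟨Finset.mem_erase.2 ⟨hxy.symm, hb⟩, hab⟩)
      exact Relation.ReflTransGen.mono (fun c e h => ⟨Finset.mem_erase.2 ⟨(Finset.mem_erase.1 h.1).1,
        Finset.mem_of_mem_erase (Finset.mem_of_mem_erase h.1)⟩, h.2⟩) _ _ ha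
    exact ⟨hbx, hby, ha.tail ⟨Finset.mem_erase.2 ⟨hbx, Finset.mem_erase.2 ⟨hby, hb⟩⟩, hab⟩⟩
  exact (this x hx).1 rfl

theorem Fails.weaken {θ X : ℝ} {v : V} {S : Finset V} {M M' : ℕ} (h : Fails A θ X v S M)
    (hM : M ≤ M') : Fails A θ X v S M' := h.mono le_rfl subset_rfl hM

theorem rootDiag_le {v : V} {X θ : ℝ} (h : X ≤ θ) (x : V) : rootDiag v X θ x ≤ θ := by
  by_cases hx : x = v
  · subst hx; simpa
  · simp [rootDiag_of_ne hx]

/-- In a minimal bad set without small obstructions the entries are at most one. -/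
theorem abs_le_one_of_minimal (hA : A.IsSymm) (h0 : ∀ i, A i i = 0) {θ X : ℝ} {v : V}
    {S : Finset V} (hθ2 : θ < 2.0199) (hX2 : X < 1.151) (hXθ : X ≤ θ)
    (hc : Conn A v S) (hS : ¬ PSDOn A (rootDiag v 1 2) S)
    (hP : ∀ S', S' ⊂ S → Conn A v S' → PSDOn A (rootDiag v 1 2) S')
    (hF : ¬ Fails A θ X v S 3) {x y : V} (hx : x ∈ S) (hy : y ∈ S) : |A x y| ≤ 1 := by
  rcases eq_or_ne x y with rfl | hxy
  · simp [h0]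
  by_contra hcon
  push Not at hcon
  have hcon2 : (2 : ℤ) ≤ |A x y| := hcon
  have hpair : rootDiag v X θ x + rootDiag v X θ y ≥ 2 * |(A x y : ℝ)| := by
    by_contra h
    push Not at h
    exact hF ((Fails.of_pair hA h0 hxy hx hy h).weaken (by norm_num))
  have hcast : ((|A x y| : ℤ) : ℝ) = |(A x y : ℝ)| := by push_cast; rfl
  have hd1 := rootDiag_le (v := v) hXθ x
  have hd2 := rootDiag_le (v := v) hXθ y
  have habs : |A x y| = 2 := by
    refine le_antisymm ?_ hcon2
    by_contra h
    push Not at h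
    have : (3 : ℝ) ≤ ((|A x y| : ℤ) : ℝ) := by exact_mod_cast h
    rw [hcast] at this
    linarith
  have habs' : |(A x y : ℝ)| = 2 := by rw [← hcast, habs]; norm_num
  have hxv : x ≠ v := by
    rintro rfl
    rw [rootDiag_self, habs'] at hpair
    linarith
  have hyv : y ≠ v := by
    rintro rfl
    rw [rootDiag_self, habs'] at hpair
    linarith
  obtain ⟨e, he, he1⟩ : ∃ e : ℤ, A x y = 2 * e ∧ e ^ 2 = 1 := by
    rcases abs_eq (by norm_num : (0 : ℤ) ≤ 2) |>.1 habs with h | h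
    · exact ⟨1, by simp [h], by norm_num⟩
    · exact ⟨-1, by simp [h], by norm_num⟩
  have he1' : (e : ℝ) ^ 2 = 1 := by exact_mod_cast he1
  have hs : A y x = A x y := hA.apply x y
  set z : V → ℝ := Pi.single x 1 + (-(e : ℝ)) • Pi.single y 1 with hz
  have hBz : ∀ q, wform A (rootDiag v 1 2) (Pi.single q 1) z
      = ((if q = x then 2 else 0) + A q x) - e * ((if q = y then 2 else 0) + A q y) := by
    intro q
    rw [hz, map_add, map_smul, wform_single_single, wform_single_single, rootDiag_of_ne hxv,
      rootDiag_of_ne hyv, smul_eq_mul]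
    ring
  have horth : ∀ q ∈ S, wform A (rootDiag v 1 2) (Pi.single q 1) z = 0 := by
    intro q hq
    rw [hBz]
    by_cases hqx : q = x
    · subst hqx
      simp only [if_true, hxy, if_false, h0, he]
      push_cast; linear_combination (-2) * he1'
    by_cases hqy : q = y
    · subst hqy
      simp only [hqx, if_true, if_false, h0, hs, he]
      push_cast; ring
    simp only [hqx, hqy, if_false, zero_add]
    by_contra hm
    set m : ℤ := A q x - e * A q y with hmdef
    have hm' : m ≠ 0 := by
      intro h; apply hm
      have : ((A q x - e * A q y : ℤ) : ℝ) = 0 := by rw [← hmdef, h]; simp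
      push_cast at this; exact this
    have hm2 : (1 : ℝ) ≤ (m : ℝ) ^ 2 := by
      have : 1 ≤ m ^ 2 := by
        have := sq_pos_of_ne_zero hm'
        omega
      exact_mod_cast this
    have hmr : (m : ℝ) = A q x - e * A q y := by rw [hmdef]; push_cast; ring
    apply hF
    refine Fails.of_cert_three hA h0 hx hy hq hxy (Ne.symm hqx) (Ne.symm hqy) 1 (-e) (-m / 2) ?_
    have e1 : A x q = A q x := hA.apply q x
    have e2 : A y q = A q y := hA.apply q y
    rw [e1, e2, he, rootDiag_of_ne hxv, rootDiag_of_ne hyv]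
    have hd := rootDiag_le (v := v) hXθ q
    have : rootDiag v X θ q * (-m / 2) ^ 2 ≤ θ * (m ^ 2 / 4) := by
      have : (0 : ℝ) ≤ (m : ℝ) ^ 2 / 4 := by positivity
      nlinarith
    have e3 : 2 * (((2 * e : ℤ) : ℝ) * (1 * -(e : ℝ)) + (A q x : ℝ) * (1 * (-m / 2))
        + A q y * (-(e : ℝ) * (-m / 2))) = -4 - m ^ 2 := by
      push_cast
      linear_combination (-4) * he1' + (m : ℝ) * hmr
    rw [e3]
    nlinarith
  have hzS : ∀ i, i ∉ S → z i = 0 := by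
    intro i hi
    have h1 : i ≠ x := fun h => hi (h ▸ hx)
    have h2 : i ≠ y := fun h => hi (h ▸ hy)
    simp [hz, h1, h2]
  have hzx : z x = 1 := by simp [hz, hxy]
  have hzy : z y = -e := by simp [hz, hxy.symm]
  have hsupp : ∀ u, z u ≠ 0 → u = x ∨ u = y := by
    intro u hu
    by_contra h
    push Not at h
    exact hu (by simp [hz, h.1, h.2])
  rcases hc.reach_or hx hy hxv hyv hxy with h | h
  · refine hS (psdOn_of_null hA hc hP hzS horth hy hyv ?_ fun u hu huy => ?_)
    · rw [hzy]; intro h; rw [neg_eq_zero] at h; rw [h] at he1'; norm_num at he1'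
    · rcases hsupp u hu with rfl | rfl
      · exact h
      · exact absurd rfl huy
  · refine hS (psdOn_of_null hA hc hP hzS horth hx hxv ?_ fun u hu huy => ?_)
    · rw [hzx]; norm_num
    · rcases hsupp u hu with rfl | rfl
      · exact absurd rfl huy
      · exact h

end rooted

section rooted
variable {V : Type*} [Fintype V] [DecidableEq V] {A : Matrix V V ℤ} {d : V → ℝ}

theorem sq_eq_one_of_abs_le {a : ℤ} (h : |a| ≤ 1) (h0 : a ≠ 0) : a ^ 2 = 1 := by
  rcases abs_le.1 h with ⟨h1, h2⟩
  interval_cases a <;> simp_all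

/-- The certificate for a star of three edges, an edge path, or a triangle with a pendant. -/
theorem star_cert {θ X : ℝ} (hθ : 2 ≤ θ) (hθ2 : θ < 2.0199) (hX1 : 1 < X) (hX2 : X < 1.151)
    (hT : X - 1 / θ - 1 / (θ - 1 / θ) < 0) {x₁ x₂ w : ℤ} (h1 : |x₁| ≤ 1) (h2 : |x₂| ≤ 1)
    (hw : |w| ≤ 1) (hm : x₁ + x₂ - 2 * w ≠ 0) : ∃ r a b c : ℝ,
      X * r ^ 2 + θ * a ^ 2 + θ * b ^ 2 + θ * c ^ 2
      + 2 * (r * a + r * b + w * (r * c) + x₁ * (a * c) + x₂ * (b * c)) < 0 := by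
  have hT' : ∃ u t : ℝ, θ * u = 1 ∧ t * (θ - u) = 1 ∧ X - u - t < 0 := by
    have hne : θ - 1 / θ ≠ 0 := by
      have : 1 / θ ≤ 1 / 2 := one_div_le_one_div_of_le (by norm_num) hθ
      intro h; linarith
    exact ⟨1 / θ, 1 / (θ - 1 / θ), by field_simp, by rw [one_div_mul_cancel hne], hT⟩
  obtain ⟨u, t, hu, ht, hut⟩ := hT'
  obtain ⟨l1, l2⟩ := abs_le.1 h1
  obtain ⟨l3, l4⟩ := abs_le.1 h2
  obtain ⟨l5, l6⟩ := abs_le.1 hw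
  have gen : ∀ m : ℝ, (x₁ : ℝ) + x₂ - 2 * w = m → 4 ≤ m ^ 2 → ∃ r a b c : ℝ,
      X * r ^ 2 + θ * a ^ 2 + θ * b ^ 2 + θ * c ^ 2
      + 2 * (r * a + r * b + w * (r * c) + x₁ * (a * c) + x₂ * (b * c)) < 0 := by
    intro m hm hm2
    refine ⟨-2, 1, 1, -m / 2, ?_⟩
    have : 2 * ((-2 : ℝ) * 1 + (-2) * 1 + w * (-2 * (-m / 2)) + x₁ * (1 * (-m / 2))
        + x₂ * (1 * (-m / 2))) = -8 - m ^ 2 := by linear_combination (-m) * hm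
    rw [this]; nlinarith
  interval_cases x₁ <;> interval_cases x₂ <;> interval_cases w <;>
    first
    | exact absurd rfl hm
    | (refine gen _ rfl ?_; norm_num; done)
    | exact ⟨1, -t, -u, t * u, by
        push_cast; linear_combination hut + (u + t ^ 2 * u) * hu + t * ht⟩
    | exact ⟨1, -t, -u, -(t * u), by
        push_cast; linear_combination hut + (u + t ^ 2 * u) * hu + t * ht⟩
    | exact ⟨1, -u, -t, t * u, by
        push_cast; linear_combination hut + (u + t ^ 2 * u) * hu + t * ht⟩
    | exact ⟨1, -u, -t, -(t * u), by
        push_cast; linear_combination hut + (u + t ^ 2 * u) * hu + t * ht⟩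
    | exact ⟨6, -2, -3, -2, by push_cast; linarith⟩
    | exact ⟨6, -2, -3, 2, by push_cast; linarith⟩
    | exact ⟨6, -3, -2, -2, by push_cast; linarith⟩
    | exact ⟨6, -3, -2, 2, by push_cast; linarith⟩

/-- In a minimal bad set without small obstructions the neighbours of the root form a clique. -/
theorem adj_of_neighbours (hA : A.IsSymm) (h0 : ∀ i, A i i = 0) {θ X : ℝ} {v : V}
    {S : Finset V} (hθ : 2 ≤ θ) (hθ2 : θ < 2.0199) (hX1 : 1 < X) (hX2 : X < 1.151)
    (hT : X - 1 / θ - 1 / (θ - 1 / θ) < 0)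
    (hc : Conn A v S) (hS : ¬ PSDOn A (rootDiag v 1 2) S)
    (hP : ∀ S', S' ⊂ S → Conn A v S' → PSDOn A (rootDiag v 1 2) S')
    (hle : ∀ x ∈ S, ∀ y ∈ S, |A x y| ≤ 1)
    (hF : ¬ Fails A θ X v S 4) {x y : V} (hx : x ∈ S) (hy : y ∈ S) (hxy : x ≠ y)
    (hvx : A v x ≠ 0) (hvy : A v y ≠ 0) : A x y = A v x * A v y := by
  have hvS := hc.1
  have hxv : x ≠ v := by rintro rfl; exact hvx (h0 _)
  have hyv : y ≠ v := by rintro rfl; exact hvy (h0 _)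
  set a := A v x with ha
  set b := A v y with hb
  have ha2 : a ^ 2 = 1 := sq_eq_one_of_abs_le (hle v hvS x hx) hvx
  have hb2 : b ^ 2 = 1 := sq_eq_one_of_abs_le (hle v hvS y hy) hvy
  have ha2' : (a : ℝ) ^ 2 = 1 := by exact_mod_cast ha2
  have hb2' : (b : ℝ) ^ 2 = 1 := by exact_mod_cast hb2
  obtain ⟨r, hr⟩ : ∃ r, r = A x y * a * b := ⟨_, rfl⟩
  have hAr : A x y = r * a * b := by rw [hr]; linear_combination (-(A x y) * b ^ 2) * ha2 - A x y * hb2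
  have hr1 : |r| ≤ 1 := by
    rw [hr, abs_mul, abs_mul]
    have h1 := hle x hx y hy
    have h2 := hle v hvS x hx
    have h3 := hle v hvS y hy
    exact mul_le_one₀ (mul_le_one₀ h1 (abs_nonneg _) h2) (abs_nonneg _) h3
  have hyx : A y x = A x y := hA.apply x y
  have hxv' : A x v = a := hA.apply v x
  have hyv' : A y v = b := hA.apply v y
  have hr3 : r = -1 ∨ r = 0 ∨ r = 1 := by
    obtain ⟨h1, h2⟩ := abs_le.1 hr1
    omega
  rcases hr3 with rfl | rfl | rfl
  · exfalso
    refine hF ((Fails.of_cert_three hA h0 hvS hx hy hxv.symm hyv.symm hxy (-2) a b ?_).weaken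
      (by norm_num))
    rw [rootDiag_self, rootDiag_of_ne hxv, rootDiag_of_ne hyv, ← ha, ← hb, hAr]
    push_cast
    have e : X * (-2) ^ 2 + θ * (a : ℝ) ^ 2 + θ * (b : ℝ) ^ 2 + 2 * (a * (-2 * a) + b * (-2 * b)
        + -1 * a * b * (a * b)) = 4 * X + 2 * θ - 10 := by
      linear_combination (θ - 4 - 2 * (b : ℝ) ^ 2) * ha2' + (θ - 6) * hb2'
    rw [e]; linarith
  · exfalso
    simp only [zero_mul] at hAr
    set z : V → ℝ := (a : ℝ) • Pi.single x 1 + (b : ℝ) • Pi.single y 1 + (-2 : ℝ) • Pi.single v 1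
      with hz
    have hBz : ∀ q, wform A (rootDiag v 1 2) (Pi.single q 1) z
        = a * ((if q = x then 2 else 0) + A q x) + b * ((if q = y then 2 else 0) + A q y)
          - 2 * ((if q = v then 1 else 0) + A q v) := by
      intro q
      rw [hz, map_add, map_add, map_smul, map_smul, map_smul, wform_single_single,
        wform_single_single, wform_single_single, rootDiag_of_ne hxv,
        rootDiag_of_ne hyv, rootDiag_self, smul_eq_mul, smul_eq_mul, smul_eq_mul]
      ring
    have horth : ∀ q ∈ S, wform A (rootDiag v 1 2) (Pi.single q 1) z = 0 := by
      intro q hq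
      rw [hBz]
      by_cases hqx : q = x
      · subst hqx
        simp only [if_true, hxy, hxv, if_false, h0, hAr, hxv']
        push_cast; ring
      by_cases hqy : q = y
      · subst hqy
        simp only [hqx, hyv, if_true, if_false, h0, hyx, hAr, hyv']
        push_cast; ring
      by_cases hqv : q = v
      · subst hqv
        simp only [hqx, hqy, if_true, if_false, h0, ← ha, ← hb]
        push_cast; linear_combination ha2' + hb2'
      simp only [hqx, hqy, hqv, if_false, zero_add]
      by_contra hm
      have ha1 : |a| ≤ 1 := hle v hvS x hx
      have hb1 : |b| ≤ 1 := hle v hvS y hy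
      obtain ⟨r, α, β, γ, hcert⟩ := star_cert hθ hθ2 hX1 hX2 hT (x₁ := a * A q x)
        (x₂ := b * A q y) (w := A q v)
        (by rw [abs_mul]; exact mul_le_one₀ ha1 (abs_nonneg _) (hle q hq x hx))
        (by rw [abs_mul]; exact mul_le_one₀ hb1 (abs_nonneg _) (hle q hq y hy)) (hle q hq v hvS)
        (by intro h; apply hm; exact_mod_cast h)
      refine hF (Fails.of_cert_four hA h0 hvS hx hy hq hxv hyv hqv hxy (Ne.symm hqx) (Ne.symm hqy)
        r (a * α) (b * β) γ ?_)
      have e1 : A x q = A q x := hA.apply q x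
      have e2 : A y q = A q y := hA.apply q y
      have e3 : A v q = A q v := hA.apply q v
      rw [e1, e2, e3, hAr, ← ha, ← hb]
      push_cast at hcert ⊢
      linear_combination hcert + (θ * α ^ 2 + 2 * r * α) * ha2' + (θ * β ^ 2 + 2 * r * β) * hb2'
    refine hS (psdOn_of_null hA hc hP (y := z) (fun i hi => ?_) horth hx hxv ?_ fun u hu hux => ?_)
    · have h1 : i ≠ x := fun h => hi (h ▸ hx)
      have h2 : i ≠ y := fun h => hi (h ▸ hy)
      have h3 : i ≠ v := fun h => hi (h ▸ hvS)
      simp [hz, h1, h2, h3]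
    · have : z x = a := by simp [hz, hxy, hxv]
      rw [this]; exact_mod_cast hvx
    · by_cases huv : u = v
      · subst huv; exact .refl
      · have huy : u = y := by
          by_contra huy
          exact hu (by simp [hz, hux, huy, huv])
        subst huy
        exact .single ⟨Finset.mem_erase.2 ⟨hux, hy⟩, hvy⟩
  · rw [hAr]; ring

end rooted

section cycle
variable {W : Type*} [AddCommGroup W] [Module ℝ W]

/-- The Gram relations of a root `v` and a path of roots `s 0, …, s n` closing up at `v`. -/
structure CycleGram (B : LinearMap.BilinForm ℝ W) (v : W) (s : ℕ → W) (σ : ℝ) (n : ℕ) : Prop where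
  symm : ∀ x y, B x y = B y x
  two_le : 2 ≤ n
  sq : σ ^ 2 = 1
  vv : B v v = 1
  first : B v (s 0) = 1
  last : B v (s n) = σ
  inner : ∀ i, 0 < i → i < n → B v (s i) = 0
  self : ∀ i ≤ n, B (s i) (s i) = 2
  next : ∀ i < n, B (s i) (s (i + 1)) = -1
  far : ∀ i j, i + 1 < j → j ≤ n → (0 < i ∨ j < n) → B (s i) (s j) = 0
  ends : B (s 0) (s n) = σ

/-- The partial alternating sums along the path. -/
def cycleSum (v : W) (s : ℕ → W) (j : ℕ) : W := v - ∑ i ∈ Finset.range j, s i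

variable {B : LinearMap.BilinForm ℝ W} {v : W} {s : ℕ → W} {σ : ℝ} {n : ℕ}

theorem cycleSum_succ (j : ℕ) : cycleSum v s (j + 1) = cycleSum v s j - s j := by
  simp only [cycleSum, Finset.sum_range_succ]; abel

@[simp] theorem cycleSum_zero : cycleSum v s 0 = v := by simp [cycleSum]

namespace CycleGram

theorem path_pair (h : CycleGram B v s σ n) {i j : ℕ} (hi : i < n) (hj : j < n) :
    B (s j) (s i) = (if i = j then 2 else 0) - (if i = j + 1 then 1 else 0)
      - (if i + 1 = j then 1 else 0) := by
  rcases lt_trichotomy i j with hij | rfl | hij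
  · rw [h.symm]
    by_cases h1 : i + 1 = j
    · subst h1; rw [h.next i hi, if_neg (by omega), if_neg (by omega), if_pos rfl]; norm_num
    · rw [h.far i j (by omega) hj.le (Or.inr hj)]
      simp [h1, hij.ne, show i ≠ j + 1 by omega]
  · simp [h.self i hi.le]
  · by_cases h1 : i = j + 1
    · subst h1; rw [h.next j hj, if_neg (by omega), if_pos rfl, if_neg (by omega)]; norm_num
    · rw [h.far j i (by omega) hi.le (Or.inr hi)]
      simp [h1, hij.ne', show i + 1 ≠ j by omega]

theorem pair_cycleSum (h : CycleGram B v s σ n) {i j : ℕ} (hi : i ≤ n) (hj : j < n) :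
    B (s j) (cycleSum v s i) = (if i = j then 1 else 0) - (if i = j + 1 then 1 else 0) := by
  induction i with
  | zero =>
    rw [cycleSum_zero, h.symm]
    rcases Nat.eq_zero_or_pos j with rfl | hj0
    · simp [h.first]
    · simp [h.inner j hj0 hj, hj0.ne]
  | succ i ih =>
    rw [cycleSum_succ, map_sub, ih (by omega), h.path_pair (by omega) hj]
    split_ifs <;> first | omega | contradiction | norm_num

theorem last_cycleSum (h : CycleGram B v s σ n) {i : ℕ} (hi : i ≤ n) :
    B (s n) (cycleSum v s i) = (if i = 0 then σ else 0) + (if i = n then 1 else 0) := by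
  have := h.two_le
  induction i with
  | zero => rw [cycleSum_zero, h.symm, h.last]; simp; omega
  | succ i ih =>
    rw [cycleSum_succ, map_sub, ih (by omega), h.symm (s n), if_neg (Nat.succ_ne_zero i)]
    rcases Nat.eq_zero_or_pos i with rfl | hi0
    · rw [h.ends]; split_ifs <;> first | omega | contradiction | norm_num
    · by_cases hin : i + 1 = n
      · subst hin; rw [h.next i (by omega)]; split_ifs <;> first | omega | contradiction | norm_num
      · rw [h.far i n (by omega) le_rfl (Or.inl hi0)]; split_ifs <;> first | omega | contradiction | norm_num

theorem root_cycleSum (h : CycleGram B v s σ n) {i : ℕ} (hi : i ≤ n) :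
    B v (cycleSum v s i) = if i = 0 then 1 else 0 := by
  induction i with
  | zero => simp [h.vv]
  | succ i ih =>
    rw [cycleSum_succ, map_sub, ih (by omega)]
    rcases Nat.eq_zero_or_pos i with rfl | hi0
    · simp [h.first]
    · simp [h.inner i hi0 (by omega), hi0.ne']

theorem orthonormal (h : CycleGram B v s σ n) {i j : ℕ} (hi : i ≤ n) (hj : j ≤ n) :
    B (cycleSum v s j) (cycleSum v s i) = if i = j then 1 else 0 := by
  induction j with
  | zero => rw [cycleSum_zero, h.root_cycleSum hi]
  | succ j ih =>
    rw [cycleSum_succ, map_sub, LinearMap.sub_apply, ih (by omega), h.pair_cycleSum hi (by omega)]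
    ring

/-- The null vector of a closed path. -/
theorem null (h : CycleGram B v s σ n) :
    B v (cycleSum v s (n + 1) + σ • v) = 0 ∧ ∀ i ≤ n, B (s i) (cycleSum v s (n + 1) + σ • v) = 0 := by
  have h2 := h.two_le
  have hsq := h.sq
  constructor
  · rw [map_add, map_smul, cycleSum_succ, map_sub, h.root_cycleSum le_rfl, h.last, h.vv]
    simp; omega
  · intro i hi
    rw [map_add, map_smul, cycleSum_succ, map_sub]
    rcases hi.lt_or_eq with hi | rfl
    · rw [h.pair_cycleSum le_rfl hi, h.symm _ v]
      rcases Nat.eq_zero_or_pos i with rfl | hi0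
      · rw [h.ends, h.first, if_neg (by omega), if_neg (by omega)]; simp
      · rw [h.inner i hi0 hi]
        by_cases hin : i + 1 = n
        · subst hin; rw [h.next i hi]; simp
        · rw [h.far i n (by omega) le_rfl (Or.inl hi0), if_neg (by omega), if_neg (by omega)]
          simp
    · rw [h.last_cycleSum le_rfl, h.symm _ v, h.last, h.self i le_rfl]
      simp only [smul_eq_mul, if_true]
      rw [if_neg (by omega)]; linarith

theorem reverse (h : CycleGram B v s σ n) : CycleGram B v (fun i => σ • s (n - i)) σ n := by
  have hsq : σ * σ = 1 := by rw [← pow_two]; exact h.sq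
  have h2 := h.two_le
  refine ⟨h.symm, h.two_le, h.sq, h.vv, ?_, ?_, ?_, ?_, ?_, ?_, ?_⟩
  · simp [h.last, hsq]
  · simp [h.first]
  · intro i h0 hn; simp [h.inner (n - i) (by omega) (by omega)]
  · intro i hi
    simp only [map_smul, LinearMap.smul_apply, smul_eq_mul, h.self (n - i) (by omega)]
    rw [← mul_assoc, hsq, one_mul]
  · intro i hi
    simp only [map_smul, LinearMap.smul_apply, smul_eq_mul]
    rw [← mul_assoc, hsq, one_mul, h.symm]
    have := h.next (n - (i + 1)) (by omega)
    rwa [show n - (i + 1) + 1 = n - i by omega] at this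
  · intro i j hij hj hor
    simp only [map_smul, LinearMap.smul_apply, smul_eq_mul]
    rw [h.symm, h.far (n - j) (n - i) (by omega) (by omega) (by omega)]; simp
  · simp only [map_smul, LinearMap.smul_apply, smul_eq_mul]
    rw [← mul_assoc, hsq, one_mul, h.symm]; simpa using h.ends

theorem add_reverse {v : W} {s : ℕ → W} {j : ℕ} (hj : j ≤ n) (hσ : σ ^ 2 = 1) : cycleSum v s j
    + σ • cycleSum v (fun i => σ • s (n - i)) (n + 1 - j) = cycleSum v s (n + 1) + σ • v := by
  have e : ∑ i ∈ Finset.range (n + 1), s i = ∑ i ∈ Finset.range j, s i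
      + ∑ i ∈ Finset.range (n + 1 - j), s (n - i) := by
    conv_lhs => rw [show n + 1 = j + (n + 1 - j) by omega, Finset.sum_range_add]
    congr 1
    rw [← Finset.sum_range_reflect]
    refine Finset.sum_congr rfl fun i hi => ?_
    rw [Finset.mem_range] at hi
    congr 1; omega
  simp only [cycleSum, e, ← Finset.smul_sum, smul_sub, smul_smul, ← pow_two, hσ, one_smul]
  abel

/-- Bessel's inequality for the partial sums. -/
theorem bessel (h : CycleGram B v s σ n) {z : W} (hz : B z z = 2)
    (hpos : 0 ≤ B (z - ∑ j ∈ Finset.range (n + 1), B z (cycleSum v s j) • cycleSum v s j)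
      (z - ∑ j ∈ Finset.range (n + 1), B z (cycleSum v s j) • cycleSum v s j)) :
    ∑ j ∈ Finset.range (n + 1), B z (cycleSum v s j) ^ 2 ≤ 2 := by
  set f := fun j => B z (cycleSum v s j)
  have e1 : B z (∑ j ∈ Finset.range (n + 1), f j • cycleSum v s j)
      = ∑ j ∈ Finset.range (n + 1), f j ^ 2 := by
    rw [map_sum]
    exact Finset.sum_congr rfl fun j _ => by rw [map_smul, smul_eq_mul, pow_two]
  have e2 : B (∑ j ∈ Finset.range (n + 1), f j • cycleSum v s j)
      (∑ j ∈ Finset.range (n + 1), f j • cycleSum v s j)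
      = ∑ j ∈ Finset.range (n + 1), f j ^ 2 := by
    rw [map_sum]
    refine Finset.sum_congr rfl fun j hj => ?_
    rw [map_smul, map_sum, LinearMap.sum_apply, Finset.sum_eq_single j]
    · rw [map_smul, LinearMap.smul_apply,
        h.orthonormal (by simpa [Nat.lt_succ_iff] using hj) (by simpa [Nat.lt_succ_iff] using hj)]
      simp [pow_two]
    · intro b hb hbj
      rw [map_smul, LinearMap.smul_apply,
        h.orthonormal (by simpa [Nat.lt_succ_iff] using hj) (by simpa [Nat.lt_succ_iff] using hb),
        if_neg hbj.symm, smul_zero]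
    · exact fun hj' => absurd hj hj'
  change 0 ≤ B (z - ∑ j ∈ Finset.range (n + 1), f j • cycleSum v s j)
      (z - ∑ j ∈ Finset.range (n + 1), f j • cycleSum v s j) at hpos
  simp only [map_sub, LinearMap.sub_apply] at hpos
  rw [h.symm (∑ j ∈ Finset.range (n + 1), f j • cycleSum v s j) z, e1, e2, hz] at hpos
  change ∑ j ∈ Finset.range (n + 1), f j ^ 2 ≤ 2
  linarith

end CycleGram
end cycle

/-- The scaled form of a cycle through the root with 3 further vertices and one extra vertex. -/
def cycleForm3 (u w0 w1 w2 : ℤ) : ℤ × ℤ × ℤ × ℤ × ℤ → ℤ := fun (a, c0, c1, c2, b) =>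
  10000 * (a ^ 2 + 2 * (c0 ^ 2 + c1 ^ 2 + c2 ^ 2 + b ^ 2) + 2 * (a * c0 + a * c2 + c0 * c2
    - c0 * c1 - c1 * c2 + a * b * u + c0 * b * w0 + c1 * b * w1 + c2 * b * w2))
    + 199 * (c0 ^ 2 + c1 ^ 2 + c2 ^ 2 + b ^ 2) + 1510 * a ^ 2

theorem exists_cert3 : ∀ u ∈ [-1, 0, 1], ∀ w0 ∈ [-1, 0, 1], ∀ w1 ∈ [-1, 0, 1], ∀ w2 ∈ [-1, 0, 1],
    w0 + w1 + w2 - 2 * u = (1 : ℤ) → ∃ c ∈ [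
      (1, 0, 0, -1, 1), (-5, 1, 2, 3, -2), (5, -2, -3, -2, 2), (-5, 2, 1, 2, -2), (-5, 3, 2, 1, -2),
      (5, -2, -3, -4, 2), (5, -3, -4, -3, 2), (-5, 3, 2, 3, -2), (5, -4, -3, -2, 2)],
      cycleForm3 u w0 w1 w2 c < 0 := by
  unfold cycleForm3
  decide +kernel

/-- The scaled form of a cycle through the root with 4 further vertices and one extra vertex. -/
def cycleForm4 (u w0 w1 w2 w3 : ℤ) : ℤ × ℤ × ℤ × ℤ × ℤ × ℤ → ℤ := fun (a, c0, c1, c2, c3, b) =>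
  10000 * (a ^ 2 + 2 * (c0 ^ 2 + c1 ^ 2 + c2 ^ 2 + c3 ^ 2 + b ^ 2) + 2 * (a * c0 + a * c3 + c0 * c3
    - c0 * c1 - c1 * c2 - c2 * c3 + a * b * u + c0 * b * w0 + c1 * b * w1 + c2 * b * w2 + c3 * b * w3))
    + 199 * (c0 ^ 2 + c1 ^ 2 + c2 ^ 2 + c3 ^ 2 + b ^ 2) + 1510 * a ^ 2

theorem exists_cert4 : ∀ u ∈ [-1, 0, 1], ∀ w0 ∈ [-1, 0, 1], ∀ w1 ∈ [-1, 0, 1], ∀ w2 ∈ [-1, 0, 1], ∀ w3 ∈ [-1, 0, 1],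
    w0 + w1 + w2 + w3 - 2 * u = (1 : ℤ) → ∃ c ∈ [
      (1, 1, 1, 0, -1, 1), (4, 0, -1, -2, -3, 2), (4, -1, -2, -3, -2, 2), (4, -1, -2, -1, -2, 2),
      (4, -2, -3, -2, -1, 2), (-4, 1, 0, 1, 2, -2), (4, -2, -1, -2, -1, 2), (-4, 2, 1, 0, 1,
      -2), (4, -3, -2, -1, 0, 2), (4, -1, -2, -3, -4, 2), (-4, 2, 3, 4, 3, -2), (-4, 2, 3, 2,
      3, -2), (-4, 3, 4, 3, 2, -2), (-4, 2, 1, 2, 3, -2), (-4, 3, 2, 3, 2, -2), (4, -3, -2,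
      -1, -2, 2), (4, -4, -3, -2, -1, 2)],
      cycleForm4 u w0 w1 w2 w3 c < 0 := by
  unfold cycleForm4
  decide +kernel

/-- The scaled form of a cycle through the root with 5 further vertices and one extra vertex. -/
def cycleForm5 (u w0 w1 w2 w3 w4 : ℤ) : ℤ × ℤ × ℤ × ℤ × ℤ × ℤ × ℤ → ℤ := fun (a, c0, c1, c2, c3, c4, b) =>
  10000 * (a ^ 2 + 2 * (c0 ^ 2 + c1 ^ 2 + c2 ^ 2 + c3 ^ 2 + c4 ^ 2 + b ^ 2) + 2 * (a * c0 + a * c4 + c0 * c4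
    - c0 * c1 - c1 * c2 - c2 * c3 - c3 * c4 + a * b * u + c0 * b * w0 + c1 * b * w1 + c2 * b * w2 + c3 * b * w3 + c4 * b * w4))
    + 199 * (c0 ^ 2 + c1 ^ 2 + c2 ^ 2 + c3 ^ 2 + c4 ^ 2 + b ^ 2) + 1510 * a ^ 2

theorem exists_cert5 : ∀ u ∈ [-1, 0, 1], ∀ w0 ∈ [-1, 0, 1], ∀ w1 ∈ [-1, 0, 1], ∀ w2 ∈ [-1, 0, 1], ∀ w3 ∈ [-1, 0, 1], ∀ w4 ∈ [-1, 0, 1],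
    w0 + w1 + w2 + w3 + w4 - 2 * u = (1 : ℤ) → ∃ c ∈ [
      (1, 1, 1, 0, 0, -1, 1), (-1, 0, 0, 1, 1, 0, -1), (-1, -1, 0, 0, 1, 1, -1), (4, 0, 0, -1, -2,
      -3, 2), (3, 0, -1, -2, -3, -2, 2), (-3, 0, 1, 2, 1, 2, -2), (-3, 1, 2, 3, 2, 1, -2), (3,
      0, -1, 0, -1, -2, 2), (-3, 1, 2, 1, 2, 1, -2), (3, -1, -2, -1, 0, -1, 2), (3, -2, -3,
      -2, -1, 0, 2), (-3, 1, 0, 1, 2, 1, -2), (3, -1, 0, -1, 0, -1, 2), (-3, 2, 1, 2, 1, 0,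
      -2), (3, -1, 0, 1, 0, -1, 2), (3, -2, -1, 0, -1, 0, 2), (-3, 2, 1, 0, -1, 0, -2), (4,
      -3, -2, -1, 0, 0, 2), (1, 1, -1, -1, -1, -2, 1), (4, 0, -1, -2, -3, -4, 2), (-4, 1, 2,
      3, 4, 3, -2), (3, -1, -2, -3, -2, -3, 2), (-4, 2, 3, 4, 3, 2, -2), (3, -1, -2, -1, -2,
      -3, 2), (-3, 2, 3, 2, 3, 2, -2), (3, -2, -3, -2, -1, -2, 2), (-4, 3, 4, 3, 2, 1, -2),
      (-3, 1, 0, 1, 2, 3, -2), (-3, 2, 1, 2, 3, 2, -2), (-3, 2, 1, 2, 1, 2, -2), (-3, 3, 2, 3,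
      2, 1, -2), (3, -2, -1, 0, -1, -2, 2), (3, -3, -2, -1, -2, -1, 2), (-3, 3, 2, 1, 0, 1,
      -2), (-4, 4, 3, 2, 1, 0, -2)],
      cycleForm5 u w0 w1 w2 w3 w4 c < 0 := by
  unfold cycleForm5
  decide +kernel

section cycleCase
variable {V : Type*} [Fintype V] [DecidableEq V] {A : Matrix V V ℤ} {d : V → ℝ}

theorem cycleSum_apply_of_ne {v : V} {p : ℕ → V} {g : ℕ → ℝ} {j : ℕ} {x : V} (hv : x ≠ v)
    (hp : ∀ i < j, x ≠ p i) :
    cycleSum (Pi.single v 1 : V → ℝ) (fun i => g i • Pi.single (p i) 1) j x = 0 := by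
  simp only [cycleSum, Pi.sub_apply, Finset.sum_apply, Pi.smul_apply, smul_eq_mul]
  rw [Pi.single_eq_of_ne hv, Finset.sum_eq_zero, sub_zero]
  intro i hi
  rw [Pi.single_eq_of_ne (hp i (Finset.mem_range.1 hi)), mul_zero]

theorem cycleSum_apply_path {v : V} {p : ℕ → V} {g : ℕ → ℝ} {j : ℕ} {i : ℕ} (hi : i < j)
    (hv : p i ≠ v) (hp : ∀ i' < j, i' ≠ i → p i' ≠ p i) :
    cycleSum (Pi.single v 1 : V → ℝ) (fun i => g i • Pi.single (p i) 1) j (p i) = - g i := by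
  simp only [cycleSum, Pi.sub_apply, Finset.sum_apply, Pi.smul_apply, smul_eq_mul]
  rw [Pi.single_eq_of_ne hv, Finset.sum_eq_single i]
  · simp
  · intro b hb hbi
    rw [Pi.single_eq_of_ne (hp b (Finset.mem_range.1 hb) hbi).symm, mul_zero]
  · exact fun h => absurd (Finset.mem_range.2 hi) h

theorem bessel_of_minimal (hA : A.IsSymm) (h0 : ∀ i, A i i = 0) {v z : V} {S : Finset V}
    {p : ℕ → V} {g : ℕ → ℝ} {σ : ℝ} {n : ℕ}
    (hP : ∀ S', S' ⊂ S → Conn A v S' → PSDOn A d S')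
    (hg : CycleGram (wform A d) (Pi.single v 1) (fun i => g i • Pi.single (p i) 1) σ n)
    (hvS : v ∈ S) (hp : ∀ i ≤ n, p i ∈ S ∧ p i ≠ v) (hinj : ∀ i < n, p i ≠ p n)
    (hfirst : A v (p 0) ≠ 0) (hnext : ∀ i < n, A (p i) (p (i + 1)) ≠ 0)
    (hz : z ∈ S) (hzv : z ≠ v) (hzp : ∀ i ≤ n, z ≠ p i) (hdz : d z = 2) :
    ∑ j ∈ Finset.range (n + 1), wform A d (Pi.single z 1)
      (cycleSum (Pi.single v 1) (fun i => g i • Pi.single (p i) 1) j) ^ 2 ≤ 2 := by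
  set T : Finset V := insert z (insert v ((Finset.range n).image p)) with hT
  have hpT : ∀ i < n, p i ∈ T := fun i hi => by
    simp only [hT, Finset.mem_insert, Finset.mem_image, Finset.mem_range]
    exact Or.inr (Or.inr ⟨i, hi, rfl⟩)
  have hvT : v ∈ T := by simp [hT]
  have hzT : z ∈ T := by simp [hT]
  by_cases hadj : A v z ≠ 0 ∨ ∃ i < n, A (p i) z ≠ 0
  · refine hg.bessel (by rw [wform_single_single]; simp [hdz, h0]) (hP T ?_ ?_ _ ?_)
    · refine Finset.ssubset_iff_subset_ne.2 ⟨?_, ?_⟩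
      · intro x hx
        simp only [hT, Finset.mem_insert, Finset.mem_image, Finset.mem_range] at hx
        rcases hx with rfl | rfl | ⟨i, hi, rfl⟩
        exacts [hz, hvS, (hp i hi.le).1]
      · intro h
        have := h ▸ (hp n le_rfl).1
        simp only [hT, Finset.mem_insert, Finset.mem_image, Finset.mem_range] at this
        rcases this with h | h | ⟨i, hi, h⟩
        exacts [hzp n le_rfl h.symm, (hp n le_rfl).2 h, hinj i hi h]
    · have reach : ∀ i < n, Relation.ReflTransGen (fun a b => b ∈ T ∧ A a b ≠ 0) v (p i) := by
        intro i hi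
        induction i with
        | zero => exact .single ⟨hpT 0 hi, hfirst⟩
        | succ i ih => exact (ih (by omega)).tail ⟨hpT _ hi, hnext i (by omega)⟩
      refine ⟨hvT, fun x hx => ?_⟩
      have hx' := hx
      simp only [hT, Finset.mem_insert, Finset.mem_image, Finset.mem_range] at hx'
      rcases hx' with rfl | rfl | ⟨i, hi, rfl⟩
      · rcases hadj with h | ⟨i, hi, h⟩
        · exact .single ⟨hx, h⟩
        · exact (reach i hi).tail ⟨hx, h⟩
      · exact .refl
      · exact reach i hi
    · intro x hx
      simp only [Pi.sub_apply, Finset.sum_apply, Pi.smul_apply, smul_eq_mul]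
      have hxz : x ≠ z := fun h => hx (h ▸ hzT)
      rw [Pi.single_eq_of_ne hxz, Finset.sum_eq_zero, sub_zero]
      intro j hj
      rw [Finset.mem_range] at hj
      have hxp : ∀ i < j, x ≠ p i := fun i hi h => hx (h ▸ hpT i (by omega))
      have hxv : x ≠ v := fun h => hx (h ▸ hvT)
      rw [cycleSum_apply_of_ne hxv hxp, mul_zero]
  · push Not at hadj
    rw [Finset.sum_eq_zero]
    · norm_num
    intro j hj
    rw [Finset.mem_range] at hj
    rw [cycleSum, map_sub, map_sum, wform_single_single, if_neg hzv, hA.apply, hadj.1,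
      Finset.sum_eq_zero]
    · simp
    intro i hi
    rw [Finset.mem_range] at hi
    rw [map_smul, wform_single_single, if_neg (hzp i (by omega)), hA.apply,
      hadj.2 i (by omega)]
    simp

/-- The value of the rooted form on a combination of a cycle and one more vertex. -/
theorem wform_cycle_add {W : Type*} [AddCommGroup W] [Module ℝ W] {B : LinearMap.BilinForm ℝ W}
    (hB : ∀ x y, B x y = B y x) (r y z : W) (a b : ℝ) :
    B (a • r + y + b • z) (a • r + y + b • z) = a ^ 2 * B r r + B y y + b ^ 2 * B z z
      + 2 * a * B r y + 2 * a * b * B r z + 2 * b * B z y := by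
  simp only [map_add, map_smul, LinearMap.add_apply, LinearMap.smul_apply, smul_eq_mul]
  rw [hB y r, hB z r, hB y z]; ring

end cycleCase

section cycleBorder

theorem CycleGram.wpair {W : Type*} [AddCommGroup W] [Module ℝ W] {B : LinearMap.BilinForm ℝ W}
    {v : W} {s : ℕ → W} {σ : ℝ} {n : ℕ} (h : CycleGram B v s σ n) {i j : ℕ} (hi : i ≤ n)
    (hj : j ≤ n) : B (s i) (s j) = if i = j then 2 else if i + 1 = j ∨ j + 1 = i then -1 else
      if (i = 0 ∧ j = n) ∨ (i = n ∧ j = 0) then σ else 0 := by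
  have key : ∀ i j, i < j → j ≤ n → B (s i) (s j) = if i + 1 = j then -1 else
      if i = 0 ∧ j = n then σ else 0 := by
    intro i j hij hj
    by_cases h1 : i + 1 = j
    · subst h1; simp [h.next i (by omega)]
    · rw [if_neg h1]
      by_cases h2 : i = 0 ∧ j = n
      · obtain ⟨rfl, rfl⟩ := h2; simp [h.ends]
      · rw [if_neg h2, h.far i j (by omega) hj (by omega)]
  rcases lt_trichotomy i j with hij | rfl | hij
  · rw [key i j hij hj]
    split_ifs <;> first | omega | rfl
  · simp [h.self i hi]
  · rw [h.symm, key j i hij hi]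
    split_ifs <;> first | omega | rfl

variable {V : Type*} [Fintype V] [DecidableEq V] {A : Matrix V V ℤ} {d : V → ℝ}

theorem mem_list_of_abs_le_one {a : ℤ} (h : |a| ≤ 1) : a ∈ [-1, 0, 1] := by
  rcases abs_le.1 h with ⟨h1, h2⟩
  interval_cases a <;> simp

/-- The value of the rooted form on a combination of a cycle and one more vertex. -/
theorem wform_cycle {B B' : LinearMap.BilinForm ℝ (V → ℝ)} {r z : V → ℝ} {s : ℕ → V → ℝ}
    {σ θ X : ℝ} {n : ℕ} {w : ℕ → ℝ} {u : ℝ} (h : CycleGram B r s σ n)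
    (hs : ∀ i ≤ n, ∀ j ≤ n, B' (s i) (s j) = B (s i) (s j) + if i = j then θ - 2 else 0)
    (hB : ∀ x y, B' x y = B' y x) (hr : B' r r = X) (hzz : B' z z = θ)
    (hrs : ∀ i ≤ n, B' r (s i) = B r (s i)) (hrz : B' r z = u) (hzs : ∀ i ≤ n, B' z (s i) = w i)
    (a b : ℝ) (c : ℕ → ℝ) :
    B' (a • r + ∑ i ∈ Finset.range (n + 1), c i • s i + b • z)
      (a • r + ∑ i ∈ Finset.range (n + 1), c i • s i + b • z)
      = a ^ 2 * X + b ^ 2 * θ + 2 * a * b * u + 2 * a * (c 0 + σ * c n)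
        + 2 * b * ∑ i ∈ Finset.range (n + 1), c i * w i
        + ∑ i ∈ Finset.range (n + 1), ∑ j ∈ Finset.range (n + 1), c i * c j *
          (if i = j then θ else if i + 1 = j ∨ j + 1 = i then -1 else
            if (i = 0 ∧ j = n) ∨ (i = n ∧ j = 0) then σ else 0) := by
  have h2 := h.two_le
  rw [wform_cycle_add hB, hr, hzz, hrz]
  have e1 : B' r (∑ i ∈ Finset.range (n + 1), c i • s i) = c 0 + σ * c n := by
    rw [map_sum, Finset.sum_range_succ, Finset.sum_eq_single 0]
    · simp [hrs 0 (by omega), hrs n le_rfl, h.first, h.last]; ring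
    · intro b hb hb0
      rw [Finset.mem_range] at hb
      rw [map_smul, hrs b hb.le, h.inner b (by omega) hb, smul_zero]
    · exact fun h => absurd (Finset.mem_range.2 (by omega)) h
  have e2 : B' z (∑ i ∈ Finset.range (n + 1), c i • s i)
      = ∑ i ∈ Finset.range (n + 1), c i * w i := by
    rw [map_sum]
    refine Finset.sum_congr rfl fun i hi => ?_
    rw [Finset.mem_range] at hi
    rw [map_smul, hzs i (by omega), smul_eq_mul]
  have e3 : B' (∑ i ∈ Finset.range (n + 1), c i • s i) (∑ i ∈ Finset.range (n + 1), c i • s i)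
      = ∑ i ∈ Finset.range (n + 1), ∑ j ∈ Finset.range (n + 1), c i * c j *
          (if i = j then θ else if i + 1 = j ∨ j + 1 = i then -1 else
            if (i = 0 ∧ j = n) ∨ (i = n ∧ j = 0) then σ else 0) := by
    simp only [map_sum, LinearMap.sum_apply, map_smul, LinearMap.smul_apply, smul_eq_mul]
    simp only [Finset.mul_sum]
    rw [Finset.sum_comm]
    refine Finset.sum_congr rfl fun i hi => Finset.sum_congr rfl fun j hj => ?_
    rw [Finset.mem_range] at hi hj
    rw [hs i (by omega) j (by omega), h.wpair (by omega) (by omega)]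
    split_ifs <;> ring
  rw [e1, e2, e3]; ring

theorem int_sq_of_sq_real {m : ℤ} (h : m ≠ 0) (h1 : ¬ (m = 1 ∨ m = -1)) : 4 ≤ (m : ℝ) ^ 2 := by
  have : 2 ≤ |m| := by
    by_contra hc
    rcases abs_lt.1 (not_le.1 hc) with ⟨h2, h3⟩
    interval_cases m <;> simp_all
  have : (2 : ℝ) ≤ |(m : ℝ)| := by exact_mod_cast this
  rw [← sq_abs]; nlinarith

theorem exists_negative_cycle {n : ℕ} (hn2 : 2 ≤ n) (hn4 : n ≤ 4) {θ X : ℝ}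
    (hθ2 : θ < 2.0199) (hX1 : 1 < X) (hX2 : X < 1.151) {σ : ℤ} (hσ : σ = 1 ∨ σ = -1) {u : ℤ}
    {w : ℕ → ℤ} (hu : |u| ≤ 1) (hw : ∀ i ≤ n, |w i| ≤ 1)
    (hm : ∑ i ∈ Finset.range (n + 1), w i - (1 + σ) * u ≠ 0) :
    ∃ (a b : ℝ) (c : ℕ → ℝ), a ^ 2 * X + b ^ 2 * θ + 2 * a * b * u + 2 * a * (c 0 + σ * c n)
        + 2 * b * ∑ i ∈ Finset.range (n + 1), c i * w i
        + ∑ i ∈ Finset.range (n + 1), ∑ j ∈ Finset.range (n + 1), c i * c j *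
          (if i = j then θ else if i + 1 = j ∨ j + 1 = i then -1 else
            if (i = 0 ∧ j = n) ∨ (i = n ∧ j = 0) then (σ : ℝ) else 0) < 0 := by
  set m : ℤ := ∑ i ∈ Finset.range (n + 1), w i - (1 + σ) * u with hmd
  have hmr : (m : ℝ) = ∑ i ∈ Finset.range (n + 1), (w i : ℝ) - (1 + σ) * u := by
    rw [hmd]; push_cast; ring
  have hm1 : (1 : ℝ) ≤ (m : ℝ) ^ 2 := by
    have : 1 ≤ m ^ 2 := by
      have := sq_nonneg m
      rcases (this.lt_or_eq) with h | h
      · exact h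
      · exact absurd (pow_eq_zero_iff (two_ne_zero) |>.1 h.symm) hm
    exact_mod_cast this
  by_cases hgen : σ = -1 ∨ ¬ (m = 1 ∨ m = -1)
  · refine ⟨-(1 + σ), -(m : ℝ) / 2, fun _ => 1, ?_⟩
    have hval : (σ = -1 ∨ (σ = 1 ∧ (4 : ℝ) ≤ (m : ℝ) ^ 2)) := by
      rcases hσ with h | h
      · exact Or.inr ⟨h, int_sq_of_sq_real hm (by rcases hgen with h' | h'; omega; exact h')⟩
      · exact Or.inl h
    have e : ∑ i ∈ Finset.range (n + 1), (1 : ℝ) * (w i : ℝ) = m + (1 + σ) * u := by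
      rw [hmr]; simp
    rw [e]
    have hθm := mul_nonneg (sub_nonneg.2 hθ2.le) (sub_nonneg.2 hm1)
    clear_value m
    clear hgen e hmr
    rcases hval with rfl | ⟨rfl, h4⟩ <;> interval_cases n <;>
      simp [Finset.sum_range_succ] <;> ring_nf at hθm ⊢ <;> linarith
  · push Not at hgen
    obtain ⟨h1, h2⟩ := hgen
    have hσ1 : σ = 1 := by omega
    subst hσ1
    have main : ∀ (u : ℤ) (w : ℕ → ℤ), |u| ≤ 1 → (∀ i ≤ n, |w i| ≤ 1) →
        ∑ i ∈ Finset.range (n + 1), w i - 2 * u = 1 →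
        ∃ (a b : ℝ) (c : ℕ → ℝ), a ^ 2 * X + b ^ 2 * θ + 2 * a * b * u + 2 * a * (c 0 + c n)
        + 2 * b * ∑ i ∈ Finset.range (n + 1), c i * w i
        + ∑ i ∈ Finset.range (n + 1), ∑ j ∈ Finset.range (n + 1), c i * c j *
          (if i = j then θ else if i + 1 = j ∨ j + 1 = i then -1 else
            if (i = 0 ∧ j = n) ∨ (i = n ∧ j = 0) then (1 : ℝ) else 0) < 0 := by
      intro u w hu hw hs
      interval_cases n
      · obtain ⟨⟨a, c0, c1, c2, b⟩, -, hc⟩ := exists_cert3 u (mem_list_of_abs_le_one hu)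
          (w 0) (mem_list_of_abs_le_one (hw _ (by norm_num))) (w 1) (mem_list_of_abs_le_one (hw _ (by norm_num)))
          (w 2) (mem_list_of_abs_le_one (hw _ (by norm_num))) (by simpa [Finset.sum_range_succ] using hs)
        refine ⟨a, b, fun i => ![(c0 : ℝ), c1, c2, 0, 0] (Fin.ofNat 5 i), ?_⟩
        simp only [cycleForm3] at hc
        have hc' := (Int.cast_lt (R := ℝ)).2 hc
        push_cast at hc'
        simp [Finset.sum_range_succ, Fin.ofNat]
        nlinarith [mul_nonneg (sub_nonneg.2 hX2.le) (sq_nonneg (a : ℝ)),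
          mul_nonneg (sub_nonneg.2 hθ2.le) (add_nonneg (add_nonneg (sq_nonneg (c0 : ℝ)) (sq_nonneg (c1 : ℝ))) (add_nonneg (sq_nonneg (c2 : ℝ)) (sq_nonneg (b : ℝ))))]
      · obtain ⟨⟨a, c0, c1, c2, c3, b⟩, -, hc⟩ := exists_cert4 u (mem_list_of_abs_le_one hu)
          (w 0) (mem_list_of_abs_le_one (hw _ (by norm_num))) (w 1) (mem_list_of_abs_le_one (hw _ (by norm_num)))
          (w 2) (mem_list_of_abs_le_one (hw _ (by norm_num))) (w 3) (mem_list_of_abs_le_one (hw _ (by norm_num)))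
          (by simpa [Finset.sum_range_succ] using hs)
        refine ⟨a, b, fun i => ![(c0 : ℝ), c1, c2, c3, 0] (Fin.ofNat 5 i), ?_⟩
        simp only [cycleForm4] at hc
        have hc' := (Int.cast_lt (R := ℝ)).2 hc
        push_cast at hc'
        simp [Finset.sum_range_succ, Fin.ofNat]
        nlinarith [mul_nonneg (sub_nonneg.2 hX2.le) (sq_nonneg (a : ℝ)),
          mul_nonneg (sub_nonneg.2 hθ2.le) (add_nonneg (add_nonneg (add_nonneg (sq_nonneg (c0 : ℝ)) (sq_nonneg (c1 : ℝ))) (add_nonneg (sq_nonneg (c2 : ℝ)) (sq_nonneg (b : ℝ)))) (sq_nonneg (c3 : ℝ)))]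
      · obtain ⟨⟨a, c0, c1, c2, c3, c4, b⟩, -, hc⟩ := exists_cert5 u (mem_list_of_abs_le_one hu)
          (w 0) (mem_list_of_abs_le_one (hw _ (by norm_num))) (w 1) (mem_list_of_abs_le_one (hw _ (by norm_num)))
          (w 2) (mem_list_of_abs_le_one (hw _ (by norm_num))) (w 3) (mem_list_of_abs_le_one (hw _ (by norm_num)))
          (w 4) (mem_list_of_abs_le_one (hw _ (by norm_num)))
          (by simpa [Finset.sum_range_succ] using hs)
        refine ⟨a, b, fun i => ![(c0 : ℝ), c1, c2, c3, c4] (Fin.ofNat 5 i), ?_⟩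
        simp only [cycleForm5] at hc
        have hc' := (Int.cast_lt (R := ℝ)).2 hc
        push_cast at hc'
        simp [Finset.sum_range_succ, Fin.ofNat]
        nlinarith [mul_nonneg (sub_nonneg.2 hX2.le) (sq_nonneg (a : ℝ)),
          mul_nonneg (sub_nonneg.2 hθ2.le) (add_nonneg (add_nonneg (add_nonneg (add_nonneg (sq_nonneg (c0 : ℝ)) (sq_nonneg (c1 : ℝ))) (add_nonneg (sq_nonneg (c2 : ℝ)) (sq_nonneg (b : ℝ)))) (sq_nonneg (c3 : ℝ))) (sq_nonneg (c4 : ℝ)))]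
    by_cases hm1' : m = 1
    · obtain ⟨a, b, c, h⟩ := main u w hu hw (by rw [hmd] at hm1'; linarith)
      exact ⟨a, b, c, by simpa using h⟩
    · have hm2 : m = -1 := h2.resolve_left hm1'
      obtain ⟨a, b, c, h⟩ := main (-u) (fun i => - w i) (by simpa using hu) (by simpa using hw)
        (by rw [hmd] at hm2; simp only [Finset.sum_neg_distrib]; linarith)
      refine ⟨a, -b, c, ?_⟩
      have e : -b * ∑ i ∈ Finset.range (n + 1), c i * (w i : ℝ)
          = b * ∑ i ∈ Finset.range (n + 1), c i * ((- w i : ℤ) : ℝ) := by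
        rw [Finset.mul_sum, Finset.mul_sum]
        exact Finset.sum_congr rfl fun i _ => by push_cast; ring
      rw [mul_assoc 2 (-b), e]
      push_cast at h ⊢
      linarith
end cycleBorder

section cycleFull
variable {V : Type*} [Fintype V] [DecidableEq V] {A : Matrix V V ℤ} {d : V → ℝ}

/-- The signs making consecutive entries along a path equal to `-1`. -/
def pathSign (A : Matrix V V ℤ) (v : V) (p : ℕ → V) : ℕ → ℤ
  | 0 => A v (p 0)
  | i + 1 => - pathSign A v p i * A (p i) (p (i + 1))

theorem cycleSum_int {v z : V} {p : ℕ → V} {g : ℕ → ℤ} {j : ℕ} (hzv : z ≠ v)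
    (hzp : ∀ i < j, z ≠ p i) : ∃ f : ℤ, wform A d (Pi.single z 1)
      (cycleSum (Pi.single v 1) (fun i => (g i : ℝ) • Pi.single (p i) 1) j) = f := by
  refine ⟨A z v - ∑ i ∈ Finset.range j, g i * A z (p i), ?_⟩
  rw [cycleSum, map_sub, map_sum, wform_single_single, if_neg hzv]
  push_cast
  rw [zero_add]
  congr 1
  refine Finset.sum_congr rfl fun i hi => ?_
  rw [map_smul, wform_single_single, if_neg (hzp i (Finset.mem_range.1 hi))]
  simp

theorem fails_of_path (hA : A.IsSymm) (h0 : ∀ i, A i i = 0) {θ X : ℝ} {v : V} {S : Finset V}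
    (hθ2 : θ < 2.0199) (hX1 : 1 < X) (hX2 : X < 1.151)
    (hc : Conn A v S) (hS : ¬ PSDOn A (rootDiag v 1 2) S)
    (hP : ∀ S', S' ⊂ S → Conn A v S' → PSDOn A (rootDiag v 1 2) S')
    (hle : ∀ x ∈ S, ∀ y ∈ S, |A x y| ≤ 1) {n : ℕ} {p : ℕ → V} (hn : 2 ≤ n)
    (hp : ∀ i ≤ n, p i ∈ S ∧ p i ≠ v) (hinj : ∀ i j, i < j → j ≤ n → p i ≠ p j)
    (hfirst : A v (p 0) ≠ 0) (hlast : A v (p n) ≠ 0)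
    (hinner : ∀ i, 0 < i → i < n → A v (p i) = 0) (hnext : ∀ i < n, A (p i) (p (i + 1)) ≠ 0)
    (hfar : ∀ i j, i + 1 < j → j ≤ n → (0 < i ∨ j < n) → A (p i) (p j) = 0)
    (hends : A (p 0) (p n) = A v (p 0) * A v (p n)) : Fails A θ X v S 7 := by
  have hvS := hc.1
  set g : ℕ → ℤ := pathSign A v p with hgdef
  have hg2 : ∀ i ≤ n, g i ^ 2 = 1 := by
    intro i hi
    induction i with
    | zero => exact sq_eq_one_of_abs_le (hle _ hvS _ (hp 0 hi).1) hfirst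
    | succ i ih =>
      have : A (p i) (p (i + 1)) ^ 2 = 1 :=
        sq_eq_one_of_abs_le (hle _ (hp i (by omega)).1 _ (hp _ hi).1) (hnext i (by omega))
      change (- g i * A (p i) (p (i + 1))) ^ 2 = 1
      rw [mul_pow, this, neg_sq, ih (by omega), one_mul]
  have hne : ∀ i ≤ n, ∀ j ≤ n, p i = p j ↔ i = j := by
    intro i hi j hj
    refine ⟨fun h => ?_, fun h => h ▸ rfl⟩
    rcases lt_trichotomy i j with hij | hij | hij
    · exact absurd h (hinj i j hij hj)
    · exact hij
    · exact absurd h.symm (hinj j i hij hi)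
  set s : ℕ → V → ℝ := fun i => (g i : ℝ) • Pi.single (p i) 1 with hsdef
  set r : V → ℝ := Pi.single v 1 with hrdef
  have hrs : ∀ d : V → ℝ, ∀ i ≤ n, wform A d r (s i) = g i * A v (p i) := fun d i hi => by
    rw [hsdef, map_smul, wform_single_single, if_neg (hp i hi).2.symm]; simp
  have hss : ∀ d : V → ℝ, ∀ i ≤ n, ∀ j ≤ n, wform A d (s i) (s j)
      = g i * g j * A (p i) (p j) + if i = j then d (p i) else 0 := fun d i hi j hj => by
    simp only [hsdef, map_smul, LinearMap.smul_apply, smul_eq_mul, wform_single_single,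
      hne i hi j hj]
    split_ifs with h
    · subst h
      have : (g i : ℝ) ^ 2 = 1 := by exact_mod_cast hg2 i hi
      linear_combination d (p i) * this
    · ring
  set σ : ℤ := g n * A v (p n) with hσdef
  have hσ2 : σ ^ 2 = 1 := by
    rw [hσdef, mul_pow, hg2 n le_rfl, sq_eq_one_of_abs_le (hle _ hvS _ (hp n le_rfl).1) hlast]; rfl
  have hg : CycleGram (wform A (rootDiag v 1 2)) r s σ n := by
    refine ⟨wform_symm hA, hn, by exact_mod_cast hσ2, ?_, ?_, ?_, ?_, ?_, ?_, ?_, ?_⟩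
    · rw [hrdef, wform_single_single]; simp [h0]
    · rw [hrs _ 0 (by omega)]
      have := hg2 0 (by omega)
      rw [sq] at this
      exact_mod_cast this
    · rw [hrs _ n le_rfl, hσdef]; push_cast; rfl
    · intro i h1 h2
      rw [hrs _ i h2.le, hinner i h1 h2]; simp
    · intro i hi
      rw [hss _ i hi i hi, rootDiag_of_ne (hp i hi).2, h0]; simp
    · intro i hi
      rw [hss _ i hi.le _ hi, if_neg (by omega)]
      have h1 := hg2 i hi.le
      have h2 : A (p i) (p (i + 1)) ^ 2 = 1 :=
        sq_eq_one_of_abs_le (hle _ (hp i hi.le).1 _ (hp _ hi).1) (hnext i hi)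
      have : g i * g (i + 1) * A (p i) (p (i + 1)) = -1 := by
        change g i * (- g i * A (p i) (p (i + 1))) * A (p i) (p (i + 1)) = -1
        linear_combination (- A (p i) (p (i + 1)) ^ 2) * h1 - h2
      rw [add_zero]; exact_mod_cast this
    · intro i j hij hj hor
      rw [hss _ i (by omega) j hj, if_neg (by omega), hfar i j hij hj hor]; simp
    · rw [hss _ 0 (by omega) n le_rfl, if_neg (by omega), hends, add_zero]
      have : g 0 * g n * (A v (p 0) * A v (p n)) = σ := by
        have := hg2 0 (by omega)
        change A v (p 0) ^ 2 = 1 at this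
        change A v (p 0) * g n * (A v (p 0) * A v (p n)) = g n * A v (p n)
        linear_combination g n * A v (p n) * this
      exact_mod_cast this
  obtain ⟨hnv, hns⟩ := hg.null
  set Y : V → ℝ := cycleSum r s (n + 1) + (σ : ℝ) • r with hY
  have hsp : ∀ i ≤ n, wform A (rootDiag v 1 2) (Pi.single (p i) 1) Y = 0 := by
    intro i hi
    have h1 := hns i hi
    rw [hsdef] at h1
    simp only [map_smul, LinearMap.smul_apply, smul_eq_mul] at h1
    rcases mul_eq_zero.1 h1 with h | h
    · have := hg2 i hi
      have hgi : g i = 0 := by exact_mod_cast h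
      rw [hgi] at this; norm_num at this
    · exact h
  have hY0 : ∀ x, x ≠ v → (∀ i ≤ n, x ≠ p i) → Y x = 0 := by
    intro x hx hxp
    rw [hY, Pi.add_apply, hsdef, hrdef, cycleSum_apply_of_ne hx fun i hi => hxp i (by omega)]
    simp [hx]
  have hex : ∃ z ∈ S, wform A (rootDiag v 1 2) (Pi.single z 1) Y ≠ 0 := by
    by_contra hcon
    push Not at hcon
    refine hS (psdOn_of_null hA hc hP (y := Y) ?_ hcon (hp 1 (by omega)).1 (hp 1 (by omega)).2
      ?_ ?_)
    · intro x hx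
      exact hY0 x (fun h => hx (h ▸ hvS)) fun i hi h => hx (h ▸ (hp i hi).1)
    · rw [hY, Pi.add_apply, hsdef, hrdef, cycleSum_apply_path (by omega) (hp 1 (by omega)).2]
      · simp only [Pi.smul_apply, Pi.single_eq_of_ne (hp 1 (by omega)).2]
        intro h
        have := hg2 1 (by omega)
        have hgi : g 1 = 0 := by
          have : (g 1 : ℝ) = 0 := by simpa using h
          exact_mod_cast this
        rw [hgi] at this; norm_num at this
      · intro i hi h1 h
        exact h1 ((hne i (by omega) 1 (by omega)).1 h)
    · intro x hx hx1
      have hmem : ∀ i ≤ n, i ≠ 1 → p i ∈ S.erase (p 1) := fun i hi h1 =>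
        Finset.mem_erase.2 ⟨fun h => h1 ((hne i hi 1 (by omega)).1 h), (hp i hi).1⟩
      have back : ∀ k, k + 2 ≤ n →
          Relation.ReflTransGen (fun a b => b ∈ S.erase (p 1) ∧ A a b ≠ 0) v (p (n - k)) := by
        intro k hk
        induction k with
        | zero => exact .single ⟨hmem n le_rfl (by omega), hlast⟩
        | succ k ih =>
          refine (ih (by omega)).tail ⟨hmem _ (by omega) (by omega), ?_⟩
          rw [← hA.apply, show n - k = n - (k + 1) + 1 by omega]
          exact hnext _ (by omega)
      by_cases hxv : x = v
      · rw [hxv]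
      · by_contra hcon
        refine hx (hY0 x hxv fun i hi h => hcon ?_)
        subst h
        rcases Nat.lt_or_ge i 2 with h2 | h2
        · have : i = 0 := by
            rcases Nat.lt_or_ge i 1 with h | h
            · omega
            · exact absurd (show p i = p 1 by rw [show i = 1 by omega]) hx1
          subst this
          exact .single ⟨hmem 0 (by omega) (by omega), hfirst⟩
        · have := back (n - i) (by omega)
          rwa [show n - (n - i) = i by omega] at this
  obtain ⟨z, hzS, hm⟩ := hex
  have hzv : z ≠ v := by rintro rfl; exact hm hnv
  have hzp : ∀ i ≤ n, z ≠ p i := by rintro i hi rfl; exact hm (hsp i hi)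
  have hdz : rootDiag v 1 2 z = 2 := rootDiag_of_ne hzv _ _
  have hn4 : n ≤ 4 := by
    have b1 := bessel_of_minimal hA h0 hP hg hvS hp (fun i hi => hinj i n hi le_rfl) hfirst hnext
      hzS hzv hzp hdz
    have hrev : (fun i => (σ : ℝ) • s (n - i))
        = fun i => ((σ * g (n - i) : ℤ) : ℝ) • (Pi.single (p (n - i)) 1 : V → ℝ) := by
      funext i; rw [hsdef]; simp [smul_smul]
    have hg' := hg.reverse
    rw [hrev] at hg'
    have b2 := bessel_of_minimal (p := fun i => p (n - i)) hA h0 hP hg' hvS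
      (fun i _ => hp (n - i) (by omega)) (fun i hi => by
        intro h; have := (hne _ (by omega) _ (by omega)).1 h; omega)
      hlast (fun i hi => by
        rw [← hA.apply, show n - i = n - (i + 1) + 1 by omega]; exact hnext _ (by omega))
      hzS hzv (fun i _ => hzp (n - i) (by omega)) hdz
    set f := fun j => wform A (rootDiag v 1 2) (Pi.single z 1) (cycleSum r s j) with hf
    set f' := fun j => wform A (rootDiag v 1 2) (Pi.single z 1)
      (cycleSum r (fun i => ((σ * g (n - i) : ℤ) : ℝ) • (Pi.single (p (n - i)) 1 : V → ℝ)) j)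
      with hf'
    have key : ∀ j ∈ Finset.range n, 1 ≤ f (j + 1) ^ 2 + f' (n - j) ^ 2 := by
      intro j hj
      rw [Finset.mem_range] at hj
      have e := congrArg (wform A (rootDiag v 1 2) (Pi.single z 1))
        (CycleGram.add_reverse (v := r) (s := s) (j := j + 1) (n := n) (by omega) hg.sq)
      rw [← hY, map_add, map_smul, hrev, show n + 1 - (j + 1) = n - j by omega] at e
      obtain ⟨a, ha⟩ : ∃ a : ℤ, f (j + 1) = a :=
        cycleSum_int hzv fun i hi => hzp i (by omega)
      obtain ⟨b, hb⟩ : ∃ b : ℤ, f' (n - j) = b :=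
        cycleSum_int hzv fun i hi => hzp (n - i) (by omega)
      change f (j + 1) + (σ : ℝ) • f' (n - j) = _ at e
      rw [ha, hb] at e ⊢
      have hab : a ≠ 0 ∨ b ≠ 0 := by
        by_contra hcon
        push Not at hcon
        rw [hcon.1, hcon.2] at e
        exact hm (by rw [← e]; simp)
      have : 1 ≤ a ^ 2 + b ^ 2 := by
        rcases hab with h | h
        · nlinarith [sq_nonneg b, Int.one_le_abs h, sq_abs a]
        · nlinarith [sq_nonneg a, Int.one_le_abs h, sq_abs b]
      exact_mod_cast this
    have hsum := Finset.sum_le_sum key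
    rw [Finset.sum_add_distrib] at hsum
    have c1 : ∑ j ∈ Finset.range n, f (j + 1) ^ 2 ≤ 2 := by
      rw [Finset.sum_range_succ'] at b1
      change ∑ j ∈ Finset.range n, f (j + 1) ^ 2 + f 0 ^ 2 ≤ 2 at b1
      nlinarith [sq_nonneg (f 0)]
    have c2 : ∑ j ∈ Finset.range n, f' (n - j) ^ 2 ≤ 2 := by
      have : ∑ j ∈ Finset.range n, f' (n - j) ^ 2 = ∑ j ∈ Finset.range n, f' (j + 1) ^ 2 := by
        rw [← Finset.sum_range_reflect]
        refine Finset.sum_congr rfl fun j hj => ?_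
        rw [Finset.mem_range] at hj
        congr 2; omega
      rw [this]
      rw [Finset.sum_range_succ'] at b2
      change ∑ j ∈ Finset.range n, f' (j + 1) ^ 2 + f' 0 ^ 2 ≤ 2 at b2
      nlinarith [sq_nonneg (f' 0)]
    simp only [Finset.sum_const, Finset.card_range, nsmul_eq_mul, mul_one] at hsum
    have : (n : ℝ) ≤ 4 := by linarith
    exact_mod_cast this
  have hw : ∀ i ≤ n, |g i * A z (p i)| ≤ 1 := by
    intro i hi
    have h1 : |g i| = 1 := by
      have := hg2 i hi
      rw [sq] at this
      rcases mul_self_eq_one_iff.1 this with h | h <;> rw [h] <;> rfl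
    rw [abs_mul, h1, one_mul]; exact hle _ hzS _ (hp i hi).1
  obtain ⟨a, b, c, hneg⟩ := exists_negative_cycle hn hn4 hθ2 hX1 hX2
    (mul_self_eq_one_iff.1 (by rw [← sq]; exact hσ2)) (u := A v z) (w := fun i => g i * A z (p i))
    (hle _ hvS _ hzS) hw (by
      intro h
      apply hm
      have hr : (∑ i ∈ Finset.range (n + 1), (g i : ℝ) * A z (p i)) - (1 + σ) * A v z = 0 := by
        exact_mod_cast h
      rw [hY, cycleSum, map_add, map_sub, map_sum, map_smul, hrdef, wform_single_single,
        if_neg hzv, hA.apply]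
      have : ∑ i ∈ Finset.range (n + 1), wform A (rootDiag v 1 2) (Pi.single z 1) (s i)
          = ∑ i ∈ Finset.range (n + 1), (g i : ℝ) * A z (p i) :=
        Finset.sum_congr rfl fun i hi => by
          rw [Finset.mem_range] at hi
          rw [hsdef, map_smul, wform_single_single, if_neg (hzp i (by omega))]; simp
      rw [this, smul_eq_mul]
      linarith)
  refine ⟨insert z (insert v ((Finset.range (n + 1)).image p)), ?_, ?_, fun hpsd => ?_⟩
  · intro x hx
    simp only [Finset.mem_insert, Finset.mem_image, Finset.mem_range] at hx
    rcases hx with rfl | rfl | ⟨i, hi, rfl⟩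
    exacts [hzS, hvS, (hp i (by omega)).1]
  · refine (Finset.card_insert_le _ _).trans ?_
    have h1 := Finset.card_insert_le v ((Finset.range (n + 1)).image p)
    have h2 : ((Finset.range (n + 1)).image p).card ≤ n + 1 :=
      Finset.card_image_le.trans (by simp)
    omega
  · have h1 := hpsd (a • r + ∑ i ∈ Finset.range (n + 1), c i • s i + b • Pi.single z 1) ?_
    · rw [wform_cycle (θ := θ) (X := X) (u := A v z) (w := fun i => g i * A z (p i)) hg] at h1
      · push_cast at hneg
        linarith
      · intro i hi j hj
        rw [hss _ i hi j hj, hss _ i hi j hj, rootDiag_of_ne (hp i hi).2,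
          rootDiag_of_ne (hp i hi).2]
        split_ifs <;> ring
      · exact wform_symm hA
      · rw [hrdef, wform_single_single]; simp [h0]
      · rw [wform_single_single, if_pos rfl, rootDiag_of_ne hzv, h0]; simp
      · intro i hi
        rw [hrs _ i hi, hrs _ i hi]
      · rw [hrdef, wform_single_single, if_neg hzv.symm, zero_add]
      · intro i hi
        rw [hsdef, map_smul, wform_single_single, if_neg (hzp i hi)]; simp
    · intro x hx
      simp only [Finset.mem_insert, Finset.mem_image, Finset.mem_range, not_or, not_exists,
        not_and] at hx
      obtain ⟨hxz, hxv, hxp⟩ := hx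
      simp only [Pi.add_apply, Finset.sum_apply, Pi.smul_apply, smul_eq_mul, hrdef, hsdef]
      rw [Pi.single_eq_of_ne hxz, Pi.single_eq_of_ne hxv, Finset.sum_eq_zero]
      · simp
      · intro i hi
        rw [Pi.single_eq_of_ne fun h => hxp i (Finset.mem_range.1 hi) h.symm]; simp
end cycleFull

section claim
variable {V : Type*} [Fintype V] [DecidableEq V] {A : Matrix V V ℤ}

/-- Uniform boundedness of obstructions for the rooted form, above threshold two. -/
theorem fails_of_not_psd_two (hA : A.IsSymm) (h0 : ∀ i, A i i = 0) {θ X : ℝ} {L : ℕ}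
    (hθ : 2 ≤ θ) (hθ2 : θ < 2.0199) (hX1 : 1 < X) (hX2 : X < 1.151)
    (hT : X - 1 / θ - 1 / (θ - 1 / θ) < 0) (hXθ : θ < X + 1 / X)
    (hL : θ ≤ X + L * (X + 1 / X - θ)) {v : V} {S : Finset V} (hc : Conn A v S)
    (hS : ¬ PSDOn A (rootDiag v 1 2) S) : Fails A θ X v S (7 + L) := by
  refine fails_of_irreducible hA h0 hX1.le hXθ hL (fun v S hc hS hP => ?_) v S hc hS
  by_cases hF : Fails A θ X v S 7
  · exact Or.inr hF
  left
  have hle : ∀ x ∈ S, ∀ y ∈ S, |A x y| ≤ 1 := fun x hx y hy =>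
    abs_le_one_of_minimal hA h0 hθ2 hX2 (by linarith) hc hS hP
      (fun h => hF (h.weaken (by norm_num))) hx hy
  have hnb : ∀ x ∈ S, ∀ y ∈ S, x ≠ y → A v x ≠ 0 → A v y ≠ 0 → A x y = A v x * A v y :=
    fun x hx y hy hxy h1 h2 => adj_of_neighbours hA h0 hθ hθ2 hX1 hX2 hT hc hS hP hle
      (fun h => hF (h.weaken (by norm_num))) hx hy hxy h1 h2
  rcases single_neighbour_or_path hA h0 (by simp) hc hS hP hnb with
    ⟨w, hw, h1, h2⟩ | ⟨n, p, hn, hp, hinj, h1, h2, h3, h4, h5⟩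
  · exact ⟨w, hw, sq_eq_one_of_abs_le (hle _ hc.1 _ hw) h1, h2⟩
  · exact absurd (fails_of_path hA h0 hθ2 hX1 hX2 hc hS hP hle hn hp hinj h1 h2 h3 h4 h5
      (hnb _ (hp 0 (by omega)).1 _ (hp n le_rfl).1 (hinj 0 n (by omega) le_rfl) h1 h2)) hF

end claim

section realise
variable {V : Type*} [Fintype V] [DecidableEq V] {A : Matrix V V ℤ} {d : V → ℝ}
variable {W : Type*} [Fintype W] [DecidableEq W] {M : Matrix W W ℤ} {e : W → ℝ}

/-- If the Gram matrix of a family of vectors is dominated by a form, nonnegativity carries over. -/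
theorem PSDOn.of_gram {S : Finset V} {T : Finset W} (h : PSDOn A d S) (x : W → V → ℝ)
    (hx : ∀ w ∈ T, ∀ i, i ∉ S → x w i = 0)
    (hd : ∀ w ∈ T, wform A d (x w) (x w) ≤ e w + M w w)
    (hB : ∀ w ∈ T, ∀ w' ∈ T, w ≠ w' → wform A d (x w) (x w') = M w w') : PSDOn M e T := by
  intro z hz
  have h1 := h (∑ w ∈ T, z w • x w) fun i hi => by
    rw [Finset.sum_apply]
    exact Finset.sum_eq_zero fun w hw => by simp [hx w hw i hi]
  refine h1.trans ?_
  rw [wform_sum_sum]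
  have hz' : z = ∑ w ∈ T, z w • Pi.single w (1 : ℝ) := by
    ext w
    rw [Finset.sum_apply]
    by_cases hw : w ∈ T
    · rw [Finset.sum_eq_single w]
      · simp
      · intro b _ hb; simp [hb.symm]
      · exact fun h => absurd hw h
    · rw [hz w hw, Finset.sum_eq_zero]
      intro b hb
      have : w ≠ b := fun h => hw (h ▸ hb)
      simp [this]
  conv_rhs => rw [hz', wform_sum_sum]
  refine Finset.sum_le_sum fun w hw => Finset.sum_le_sum fun w' hw' => ?_
  rw [wform_single_single]
  by_cases hww : w = w'
  · subst hww
    simp only [if_true]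
    exact mul_le_mul_of_nonneg_left (hd w hw) (mul_self_nonneg _)
  · rw [hB w hw w' hw' hww, if_neg hww, zero_add]

theorem psdOn_submatrix_iff {f : W → V} (hf : Function.Injective f) {T : Finset W} :
    PSDOn (A.submatrix f f) (fun w => d (f w)) T ↔ PSDOn A d (T.image f) := by
  constructor
  · intro h
    by_cases hT : T.Nonempty
    swap
    · rw [Finset.not_nonempty_iff_eq_empty] at hT
      subst hT
      intro z hz
      have : z = 0 := by ext i; exact hz i (by simp)
      simp [this]
    obtain ⟨t, -⟩ := hT
    have : Nonempty W := ⟨t⟩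
    refine h.of_gram (fun v => Pi.single (Function.invFun f v) 1) ?_ ?_ ?_
    · intro v hv i hi
      obtain ⟨w, hw, rfl⟩ := Finset.mem_image.1 hv
      rw [Function.leftInverse_invFun hf w]
      have hne : i ≠ w := fun h => hi (h ▸ hw)
      simp [hne]
    · intro v hv
      obtain ⟨w, hw, rfl⟩ := Finset.mem_image.1 hv
      rw [Function.leftInverse_invFun hf w, wform_single_single]
      simp
    · intro v hv v' hv' hne
      obtain ⟨w, hw, rfl⟩ := Finset.mem_image.1 hv
      obtain ⟨w', hw', rfl⟩ := Finset.mem_image.1 hv'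
      rw [Function.leftInverse_invFun hf w, Function.leftInverse_invFun hf w',
        wform_single_single]
      have hne' : w ≠ w' := fun h => hne (congrArg f h)
      simp [hne']
  · intro h
    refine h.of_gram (fun w => Pi.single (f w) 1) ?_ ?_ ?_
    · intro w hw i hi
      have hne : i ≠ f w := fun h => hi (h ▸ Finset.mem_image_of_mem f hw)
      simp [hne]
    · intro w hw
      rw [wform_single_single]; simp
    · intro w hw w' hw' hne
      rw [wform_single_single, if_neg fun h => hne (hf h)]; simp

/-- A form that is not nonnegative stays so after a small increase of the diagonal. -/
theorem exists_pos_not_psdOn_add (h : ¬ PSDOn M e Finset.univ) :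
    ∃ ε > 0, ∀ ε' ≤ ε, ¬ PSDOn M (fun w => e w + ε') Finset.univ := by
  unfold PSDOn at h
  push Not at h
  obtain ⟨z, -, hz⟩ := h
  have hs : 0 ≤ ∑ w, z w * z w := Finset.sum_nonneg fun _ _ => mul_self_nonneg _
  refine ⟨- wform M e z z / (∑ w, z w * z w + 1), by
    apply div_pos <;> linarith, fun ε' hε' hp => ?_⟩
  have := hp z (by simp)
  rw [wform_diag_change (d := e)] at this
  have e1 : ∑ w, (e w + ε' - e w) * z w * z w = ε' * ∑ w, z w * z w := by
    rw [Finset.mul_sum]; exact Finset.sum_congr rfl fun _ _ => by ring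
  rw [e1] at this
  rw [le_div_iff₀ (by linarith)] at hε'
  rcases le_or_gt 0 ε' with h0 | h0
  · nlinarith
  · nlinarith

/-- Robustness of finitely many failures. -/
theorem exists_pos_forall_not_psdOn_add {ι : Type*} [Finite ι] {W : ι → Type*}
    [∀ i, Fintype (W i)] [∀ i, DecidableEq (W i)] (M : ∀ i, Matrix (W i) (W i) ℤ)
    (e : ∀ i, W i → ℝ) : ∃ ε > 0, ∀ i, ¬ PSDOn (M i) (e i) Finset.univ →
      ¬ PSDOn (M i) (fun w => e i w + ε) Finset.univ := by
  have : ∀ i, ∃ ε > 0, ¬ PSDOn (M i) (e i) Finset.univ →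
      ∀ ε' ≤ ε, ¬ PSDOn (M i) (fun w => e i w + ε') Finset.univ := by
    intro i
    by_cases h : PSDOn (M i) (e i) Finset.univ
    · exact ⟨1, one_pos, fun h' => absurd h h'⟩
    · obtain ⟨ε, h1, h2⟩ := exists_pos_not_psdOn_add h
      exact ⟨ε, h1, fun _ => h2⟩
  choose ε hε h using this
  have := Fintype.ofFinite ι
  by_cases hne : Nonempty ι
  · refine ⟨Finset.univ.inf' Finset.univ_nonempty ε, ?_, fun i hi => h i hi _ ?_⟩
    · rw [gt_iff_lt, Finset.lt_inf'_iff]; exact fun i _ => hε i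
    · exact Finset.inf'_le _ (Finset.mem_univ i)
  · exact ⟨1, one_pos, fun i => absurd ⟨i⟩ hne⟩

end realise

/-- Failures of bounded size and bounded entries are uniformly robust. -/
theorem exists_pos_forall_card_le (B : ℕ) (C : ℤ) (θ X : ℝ) : ∃ ε > 0, ∀ {V : Type*} [Fintype V]
    [DecidableEq V] (A : Matrix V V ℤ) (v : V) (U : Finset V), U.card ≤ B →
    (∀ x ∈ U, ∀ y ∈ U, |A x y| ≤ C) → ¬ PSDOn A (rootDiag v X θ) U →
    ¬ PSDOn A (fun x => rootDiag v X θ x + ε) U := by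
  let ι := Σ k : Fin (B + 1), (Fin k → Fin k → Set.Icc (-C) C) × (Fin k → Bool)
  obtain ⟨ε, hε, h⟩ := exists_pos_forall_not_psdOn_add (ι := ι) (W := fun i => Fin i.1)
    (fun i => Matrix.of fun a b => (i.2.1 a b : ℤ)) (fun i w => if i.2.2 w then X else θ)
  refine ⟨ε, hε, fun {V} _ _ A v U hU hC hn hp => ?_⟩
  let f : Fin U.card → V := fun i => (U.equivFin.symm i : V)
  have hf : Function.Injective f := fun i j hij => by simpa [f] using hij
  have hfU : ∀ i, f i ∈ U := fun i => (U.equivFin.symm i).2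
  have him : Finset.univ.image f = U := by
    apply Finset.eq_of_subset_of_card_le
    · intro x hx
      obtain ⟨i, _, rfl⟩ := Finset.mem_image.1 hx
      exact hfU i
    · rw [Finset.card_image_of_injective _ hf]; simp
  let i : ι := ⟨⟨U.card, by omega⟩,
    (fun a b => ⟨A (f a) (f b), abs_le.1 (hC _ (hfU a) _ (hfU b))⟩, fun a => decide (f a = v))⟩
  have e1 : (fun w => if decide (f w = v) then X else θ) = fun w => rootDiag v X θ (f w) := by
    funext w
    by_cases hw : f w = v
    · simp [hw]
    · simp [hw, rootDiag_of_ne hw]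
  have key : ¬ PSDOn (A.submatrix f f) (fun w => if decide (f w = v) then X else θ) Finset.univ →
      ¬ PSDOn (A.submatrix f f) (fun w => (if decide (f w = v) then X else θ) + ε) Finset.univ :=
    h i
  have e2 : (fun w => (if decide (f w = v) then X else θ) + ε) =
      fun w => rootDiag v X θ (f w) + ε := by
    funext w; rw [← congrFun e1 w]
  rw [e1, e2] at key
  rw [← him] at hn hp
  exact key (fun hq => hn ((psdOn_submatrix_iff hf).1 hq))
    ((psdOn_submatrix_iff (d := fun x => rootDiag v X θ x + ε) hf).2 hp)

/-- Ramsey's theorem for three colours. -/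
theorem exists_ramsey (s : ℕ) : ∀ a : Fin 3 → ℕ, ∑ i, a i = s → ∃ N : ℕ, ∀ {α : Type} (T : Finset α)
    (f : α → α → Fin 3), (∀ x y, f x y = f y x) → N ≤ T.card →
    ∃ c, ∃ U ⊆ T, U.card = a c ∧ ∀ x ∈ U, ∀ y ∈ U, x ≠ y → f x y = c := by
  induction s with
  | zero =>
    intro a ha
    have : a 0 = 0 := by
      have := Finset.single_le_sum (f := a) (fun i _ => Nat.zero_le _) (Finset.mem_univ 0)
      omega
    exact ⟨0, fun T f _ _ => ⟨0, ∅, by simp, by simp [this], by simp⟩⟩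
  | succ s ih =>
    intro a ha
    by_cases hz : ∃ i, a i = 0
    · obtain ⟨i, hi⟩ := hz
      exact ⟨0, fun T f _ _ => ⟨i, ∅, by simp, by simp [hi], by simp⟩⟩
    push Not at hz
    have hsum : ∀ i, ∑ j, Function.update a i (a i - 1) j = s := by
      intro i
      have h1 := Finset.sum_update_of_mem (Finset.mem_univ i) a (a i - 1)
      have h2 := Finset.sum_erase_eq_sub (f := fun j => (a j : ℤ)) (Finset.mem_univ i)
      have h3 := Finset.add_sum_erase Finset.univ a (Finset.mem_univ i)
      rw [h1, Finset.sdiff_singleton_eq_erase]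
      have := Nat.pos_of_ne_zero (hz i)
      omega
    choose N hN using fun i => ih _ (hsum i)
    refine ⟨1 + ∑ i, N i, fun {α} T f hf hT => ?_⟩
    obtain ⟨x, hx⟩ : T.Nonempty := Finset.card_pos.1 (by omega)
    have hcard : (T.erase x).card = ∑ i, ((T.erase x).filter fun y => f x y = i).card :=
      Finset.card_eq_sum_card_fiberwise (f := fun y => f x y) (by simp)
    have hex : ∃ i, N i ≤ ((T.erase x).filter fun y => f x y = i).card := by
      by_contra hcon
      push Not at hcon
      have := Finset.sum_le_sum (s := Finset.univ) fun i _ => (hcon i).le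
      have h0 := Finset.sum_lt_sum_of_nonempty (s := Finset.univ) Finset.univ_nonempty
        fun i _ => hcon i
      rw [Finset.card_erase_of_mem hx] at hcard
      omega
    obtain ⟨i, hi⟩ := hex
    obtain ⟨c, U, hU, hUc, hUf⟩ := hN i _ f hf hi
    have hUT : U ⊆ T := fun y hy =>
      Finset.mem_of_mem_erase (Finset.mem_filter.1 (hU hy)).1
    by_cases hci : c = i
    · subst hci
      refine ⟨c, insert x U, Finset.insert_subset hx hUT, ?_, ?_⟩
      · rw [Finset.card_insert_of_notMem fun h => by simpa using hU h, hUc]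
        have := Nat.pos_of_ne_zero (hz c)
        simp; omega
      · intro y hy z hz hyz
        rcases Finset.mem_insert.1 hy with h1 | h1 <;> rcases Finset.mem_insert.1 hz with h2 | h2
        · exact absurd (h1.trans h2.symm) hyz
        · rw [h1]; exact (Finset.mem_filter.1 (hU h2)).2
        · rw [h2, hf]; exact (Finset.mem_filter.1 (hU h1)).2
        · exact hUf y h1 z h2 hyz
    · exact ⟨c, U, hUT, by rw [hUc, Function.update_of_ne hci], hUf⟩

section large
variable {V : Type} [Fintype V] [DecidableEq V] {A : Matrix V V ℤ} {d : V → ℝ}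

theorem wform_sum_const {ι : Type*} {U : Finset ι} {f : ι → V → ℝ} {a b : ℝ}
    (h : ∀ i ∈ U, ∀ j ∈ U, wform A d (f i) (f j) = if i = j then a else b) :
    wform A d (∑ i ∈ U, f i) (∑ i ∈ U, f i) = U.card * a + U.card * (U.card - 1) * b := by
  have h1 := wform_sum_sum (A := A) (d := d) U f fun _ => 1
  simp only [one_smul, one_mul] at h1
  rw [h1]
  have h2 : ∀ i ∈ U, ∑ j ∈ U, wform A d (f i) (f j) = a + (U.card - 1) * b := by
    intro i hi
    rw [← Finset.add_sum_erase _ _ hi, h i hi i hi, if_pos rfl]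
    rw [Finset.sum_congr rfl fun j hj => by
      rw [h i hi j (Finset.mem_of_mem_erase hj), if_neg (Finset.ne_of_mem_erase hj).symm]]
    rw [Finset.sum_const, Finset.card_erase_of_mem hi, nsmul_eq_mul,
      Nat.cast_sub (Finset.card_pos.2 ⟨i, hi⟩)]
    simp
  rw [Finset.sum_congr rfl h2, Finset.sum_const, nsmul_eq_mul]
  ring

theorem wform_smul_single (a b : ℝ) (i j : V) :
    wform A d (a • Pi.single i 1) (b • Pi.single j 1) =
      a * b * ((if i = j then d j else 0) + A i j) := by
  rw [LinearMap.BilinForm.smul_left, LinearMap.BilinForm.smul_right, wform_single_single]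
  ring

theorem sum_single_apply_eq_zero {U : Finset V} {c : V → ℝ} {i : V} (hi : i ∉ U) :
    (∑ k ∈ U, c k • Pi.single k (1 : ℝ) : V → ℝ) i = 0 := by
  rw [Finset.sum_apply]
  refine Finset.sum_eq_zero fun k hk => ?_
  have : i ≠ k := fun h => hi (h ▸ hk)
  simp [this]

/-- A star with five leaves is not nonnegative. -/
theorem star_card_ne_five (hA : A.IsSymm) (h0 : ∀ i, A i i = 0) {θ : ℝ} {S K : Finset V} {u : V}
    (hθ : θ < 2.1) (hbad : ∀ U ⊆ S, U.card ≤ 6 → PSDOn A (fun _ => θ) U) (hu : u ∈ S) (hK : K ⊆ S)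
    (hsq : ∀ k ∈ K, (A u k : ℝ) * A u k = 1) (hr : ∀ x ∈ K, ∀ y ∈ K, x ≠ y → A x y = 0) :
    K.card ≠ 5 := by
  intro h5
  have huK : u ∉ K := fun h => by simpa [h0] using hsq u h
  have hval : wform A (fun _ => θ) (∑ k ∈ K, (A u k : ℝ) • Pi.single k 1)
        (∑ k ∈ K, (A u k : ℝ) • Pi.single k 1) = K.card * θ + K.card * (K.card - 1) * 0 := by
    refine wform_sum_const fun i hi j hj => ?_
    rw [wform_smul_single]
    by_cases hij : i = j
    · subst hij; simp [h0, hsq i hi]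
    · simp [hij, hr i hi j hj hij]
  have h := hbad (insert u K) (Finset.insert_subset hu hK)
    ((Finset.card_insert_le _ _).trans (by omega))
    ((-1 : ℝ) • (∑ k ∈ K, (A u k : ℝ) • Pi.single k 1) + (2 : ℝ) • Pi.single u 1) (by
      intro i hi
      rw [Finset.mem_insert, not_or] at hi
      rw [Pi.add_apply, Pi.smul_apply, sum_single_apply_eq_zero hi.2]
      simp [hi.1])
  rw [wform_self_add hA] at h
  simp only [LinearMap.BilinForm.smul_left, LinearMap.BilinForm.smul_right] at h
  rw [hval, h5, wform_single_single] at h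
  have hc : wform A (fun _ => θ) (∑ k ∈ K, (A u k : ℝ) • Pi.single k 1) (Pi.single u 1) = 5 := by
    rw [LinearMap.BilinForm.sum_left, Finset.sum_congr rfl fun k hk => by
      rw [LinearMap.BilinForm.smul_left, wform_single_single,
        if_neg (fun h => huK (h ▸ hk) : k ≠ u), hA.apply u k, zero_add, hsq k hk]]
    simp [h5]
  rw [hc] at h
  norm_num [h0] at h; linarith

/-- A vertex with many neighbours is adjacent to a large signed clique. -/
theorem exists_clique_of_degree (M : ℕ) : ∃ N : ℕ, ∀ {V : Type} [Fintype V] [DecidableEq V]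
    {A : Matrix V V ℤ} {θ : ℝ} {S : Finset V}, A.IsSymm → (∀ i, A i i = 0) → θ < 2.1 →
    (∀ x ∈ S, ∀ y ∈ S, |A x y| ≤ 1) → (∀ U ⊆ S, U.card ≤ 6 → PSDOn A (fun _ => θ) U) →
    ∀ u ∈ S, ∀ D ⊆ S, (∀ x ∈ D, A u x ≠ 0) → N ≤ D.card →
    ∃ K ⊆ D, M = K.card ∧ ∀ x ∈ K, ∀ y ∈ K, x ≠ y → A x y = A u x * A u y := by
  obtain ⟨N, hN⟩ := exists_ramsey (4 + 5 + M) ![4, 5, M] (by simp [Fin.sum_univ_three])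
  refine ⟨N, fun {V} _ _ A θ S hA h0 hθ hle hbad u hu D hDS hD hcard => ?_⟩
  set F : V → V → ℤ := fun x y => A u x * A u y * A x y with hF
  have hsymm : ∀ x y, F x y = F y x := fun x y => by simp only [hF, hA.apply x y]; ring
  obtain ⟨c, K, hK, hKc, hKf⟩ := hN D
    (fun x y => if F x y < 0 then 0 else if F x y = 0 then 1 else 2)
    (fun x y => by simp only [hsymm x y]) hcard
  have hpm : ∀ x ∈ D, A u x = 1 ∨ A u x = -1 := fun x hx => by
    have h1 := hle u hu x (hDS hx)
    have h2 := hD x hx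
    rw [abs_le] at h1; omega
  have hsq : ∀ x ∈ D, (A u x : ℝ) * A u x = 1 := fun x hx => by
    rcases hpm x hx with h | h <;> simp [h]
  have hFA : ∀ x ∈ D, ∀ y ∈ D, A x y = F x y * (A u x * A u y) := fun x hx y hy => by
    rcases hpm x hx with h | h <;> rcases hpm y hy with h' | h' <;> simp [hF, h, h']
  have hFle : ∀ x ∈ D, ∀ y ∈ D, F x y = -1 ∨ F x y = 0 ∨ F x y = 1 := by
    intro x hx y hy
    have h1 := hle x (hDS hx) y (hDS hy)
    rw [abs_le] at h1
    rcases hpm x hx with h | h <;> rcases hpm y hy with h' | h' <;> simp [hF, h, h'] <;> omega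
  have hval : ∀ r : ℤ, (∀ x ∈ K, ∀ y ∈ K, x ≠ y → F x y = r) →
      wform A (fun _ => θ) (∑ k ∈ K, (A u k : ℝ) • Pi.single k 1)
        (∑ k ∈ K, (A u k : ℝ) • Pi.single k 1) = K.card * θ + K.card * (K.card - 1) * r := by
    intro r hr
    refine wform_sum_const fun i hi j hj => ?_
    rw [wform_smul_single]
    by_cases hij : i = j
    · subst hij; simp [h0, hsq i (hK hi)]
    · rw [if_neg hij, if_neg hij, hFA i (hK hi) j (hK hj), hr i hi j hj hij]
      push_cast
      linear_combination (r : ℝ) * (A u j * A u j) * hsq i (hK hi) + r * hsq j (hK hj)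
  fin_cases c
  · exfalso
    have hr : ∀ x ∈ K, ∀ y ∈ K, x ≠ y → F x y = -1 := fun x hx y hy hxy => by
      have h1 := hKf x hx y hy hxy
      rcases hFle x (hK hx) y (hK hy) with h | h | h
      · exact h
      · simp [h] at h1
      · simp [h] at h1
    have h4 : K.card = 4 := by simpa using hKc
    have h := hbad K (hK.trans hDS) (by omega) _ fun i hi =>
      sum_single_apply_eq_zero (c := fun k => (A u k : ℝ)) hi
    rw [hval _ hr, h4] at h
    norm_num at h; linarith
  · exfalso
    have hr : ∀ x ∈ K, ∀ y ∈ K, x ≠ y → F x y = 0 := fun x hx y hy hxy => by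
      have h1 := hKf x hx y hy hxy
      rcases hFle x (hK hx) y (hK hy) with h | h | h
      · simp [h] at h1
      · exact h
      · simp [h] at h1
    refine star_card_ne_five hA h0 hθ hbad hu (hK.trans hDS) (fun k hk => hsq k (hK hk))
      (fun x hx y hy hxy => ?_) (by simpa using hKc)
    rw [hFA x (hK hx) y (hK hy), hr x hx y hy hxy, zero_mul]
  · refine ⟨K, hK, by simpa using hKc.symm, fun x hx y hy hxy => ?_⟩
    have h1 := hKf x hx y hy hxy
    rcases hFle x (hK hx) y (hK hy) with h | h | h
    · simp [h] at h1
    · simp [h] at h1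
    · rw [hFA x (hK hx) y (hK hy), h, one_mul]

end large

section connectivity
variable {V : Type} [Fintype V] [DecidableEq V] {A : Matrix V V ℤ} {d : V → ℝ}

theorem Conn.reroot (hA : A.IsSymm) {v w : V} {S : Finset V} (hc : Conn A v S) (hw : w ∈ S) :
    Conn A w S := by
  refine ⟨hw, fun x hx => ?_⟩
  have hrev : ∀ y, Relation.ReflTransGen (fun a b => b ∈ S ∧ A a b ≠ 0) v y →
      Relation.ReflTransGen (fun a b => b ∈ S ∧ A a b ≠ 0) y v := by
    intro y hy
    induction hy with
    | refl => exact .refl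
    | @tail b c hb hbc ih =>
      refine Relation.ReflTransGen.head ⟨?_, ?_⟩ ih
      · rcases Relation.ReflTransGen.cases_tail hb with h | ⟨e, -, h⟩
        · rw [h]; exact hc.1
        · exact h.1
      · rw [hA.apply]; exact hbc.2
  exact (hrev w (hc.2 w hw)).trans (hc.2 x hx)

/-- A form splitting as an orthogonal sum is nonnegative if both summands are. -/
theorem psdOn_union (hA : A.IsSymm) {S T : Finset V} (hST : Disjoint S T)
    (hz : ∀ x ∈ S, ∀ y ∈ T, A x y = 0) (hS : PSDOn A d S) (hT : PSDOn A d T) :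
    PSDOn A d (S ∪ T) := by
  intro z hzs
  have e : z = vrestrict S z + vrestrict T z := by
    ext i
    by_cases h1 : i ∈ S
    · have h2 : i ∉ T := Finset.disjoint_left.1 hST h1
      simp [vrestrict, h1, h2]
    · by_cases h2 : i ∈ T
      · simp [vrestrict, h1, h2]
      · simp [vrestrict, h1, h2, hzs i (by simp [h1, h2])]
  rw [e, wform_self_add hA]
  have h1 := hS (vrestrict S z) fun i hi => by simp [vrestrict, hi]
  have h2 := hT (vrestrict T z) fun i hi => by simp [vrestrict, hi]
  have h3 : wform A d (vrestrict S z) (vrestrict T z) = 0 := by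
    rw [wform_vrestrict]
    refine Finset.sum_eq_zero fun i hi => ?_
    have hiS : i ∉ S := fun h => Finset.disjoint_left.1 hST h hi
    rw [wform_single_right]
    have : ∑ j, (A j i : ℝ) * vrestrict S z j = 0 := Finset.sum_eq_zero fun j _ => by
      by_cases hj : j ∈ S
      · simp [hz j hj i hi]
      · simp [vrestrict, hj]
    rw [this]
    simp [vrestrict, hiS]
  linarith

theorem Conn.of_minimal (hA : A.IsSymm) {S : Finset V} (hS : ¬ PSDOn A d S)
    (hP : ∀ S', S' ⊂ S → PSDOn A d S') {v : V} (hv : v ∈ S) : Conn A v S := by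
  refine ⟨hv, ?_⟩
  by_contra hcon
  push Not at hcon
  obtain ⟨x, hx, hxv⟩ := hcon
  set C := S.filter fun y => Relation.ReflTransGen (fun a b => b ∈ S ∧ A a b ≠ 0) v y with hC
  have hCS : C ⊆ S := Finset.filter_subset _ _
  have hCx : x ∉ C := fun h => hxv (Finset.mem_filter.1 h).2
  have hCv : v ∈ C := Finset.mem_filter.2 ⟨hv, .refl⟩
  refine hS ?_
  rw [← Finset.union_sdiff_of_subset hCS]
  refine psdOn_union hA Finset.disjoint_sdiff ?_
    (hP _ (Finset.ssubset_iff_subset_ne.2 ⟨hCS, fun h => hCx (h ▸ hx)⟩))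
    (hP _ (Finset.ssubset_iff_subset_ne.2 ⟨Finset.sdiff_subset, fun h => ?_⟩))
  · intro a ha b hb
    by_contra hab
    rw [Finset.mem_sdiff] at hb
    exact hb.2 (Finset.mem_filter.2 ⟨hb.1, (Finset.mem_filter.1 ha).2.tail ⟨hb.1, hab⟩⟩)
  · have := h ▸ hv
    exact (Finset.mem_sdiff.1 this).2 hCv

/-- Every failing set contains a minimal one. -/
theorem exists_minimal_not_psdOn {S : Finset V} (hS : ¬ PSDOn A d S) :
    ∃ T ⊆ S, ¬ PSDOn A d T ∧ ∀ T', T' ⊂ T → PSDOn A d T' := by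
  induction S using Finset.strongInduction with
  | H S ih =>
    by_cases h : ∀ T', T' ⊂ S → PSDOn A d T'
    · exact ⟨S, subset_rfl, hS, h⟩
    · push Not at h
      obtain ⟨T', h1, h2⟩ := h
      obtain ⟨T, h3, h4⟩ := ih T' h1 h2
      exact ⟨T, h3.trans h1.subset, h4⟩

/-- A large connected set of bounded degree contains long induced chains leaving a given set. -/
theorem exists_long_chain {v : V} {S P : Finset V} {D L : ℕ}
    (hc : Conn A v S) (hv : v ∈ P) (hPS : P ⊆ S)
    (hdeg : ∀ x ∈ S, (S.filter fun y => A x y ≠ 0).card ≤ D)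
    (hcard : P.card * (D + 1) ^ L < S.card) :
    ∃ (n : ℕ) (p : ℕ → V), L ≤ n ∧ p 0 ∈ P ∧ (∀ i ≤ n, p i ∈ S) ∧
      (∀ i < n, A (p i) (p (i + 1)) ≠ 0) ∧ (∀ i j, i < j → j ≤ n → p i ≠ p j) ∧
      (∀ i j, i + 1 < j → j ≤ n → A (p i) (p j) = 0) ∧ (∀ i, 0 < i → i ≤ n → p i ∉ P) := by
  let ball : ℕ → Finset V := fun k => Nat.rec P
    (fun _ B => B.biUnion fun x => insert x (S.filter fun y => A x y ≠ 0)) k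
  have hball0 : ball 0 = P := rfl
  have hballs : ∀ k, ball (k + 1) =
      (ball k).biUnion fun x => insert x (S.filter fun y => A x y ≠ 0) := fun _ => rfl
  have hsub : ∀ k, ball k ⊆ S ∧ (ball k).card ≤ P.card * (D + 1) ^ k := by
    intro k
    induction k with
    | zero => simpa [hball0] using hPS
    | succ k ih =>
      rw [hballs]
      refine ⟨?_, ?_⟩
      · intro y hy
        obtain ⟨x, hx, hy⟩ := Finset.mem_biUnion.1 hy
        rcases Finset.mem_insert.1 hy with rfl | hy
        · exact ih.1 hx
        · exact (Finset.mem_filter.1 hy).1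
      · refine Finset.card_biUnion_le.trans ?_
        refine (Finset.sum_le_card_nsmul _ _ (D + 1) fun x hx =>
          (Finset.card_insert_le _ _).trans (Nat.succ_le_succ (hdeg x (ih.1 hx)))).trans ?_
        rw [smul_eq_mul, pow_succ, ← mul_assoc]
        exact Nat.mul_le_mul_right _ ih.2
  have hmono : ∀ k l, k ≤ l → ball k ⊆ ball l := by
    intro k l hkl
    induction hkl with
    | refl => exact subset_rfl
    | step _ ih =>
      refine ih.trans fun x hx => ?_
      rw [Nat.succ_eq_add_one, hballs]
      exact Finset.mem_biUnion.2 ⟨x, hx, Finset.mem_insert_self _ _⟩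
  obtain ⟨x, hxS, hx⟩ : ∃ x ∈ S, x ∉ ball L := by
    by_contra hcon
    push Not at hcon
    exact absurd (Finset.card_le_card hcon) (by have := (hsub L).2; omega)
  obtain ⟨n, p, h0, hn, hR, hinj, hind, -, hPi⟩ :=
    exists_shortest_chain (P := fun y => y ∈ P) (Q := fun y => y = x) hv rfl (hc.2 x hxS)
  have hpS : ∀ i ≤ n, p i ∈ S := by
    intro i hi
    rcases i with _ | i
    · exact hPS h0
    · exact (hR i (by omega)).1
  have hpb : ∀ i ≤ n, p i ∈ ball i := by
    intro i
    induction i with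
    | zero => exact fun _ => h0
    | succ i ih =>
      intro hi
      rw [hballs]
      exact Finset.mem_biUnion.2 ⟨p i, ih (by omega), Finset.mem_insert_of_mem
        (Finset.mem_filter.2 (hR i (by omega)))⟩
  refine ⟨n, p, ?_, h0, hpS, fun i hi => (hR i hi).2, hinj, fun i j hij hj => ?_, hPi⟩
  · by_contra hlt
    exact hx (hn ▸ hmono n L (by omega) (hpb n le_rfl))
  · by_contra hne
    exact hind i j hij hj ⟨hpS j hj, hne⟩

/-- On an induced path a vertex has few neighbours. -/
theorem card_neighbours_path_le (hA : A.IsSymm) (h0 : ∀ i, A i i = 0) {θ : ℝ} {S : Finset V}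
    (hθ : θ < 2.1) (hle : ∀ x ∈ S, ∀ y ∈ S, |A x y| ≤ 1)
    (hbad : ∀ U ⊆ S, U.card ≤ 6 → PSDOn A (fun _ => θ) U) {n : ℕ} {p : ℕ → V}
    (hp : ∀ i ≤ n, p i ∈ S) (hinj : ∀ i j, i < j → j ≤ n → p i ≠ p j)
    (hind : ∀ i j, i + 1 < j → j ≤ n → A (p i) (p j) = 0) {z : V} (hz : z ∈ S) :
    ((Finset.range (n + 1)).filter fun i => A z (p i) ≠ 0).card ≤ 8 := by
  by_contra hcon
  push Not at hcon
  set I := (Finset.range (n + 1)).filter fun i => A z (p i) ≠ 0 with hI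
  have hpar := Finset.card_filter_add_card_filter_not (s := I) (fun i => i % 2 = 0)
  obtain ⟨J, hJI, hJ5, hJp⟩ : ∃ J ⊆ I, J.card = 5 ∧ ∀ i ∈ J, ∀ j ∈ J, i < j → i + 1 < j := by
    rcases le_or_gt 5 (I.filter fun i => i % 2 = 0).card with h | h
    · obtain ⟨J, hJ, hJ5⟩ := Finset.exists_subset_card_eq h
      refine ⟨J, hJ.trans (Finset.filter_subset _ _), hJ5, fun i hi j hj hij => ?_⟩
      have h1 := (Finset.mem_filter.1 (hJ hi)).2
      have h2 := (Finset.mem_filter.1 (hJ hj)).2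
      omega
    · obtain ⟨J, hJ, hJ5⟩ := Finset.exists_subset_card_eq
        (show 5 ≤ (I.filter fun i => ¬ i % 2 = 0).card by omega)
      refine ⟨J, hJ.trans (Finset.filter_subset _ _), hJ5, fun i hi j hj hij => ?_⟩
      have h1 := (Finset.mem_filter.1 (hJ hi)).2
      have h2 := (Finset.mem_filter.1 (hJ hj)).2
      omega
  have hJn : ∀ i ∈ J, i ≤ n ∧ A z (p i) ≠ 0 := fun i hi => by
    have := hJI hi
    rw [hI, Finset.mem_filter, Finset.mem_range] at this
    exact ⟨by omega, this.2⟩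
  have hinjJ : Set.InjOn p J := by
    intro i hi j hj hij
    by_contra hne
    rcases lt_or_gt_of_ne hne with h | h
    · exact hinj i j h (hJn j hj).1 hij
    · exact hinj j i h (hJn i hi).1 hij.symm
  refine star_card_ne_five hA h0 hθ hbad hz (K := J.image p) ?_ ?_ ?_
    ((Finset.card_image_of_injOn hinjJ).trans hJ5)
  · intro x hx
    obtain ⟨i, hi, rfl⟩ := Finset.mem_image.1 hx
    exact hp i (hJn i hi).1
  · intro x hx
    obtain ⟨i, hi, rfl⟩ := Finset.mem_image.1 hx
    have := sq_eq_one_of_abs_le (hle z hz _ (hp i (hJn i hi).1)) (hJn i hi).2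
    rw [← sq]; exact_mod_cast this
  · intro x hx y hy hxy
    obtain ⟨i, hi, rfl⟩ := Finset.mem_image.1 hx
    obtain ⟨j, hj, rfl⟩ := Finset.mem_image.1 hy
    rcases lt_trichotomy i j with h | h | h
    · exact hind i j (hJp i hi j hj h) (hJn j hj).1
    · exact absurd (congrArg p h) hxy
    · rw [hA.apply]; exact hind j i (hJp j hj i hi h) (hJn i hi).1

end connectivity

/-- Signs along a chain making all consecutive entries equal to `-1`. -/
def chainSign {V : Type} (A : Matrix V V ℤ) (p : ℕ → V) : ℕ → ℤ
  | 0 => 1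
  | i + 1 => -A (p i) (p (i + 1)) * chainSign A p i

section sums
variable {V : Type} [Fintype V] [DecidableEq V] {A : Matrix V V ℤ} {d : V → ℝ}

theorem chainSign_sq {n : ℕ} {p : ℕ → V} (hA1 : ∀ i < n, A (p i) (p (i + 1)) ^ 2 = 1) :
    ∀ i ≤ n, chainSign A p i ^ 2 = 1 := by
  intro i
  induction i with
  | zero => intro _; simp [chainSign]
  | succ i ih =>
    intro hi
    rw [chainSign, mul_pow, ih (by omega), neg_sq, hA1 i (by omega), one_mul]

/-- The weighted signed sum of the first `k` vertices of a chain. -/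
noncomputable def chainSum (A : Matrix V V ℤ) (p : ℕ → V) (c : ℕ → ℝ) (k : ℕ) : V → ℝ :=
  ∑ i ∈ Finset.range k, (c i * chainSign A p i) • Pi.single (p i) (1 : ℝ)

theorem chainSum_apply_eq_zero {p : ℕ → V} {c : ℕ → ℝ} {k : ℕ} {x : V} (h : ∀ i < k, p i ≠ x) :
    chainSum A p c k x = 0 := by
  rw [chainSum, Finset.sum_apply]
  refine Finset.sum_eq_zero fun i hi => ?_
  have : x ≠ p i := fun e => h i (Finset.mem_range.1 hi) e.symm
  simp [this]

theorem wform_chainSum_right {p : ℕ → V} {c : ℕ → ℝ} {k : ℕ} (x : V → ℝ) :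
    wform A d x (chainSum A p c k) =
      ∑ i ∈ Finset.range k, c i * chainSign A p i * wform A d x (Pi.single (p i) 1) := by
  rw [chainSum, LinearMap.BilinForm.sum_right]
  exact Finset.sum_congr rfl fun i _ => LinearMap.BilinForm.smul_right _ _ _

theorem wform_chainSum (hA : A.IsSymm) (h0 : ∀ i, A i i = 0) {n : ℕ} {p : ℕ → V}
    (hA1 : ∀ i < n, A (p i) (p (i + 1)) ^ 2 = 1) (hinj : ∀ i j, i < j → j ≤ n → p i ≠ p j)
    (hind : ∀ i j, i + 1 < j → j ≤ n → A (p i) (p j) = 0) (c : ℕ → ℝ) :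
    ∀ k ≤ n, wform A d (chainSum A p c (k + 1)) (chainSum A p c (k + 1)) =
      ∑ i ∈ Finset.range (k + 1), d (p i) * c i ^ 2
        - 2 * ∑ i ∈ Finset.range k, c i * c (i + 1) := by
  have hs := chainSign_sq hA1
  have hsR : ∀ i ≤ n, (chainSign A p i : ℝ) * chainSign A p i = 1 := fun i hi => by
    rw [← sq]; exact_mod_cast hs i hi
  intro k
  induction k with
  | zero =>
    intro _
    simp only [chainSum, zero_add, Finset.range_one, Finset.sum_singleton]
    rw [wform_smul_single]
    simp [h0, chainSign]; ring
  | succ k ih =>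
    intro hk
    have e : chainSum A p c (k + 1 + 1) = chainSum A p c (k + 1) +
        (c (k + 1) * chainSign A p (k + 1)) • Pi.single (p (k + 1)) (1 : ℝ) := by
      rw [chainSum, Finset.sum_range_succ]; rfl
    rw [e, wform_self_add hA, ih (by omega), wform_smul_single, if_pos rfl, h0,
      LinearMap.BilinForm.smul_right, wform_symm hA, wform_chainSum_right]
    have e2 : ∑ i ∈ Finset.range (k + 1), c i * (chainSign A p i : ℝ) *
        wform A d (Pi.single (p (k + 1)) 1) (Pi.single (p i) 1) =
        c k * chainSign A p k * A (p k) (p (k + 1)) := by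
      rw [Finset.sum_range_succ, Finset.sum_eq_zero, zero_add, wform_single_single,
        if_neg (hinj k (k + 1) (by omega) hk).symm, hA.apply, zero_add]
      intro i hi
      rw [Finset.mem_range] at hi
      rw [wform_single_single, if_neg (hinj i (k + 1) (by omega) hk).symm, hA.apply,
        hind i (k + 1) (by omega) hk]
      simp
    rw [e2, Finset.sum_range_succ (fun i => d (p i) * c i ^ 2) (k + 1),
      Finset.sum_range_succ (fun i => c i * c (i + 1)) k]
    have h1 := hsR (k + 1) hk
    have h2 : (chainSign A p (k + 1) : ℝ) = -A (p k) (p (k + 1)) * chainSign A p k := by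
      rw [chainSign]; push_cast; ring
    have h3 : (A (p k) (p (k + 1)) : ℝ) * A (p k) (p (k + 1)) = 1 := by
      rw [← sq]; exact_mod_cast hA1 k (by omega)
    have h4 := hsR k (by omega)
    have h5 : (chainSign A p (k + 1) : ℝ) * (chainSign A p k * A (p k) (p (k + 1))) = -1 := by
      rw [h2]; linear_combination (-(chainSign A p k : ℝ) * chainSign A p k) * h3 - h4
    push_cast
    linear_combination d (p (k + 1)) * c (k + 1) ^ 2 * h1 + 2 * c (k + 1) * c k * h5

/-- The signed average over a subset of a clique. -/
noncomputable def cliqueAvg (g : V → ℤ) (U : Finset V) : V → ℝ :=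
  ∑ k ∈ U, ((g k : ℝ) / U.card) • Pi.single k (1 : ℝ)

theorem cliqueAvg_apply_eq_zero {g : V → ℤ} {U : Finset V} {x : V} (h : x ∉ U) :
    cliqueAvg g U x = 0 := sum_single_apply_eq_zero (c := fun k => (g k : ℝ) / U.card) h

theorem wform_cliqueAvg_right {g : V → ℤ} {U : Finset V} (hU : U.Nonempty) {x : V → ℝ} {r : ℝ}
    (h : ∀ k ∈ U, g k * wform A d x (Pi.single k 1) = r) : wform A d x (cliqueAvg g U) = r := by
  have hpos : (0 : ℝ) < U.card := by exact_mod_cast Finset.card_pos.2 hU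
  rw [cliqueAvg, LinearMap.BilinForm.sum_right, Finset.sum_congr rfl fun k hk => by
    rw [LinearMap.BilinForm.smul_right, div_mul_eq_mul_div, h k hk], Finset.sum_const,
    nsmul_eq_mul]
  field_simp

theorem wform_cliqueAvg (h0 : ∀ i, A i i = 0) {g : V → ℤ} {U : Finset V} {θ : ℝ} (hU : U.Nonempty)
    (hd : ∀ k ∈ U, d k = θ) (hg : ∀ k ∈ U, g k ^ 2 = 1)
    (hK : ∀ x ∈ U, ∀ y ∈ U, x ≠ y → A x y = g x * g y) :
    wform A d (cliqueAvg g U) (cliqueAvg g U) = 1 + (θ - 1) / U.card := by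
  have hpos : (0 : ℝ) < U.card := by exact_mod_cast Finset.card_pos.2 hU
  have hgR : ∀ k ∈ U, (g k : ℝ) * g k = 1 := fun k hk => by rw [← sq]; exact_mod_cast hg k hk
  rw [cliqueAvg, wform_sum_const (a := θ / (U.card : ℝ) ^ 2) (b := 1 / (U.card : ℝ) ^ 2)]
  · field_simp; ring
  · intro i hi j hj
    rw [wform_smul_single]
    by_cases hij : i = j
    · subst hij
      rw [if_pos rfl, if_pos rfl, hd i hi, h0]
      have := hgR i hi
      field_simp
      push_cast
      linear_combination θ * this
    · rw [if_neg hij, if_neg hij, hK i hi j hj hij]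
      have := hgR i hi
      have := hgR j hj
      field_simp
      push_cast
      nlinarith

end sums

section small
variable {V : Type} [Fintype V] [DecidableEq V] {A : Matrix V V ℤ} {d : V → ℝ}

theorem card_image_range_le (p : ℕ → V) (k : ℕ) : ((Finset.range k).image p).card ≤ k :=
  Finset.card_image_le.trans (Finset.card_range k).le

theorem chainSum_apply_of_notMem {p : ℕ → V} {c : ℕ → ℝ} {k : ℕ} {x : V}
    (h : x ∉ (Finset.range k).image p) : chainSum A p c k x = 0 :=
  chainSum_apply_eq_zero fun i hi e =>
    h (Finset.mem_image.2 ⟨i, Finset.mem_range.2 hi, e⟩)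

/-- Below threshold two, long induced chains are not nonnegative. -/
theorem not_long_chain (hA : A.IsSymm) (h0 : ∀ i, A i i = 0) {θ : ℝ} {S : Finset V} {N : ℕ}
    (hN : 2 < N * (2 - θ)) (hgood : ∀ U ⊆ S, U.card ≤ N → PSDOn A d U) {p : ℕ → V}
    (hd : ∀ i < N, d (p i) = θ)
    (hp : ∀ i < N, p i ∈ S) (hA1 : ∀ i, i + 1 < N → A (p i) (p (i + 1)) ^ 2 = 1)
    (hinj : ∀ i j, i < j → j < N → p i ≠ p j)
    (hind : ∀ i j, i + 1 < j → j < N → A (p i) (p j) = 0) : False := by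
  obtain ⟨n, rfl⟩ : ∃ n, N = n + 1 := by
    rcases N with _ | n
    · norm_num at hN
    · exact ⟨n, rfl⟩
  have h := hgood ((Finset.range (n + 1)).image p)
    (fun x hx => by
      obtain ⟨i, hi, rfl⟩ := Finset.mem_image.1 hx
      exact hp i (Finset.mem_range.1 hi)) (card_image_range_le _ _)
    (chainSum A p (fun _ => 1) (n + 1)) fun x hx => chainSum_apply_of_notMem hx
  rw [wform_chainSum hA h0 (n := n) (fun i hi => hA1 i (by omega))
    (fun i j hij hj => hinj i j hij (by omega)) (fun i j hij hj => hind i j hij (by omega)) _ n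
    le_rfl, Finset.sum_congr rfl fun i hi => by rw [hd i (Finset.mem_range.1 hi)]] at h
  simp at h
  push_cast at hN
  nlinarith

/-- Below threshold two, a rooted chain closing up at the root has a bounded failure. -/
theorem cycle_neg (hA : A.IsSymm) (h0 : ∀ i, A i i = 0) {θ : ℝ} {v : V} (hθ : θ < 2)
    {n : ℕ} {p : ℕ → V} (hn : 2 ≤ n)
    (hp : ∀ i ≤ n, p i ≠ v) (hinj : ∀ i j, i < j → j ≤ n → p i ≠ p j)
    (hfirst : A v (p 0) ^ 2 = 1) (hlast : A v (p n) ^ 2 = 1)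
    (hinner : ∀ i, 0 < i → i < n → A v (p i) = 0)
    (hnext : ∀ i < n, A (p i) (p (i + 1)) ^ 2 = 1)
    (hfar : ∀ i j, i + 1 < j → j ≤ n → (0 < i ∨ j < n) → A (p i) (p j) = 0)
    (hends : A (p 0) (p n) = A v (p 0) * A v (p n)) :
    ¬ PSDOn A (rootDiag v 1 θ) (insert v ((Finset.range (n + 1)).image p)) := by
  intro h
  obtain ⟨k, rfl⟩ : ∃ k, n = k + 1 := ⟨n - 1, by omega⟩
  set d := rootDiag v 1 θ with hdd
  have hd : ∀ i ≤ k + 1, d (p i) = θ := fun i hi => rootDiag_of_ne (hp i hi) _ _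
  have hv : d v = 1 := rootDiag_self _ _ _
  have hs := chainSign_sq hnext
  set σ := chainSign A p with hσ
  set y := chainSum A p (fun _ => 1) (k + 1) with hy
  set w : V → ℝ := (σ (k + 1) : ℝ) • Pi.single (p (k + 1)) 1 with hw
  set ε : ℝ := σ (k + 1) * (A v (p 0) * A v (p (k + 1))) with hε
  set u : V → ℝ := (-((1 + ε) * A v (p 0))) • Pi.single v 1 with hu
  have h' := h ((y + w) + u) (by
    intro x hx
    rw [Finset.mem_insert, not_or] at hx
    have h1 : y x = 0 := chainSum_apply_eq_zero fun i hi e => hx.2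
      (Finset.mem_image.2 ⟨i, Finset.mem_range.2 (by omega), e⟩)
    have h2 : x ≠ p (k + 1) := fun e => hx.2 (Finset.mem_image.2 ⟨k + 1, by simp, e.symm⟩)
    simp [h1, hw, hu, h2, hx.1])
  have yy : wform A d y y = (k + 1) * θ - 2 * k := by
    rw [hy, wform_chainSum hA h0 (n := k) (fun i hi => hnext i (by omega))
      (fun i j hij hj => hinj i j hij (by omega))
      (fun i j hij hj => hfar i j hij (by omega) (by omega)) _ k le_rfl,
      Finset.sum_congr rfl fun i hi => by
        rw [hd i (by rw [Finset.mem_range] at hi; omega)]]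
    simp
  have hsR : ∀ i ≤ k + 1, (σ i : ℝ) * σ i = 1 := fun i hi => by
    rw [← sq]; exact_mod_cast hs i hi
  have hσs : (σ (k + 1) : ℝ) = -A (p k) (p (k + 1)) * σ k := by
    rw [hσ, chainSign]; push_cast; ring
  have ha : (A v (p 0) : ℝ) * A v (p 0) = 1 := by rw [← sq]; exact_mod_cast hfirst
  have hb : (A v (p (k + 1)) : ℝ) * A v (p (k + 1)) = 1 := by rw [← sq]; exact_mod_cast hlast
  have hab : (A (p k) (p (k + 1)) : ℝ) * A (p k) (p (k + 1)) = 1 := by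
    rw [← sq]; exact_mod_cast hnext k (by omega)
  have hσ0 : (σ 0 : ℝ) = 1 := by simp [hσ, chainSign]
  have hεε : ε * ε = 1 := by
    rw [hε]; linear_combination (A v (p 0) : ℝ) * A v (p 0) * A v (p (k + 1)) * A v (p (k + 1)) *
      hsR (k + 1) le_rfl + (A v (p 0) : ℝ) * A v (p 0) * hb + ha
  have yw : wform A d y w = -1 + ε := by
    rw [hw, LinearMap.BilinForm.smul_right, wform_symm hA, hy, wform_chainSum_right]
    have e2 : ∑ i ∈ Finset.range (k + 1), 1 * (chainSign A p i : ℝ) *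
        wform A d (Pi.single (p (k + 1)) 1) (Pi.single (p i) 1) =
        σ k * A (p k) (p (k + 1)) + A v (p 0) * A v (p (k + 1)) := by
      rw [Finset.sum_range_succ, Finset.sum_eq_single 0]
      · rw [wform_single_single, wform_single_single,
          if_neg (hinj k (k + 1) (by omega) le_rfl).symm,
          if_neg (hinj 0 (k + 1) (by omega) le_rfl).symm, hA.apply (p k), hA.apply (p 0), hends,
          ← hσ, hσ0]
        push_cast; ring
      · intro i hi hi0
        rw [Finset.mem_range] at hi
        rw [wform_single_single, if_neg (hinj i (k + 1) (by omega) le_rfl).symm, hA.apply,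
          hfar i (k + 1) (by omega) le_rfl (by omega)]
        simp
      · intro hk; simp at hk; omega
    rw [e2, hε, hσs]
    linear_combination (-(σ k : ℝ) * σ k) * hab - hsR k (by omega)
  have ww : wform A d w w = θ := by
    rw [hw, wform_smul_single, if_pos rfl, h0, hd _ le_rfl, hsR _ le_rfl]; simp
  have uu : wform A d u u = (1 + ε) ^ 2 := by
    rw [hu, wform_smul_single, if_pos rfl, h0, hv]
    push_cast
    linear_combination (1 + ε) ^ 2 * ha
  have vy : wform A d (Pi.single v 1) y = A v (p 0) := by
    rw [hy, wform_chainSum_right, Finset.sum_eq_single 0]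
    · rw [wform_single_single, if_neg (hp 0 (by omega)).symm, ← hσ, hσ0]; simp
    · intro i hi hi0
      rw [Finset.mem_range] at hi
      rw [wform_single_single, if_neg (hp i (by omega)).symm, hinner i (by omega) (by omega)]
      simp
    · simp
  have vw : wform A d (Pi.single v 1) w = σ (k + 1) * A v (p (k + 1)) := by
    rw [hw, LinearMap.BilinForm.smul_right, wform_single_single, if_neg (hp _ le_rfl).symm]
    ring
  have ywu : wform A d (y + w) u = -(1 + ε) ^ 2 := by
    rw [hu, LinearMap.BilinForm.smul_right, wform_symm hA, map_add, vy, vw]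
    have e3 : (A v (p 0) : ℝ) * (σ (k + 1) * A v (p (k + 1))) = ε := by rw [hε]; ring
    linear_combination -(1 + ε) * ha - (1 + ε) * e3
  rw [wform_self_add hA, ywu, uu, wform_self_add hA, yy, yw, ww] at h'
  have : (0 : ℝ) ≤ k := Nat.cast_nonneg _
  nlinarith

end small

/-- Among at least `3 * s` integers of absolute value at most one, `s` agree. -/
theorem exists_constant_subset {α : Type} {T : Finset α} {s : ℕ} (hT : 3 * s ≤ T.card) {f : α → ℤ}
    (hf : ∀ x ∈ T, |f x| ≤ 1) : ∃ b : ℤ, ∃ U ⊆ T, U.card = s ∧ ∀ x ∈ U, f x = b := by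
  have key : ∃ b ∈ Finset.Icc (-1 : ℤ) 1, s ≤ (T.filter fun x => f x = b).card := by
    by_contra hcon
    push Not at hcon
    have h := Finset.card_eq_sum_card_fiberwise (f := f) (s := T) (t := Finset.Icc (-1 : ℤ) 1)
      fun x hx => by simpa [abs_le] using hf x hx
    have h2 := Finset.sum_lt_sum_of_nonempty (s := Finset.Icc (-1 : ℤ) 1) (by simp) hcon
    simp at h2
    rw [← h] at h2
    omega
  obtain ⟨b, -, hb⟩ := key
  obtain ⟨U, hU, hUc⟩ := Finset.exists_subset_card_eq hb
  exact ⟨b, U, hU.trans (Finset.filter_subset _ _), hUc, fun x hx => (Finset.mem_filter.1 (hU hx)).2⟩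

/-- Below threshold two, the rooted form with a unit root has bounded obstructions. -/
theorem exists_fails_one {θ : ℝ} (hθ1 : 1 ≤ θ) (hθ2 : θ < 2) : ∃ B : ℕ, ∀ {V : Type} [Fintype V]
    [DecidableEq V] {A : Matrix V V ℤ} {v : V} {S : Finset V}, A.IsSymm → (∀ i, A i i = 0) →
    Conn A v S → (∀ x ∈ S, ∀ y ∈ S, |A x y| ≤ 1) → ¬ PSDOn A (rootDiag v 1 θ) S →
    Fails A θ 1 v S B := by
  obtain ⟨N, hN⟩ : ∃ N : ℕ, 2 / (2 - θ) < N := exists_nat_gt _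
  rw [div_lt_iff₀ (by linarith)] at hN
  have hNpos : 0 < N := by
    rcases Nat.eq_zero_or_pos N with h | h
    · subst h; norm_num at hN
    · exact h
  obtain ⟨D, hD⟩ := exists_clique_of_degree (3 * N + 1)
  refine ⟨(D + 1) ^ (N + 1) + 2 * N + 10, fun {V} _ _ A v S₀ hA h0 hc₀ hle₀ hS₀ => ?_⟩
  set B := (D + 1) ^ (N + 1) + 2 * N + 10 with hB
  by_contra hF
  -- a minimal connected failing set
  have hmin : ∃ S ⊆ S₀, Conn A v S ∧ ¬ PSDOn A (rootDiag v 1 θ) S ∧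
      ∀ S', S' ⊂ S → Conn A v S' → PSDOn A (rootDiag v 1 θ) S' := by
    clear hF hle₀
    induction S₀ using Finset.strongInduction with
    | H S₀ ih =>
      by_cases h : ∀ S', S' ⊂ S₀ → Conn A v S' → PSDOn A (rootDiag v 1 θ) S'
      · exact ⟨S₀, subset_rfl, hc₀, hS₀, h⟩
      · push Not at h
        obtain ⟨S', h1, h2, h3⟩ := h
        obtain ⟨S, h4, h5⟩ := ih S' h1 h2 h3
        exact ⟨S, h4.trans h1.subset, h5⟩
  obtain ⟨S, hSS, hc, hS, hP⟩ := hmin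
  have hle : ∀ x ∈ S, ∀ y ∈ S, |A x y| ≤ 1 := fun x hx y hy => hle₀ x (hSS hx) y (hSS hy)
  have hgood : ∀ U ⊆ S, U.card ≤ B → PSDOn A (rootDiag v 1 θ) U := by
    intro U hU hUB
    by_contra h
    exact hF ⟨U, hU.trans hSS, hUB, h⟩
  have hcardS : B < S.card := by
    by_contra h
    exact hS (hgood S subset_rfl (by omega))
  have hsq : ∀ x ∈ S, ∀ y ∈ S, A x y ≠ 0 → A x y ^ 2 = 1 := fun x hx y hy h =>
    sq_eq_one_of_abs_le (hle x hx y hy) h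
  have hgood6 : ∀ U ⊆ S, U.card ≤ 6 → PSDOn A (fun _ => θ) U := fun U hU h6 =>
    (hgood U hU (by omega)).mono_diag fun i _ => rootDiag_le hθ1 i
  have hlong : ∀ p : ℕ → V, (∀ i < N, p i ∈ S ∧ p i ≠ v) →
      (∀ i, i + 1 < N → A (p i) (p (i + 1)) ≠ 0) → (∀ i j, i < j → j < N → p i ≠ p j) →
      (∀ i j, i + 1 < j → j < N → A (p i) (p j) = 0) → False := fun p h1 h2 h3 h4 =>
    not_long_chain hA h0 hN (fun U hU h => hgood U hU (by omega))
      (fun i hi => rootDiag_of_ne (h1 i hi).2 _ _) (fun i hi => (h1 i hi).1)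
      (fun i hi => hsq _ (h1 i (by omega)).1 _ (h1 _ hi).1 (h2 i hi)) h3 h4
  have hnb : ∀ x ∈ S, ∀ y ∈ S, x ≠ y → A v x ≠ 0 → A v y ≠ 0 → A x y = A v x * A v y := by
    intro x hx y hy hxy hvx hvy
    by_contra hne
    have hxv : x ≠ v := fun h => hvx (h ▸ h0 v)
    have hyv : y ≠ v := fun h => hvy (h ▸ h0 v)
    have h1 := hle v hc.1 x hx
    have h2 := hle v hc.1 y hy
    have h3 := hle x hx y hy
    rw [abs_le] at h1 h2 h3
    have hρ : A v x * A v y * A x y ≤ 0 := by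
      have e1 : A v x = 1 ∨ A v x = -1 := by omega
      have e2 : A v y = 1 ∨ A v y = -1 := by omega
      rcases e1 with e | e <;> rcases e2 with e' | e' <;> rw [e, e'] at hne ⊢ <;> omega
    have hρR : (A v x : ℝ) * A v y * A x y ≤ 0 := by exact_mod_cast hρ
    have ha : (A v x : ℝ) ^ 2 = 1 := by exact_mod_cast hsq v hc.1 x hx hvx
    have hb : (A v y : ℝ) ^ 2 = 1 := by exact_mod_cast hsq v hc.1 y hy hvy
    obtain ⟨U, hU, hUc, hUn⟩ := Fails.of_cert_three hA h0 (θ := θ) (X := 1) (v := v) hc.1 hx hy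
      hxv.symm hyv.symm hxy 2 (-A v x) (-A v y) (by
        rw [rootDiag_self, rootDiag_of_ne hxv, rootDiag_of_ne hyv]
        nlinarith)
    exact hUn (hgood U hU (by omega))
  rcases single_neighbour_or_path hA h0 (by simp) hc hS hP hnb with
    ⟨w, hw, h1, h2⟩ | ⟨n, p, hn, hp, hinj, h1, h2, h3, h4, h5⟩
  swap
  · by_cases hnN : N ≤ n
    · exact hlong p (fun i hi => hp i (by omega)) (fun i hi => h4 i (by omega))
        (fun i j hij hj => hinj i j hij (by omega))
        (fun i j hij hj => h5 i j hij (by omega) (Or.inr (by omega)))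
    · refine cycle_neg hA h0 hθ2 hn (fun i hi => (hp i hi).2) hinj
        (hsq _ hc.1 _ (hp 0 (by omega)).1 h1) (hsq _ hc.1 _ (hp n le_rfl).1 h2) h3
        (fun i hi => hsq _ (hp i (by omega)).1 _ (hp (i + 1) (by omega)).1 (h4 i hi)) h5
        (hnb _ (hp 0 (by omega)).1 _ (hp n le_rfl).1 (hinj 0 n (by omega) le_rfl) h1 h2)
        (hgood _ ?_ ?_)
      · refine Finset.insert_subset hc.1 fun x hx => ?_
        obtain ⟨i, hi, rfl⟩ := Finset.mem_image.1 hx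
        exact (hp i (by rw [Finset.mem_range] at hi; omega)).1
      · refine (Finset.card_insert_le _ _).trans ?_
        have := card_image_range_le p (n + 1)
        omega
  -- a vertex of large degree
  obtain ⟨u, hu, hudeg⟩ : ∃ u ∈ S, D < (S.filter fun y => A u y ≠ 0).card := by
    by_contra hcon
    push Not at hcon
    obtain ⟨n, p, hn, hp0, hpS, hnext, hinj, hind, hpv⟩ := exists_long_chain (P := {v}) (L := N + 1)
      hc (by simp) (by simpa using hc.1) hcon (by simp; omega)
    exact hlong (fun i => p (i + 1))
      (fun i hi => ⟨hpS _ (by omega), by simpa using hpv (i + 1) (by omega) (by omega)⟩)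
      (fun i hi => hnext (i + 1) (by omega)) (fun i j hij hj => hinj _ _ (by omega) (by omega))
      (fun i j hij hj => hind _ _ (by omega) (by omega))
  obtain ⟨K₀, hK₀, hK₀c, hK₀A⟩ := hD hA h0 (by linarith) hle hgood6 u hu _ (Finset.filter_subset _ _)
    (fun x hx => (Finset.mem_filter.1 hx).2) hudeg.le
  set K := K₀.erase v with hK
  have hKcard : 3 * N ≤ K.card := by
    have := Finset.pred_card_le_card_erase (s := K₀) (a := v)
    rw [hK]; omega
  have hKv : ∀ k ∈ K, k ≠ v := fun k hk => Finset.ne_of_mem_erase hk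
  have hKK : ∀ k ∈ K, k ∈ S ∧ A u k ≠ 0 := fun k hk =>
    Finset.mem_filter.1 (hK₀ (Finset.mem_of_mem_erase hk))
  set g : V → ℤ := fun k => A u k with hg
  have hg2 : ∀ k ∈ K, g k ^ 2 = 1 := fun k hk => hsq u hu k (hKK k hk).1 (hKK k hk).2
  have hKA : ∀ x ∈ K, ∀ y ∈ K, x ≠ y → A x y = g x * g y := fun x hx y hy =>
    hK₀A x (Finset.mem_of_mem_erase hx) y (Finset.mem_of_mem_erase hy)
  have hN3 : 3 ≤ N := by
    have : (2 : ℝ) < N := by nlinarith [(Nat.cast_pos (α := ℝ)).2 hNpos]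
    exact_mod_cast this
  have hadj : ∀ k ∈ K, ∃ k' ∈ K, A k k' ≠ 0 := by
    intro k hk
    obtain ⟨k', hk', hne⟩ := Finset.exists_mem_ne (s := K) (by omega) k
    refine ⟨k', hk', ?_⟩
    rw [hKA k hk k' hk' hne.symm]
    exact mul_ne_zero (hKK k hk).2 (hKK k' hk').2
  obtain ⟨k₀, hk₀⟩ : K.Nonempty := Finset.card_pos.1 (by omega)
  -- a shortest chain from the root to the clique
  obtain ⟨m, q, hq0, hqm, hR, hinj, hind, hnQ, hqv⟩ :=
    exists_shortest_chain (P := fun y => y = v) (Q := fun y => ∃ k ∈ K, A y k ≠ 0) rfl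
      (hadj k₀ hk₀) (hc.2 k₀ (hKK k₀ hk₀).1)
  have hqS : ∀ i ≤ m, q i ∈ S := by
    intro i hi
    rcases i with _ | i
    · rw [hq0]; exact hc.1
    · exact (hR i (by omega)).1
  have hind' : ∀ i j, i + 1 < j → j ≤ m → A (q i) (q j) = 0 := by
    intro i j hij hj
    by_contra hne
    exact hind i j hij hj ⟨hqS j hj, hne⟩
  have hqK : ∀ i ≤ m, q i ∉ K := by
    intro i hi hiK
    rcases Nat.lt_or_ge i m with h | h
    · exact hnQ i h (hadj _ hiK)
    · rcases i with _ | i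
      · exact hKv _ hiK hq0
      · exact hnQ i (by omega) ⟨_, hiK, (hR i (by omega)).2⟩
  have hqK0 : ∀ i < m, ∀ k ∈ K, A (q i) k = 0 := by
    intro i hi k hk
    by_contra hne
    exact hnQ i hi ⟨k, hk, hne⟩
  have hmN : m < N := by
    by_contra h
    exact hlong (fun i => q (i + 1)) (fun i hi => ⟨hqS _ (by omega), hqv _ (by omega) (by omega)⟩)
      (fun i hi => (hR (i + 1) (by omega)).2) (fun i j hij hj => hinj _ _ (by omega) (by omega))
      (fun i j hij hj => hind' _ _ (by omega) (by omega))
  have hA1 : ∀ i < m, A (q i) (q (i + 1)) ^ 2 = 1 := fun i hi =>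
    hsq _ (hqS i hi.le) _ (hqS _ hi) (hR i hi).2
  set d := rootDiag v 1 θ with hd
  have hdv : d v = 1 := rootDiag_self _ _ _
  have hdq : ∀ x, x ≠ v → d x = θ := fun x hx => rootDiag_of_ne hx _ _
  set σ := chainSign A q with hσ
  have hs := chainSign_sq hA1
  set P := chainSum A q (fun _ => 1) (m + 1) with hPdef
  have hPP : wform A d P P = 1 - m * (2 - θ) := by
    rw [hPdef, wform_chainSum hA h0 hA1 hinj hind' _ m le_rfl, Finset.sum_range_succ',
      hq0, hdv, Finset.sum_congr rfl fun i hi => by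
        rw [hdq _ (hqv (i + 1) (by omega) (by rw [Finset.mem_range] at hi; omega))]]
    simp; ring
  have hPk : ∀ k ∈ K, wform A d P (Pi.single k 1) = σ m * A (q m) k := by
    intro k hk
    have hne : ∀ i ≤ m, k ≠ q i := fun i hi h => hqK i hi (h ▸ hk)
    rw [wform_symm hA, hPdef, wform_chainSum_right, Finset.sum_range_succ, Finset.sum_eq_zero,
      zero_add, wform_single_single, if_neg (hne m le_rfl), hA.apply]
    · ring
    · intro i hi
      rw [Finset.mem_range] at hi
      rw [wform_single_single, if_neg (hne i hi.le), hA.apply, hqK0 i hi k hk]; simp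
  have hsm : (σ m : ℝ) ^ 2 = 1 := by exact_mod_cast hs m le_rfl
  have hgR : ∀ k ∈ K, (g k : ℝ) ^ 2 = 1 := fun k hk => by exact_mod_cast hg2 k hk
  obtain ⟨b, U, hUK, hUN, hUb⟩ := exists_constant_subset hKcard
    (f := fun k => σ m * A (q m) k * g k) (fun k hk => by
      rw [← sq_le_one_iff_abs_le_one, mul_pow, mul_pow, hg2 k hk, hs m le_rfl, one_mul, mul_one,
        sq_le_one_iff_abs_le_one]
      exact hle _ (hqS m le_rfl) _ (hKK k hk).1)
  have hUne : U.Nonempty := Finset.card_pos.1 (by omega)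
  have haa : wform A d (cliqueAvg g U) (cliqueAvg g U) = 1 + (θ - 1) / N := by
    rw [wform_cliqueAvg h0 hUne (fun k hk => hdq k (hKv k (hUK hk))) (fun k hk => hg2 k (hUK hk))
      (fun x hx y hy => hKA x (hUK hx) y (hUK hy)), hUN]
  have hPa : wform A d P (cliqueAvg g U) = b := by
    refine wform_cliqueAvg_right hUne fun k hk => ?_
    rw [hPk k (hUK hk), ← hUb k hk]; push_cast; ring
  have hsmall : (θ - 1) / N < 2 - θ := by
    rw [div_lt_iff₀ (by exact_mod_cast hNpos)]
    linarith
  have hm0 : (0 : ℝ) ≤ m := Nat.cast_nonneg _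
  set T := (Finset.range (m + 1)).image q with hT
  have hTc : T.card ≤ m + 1 := card_image_range_le q (m + 1)
  have hTS : T ⊆ S := fun x hx => by
    obtain ⟨i, hi, rfl⟩ := Finset.mem_image.1 hx
    exact hqS i (by rw [Finset.mem_range] at hi; omega)
  have hUS : U ⊆ S := fun x hx => (hKK x (hUK hx)).1
  by_cases hb : b = 0
  · obtain ⟨k₁, hk₁, hk₁A⟩ := hqm
    set b₁ : ℝ := σ m * A (q m) k₁ * g k₁ with hb₁
    have hb2 : b₁ ^ 2 = 1 := by
      have h3 : (A (q m) k₁ : ℝ) ^ 2 = 1 := by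
        exact_mod_cast hsq _ (hqS m le_rfl) _ (hKK _ hk₁).1 hk₁A
      rw [hb₁, mul_pow, mul_pow, hsm, h3, hgR k₁ hk₁]; norm_num
    have hk₁U : k₁ ∉ U := by
      intro h
      have h3 := hUb k₁ h
      rw [hb] at h3
      have h4 : b₁ = 0 := by rw [hb₁]; exact_mod_cast h3
      rw [h4] at hb2; norm_num at hb2
    have h3 := hgood (insert k₁ (T ∪ U))
      (Finset.insert_subset (hKK _ hk₁).1 (Finset.union_subset hTS hUS))
      ((Finset.card_insert_le _ _).trans (by have := Finset.card_union_le T U; omega))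
      ((P + (-(b₁ * g k₁)) • Pi.single k₁ 1) + b₁ • cliqueAvg g U) (by
        intro x hx
        rw [Finset.mem_insert, Finset.mem_union, not_or, not_or] at hx
        simp [hx.1, cliqueAvg_apply_eq_zero hx.2.2, hPdef, chainSum_apply_of_notMem hx.2.1])
    have h4 : wform A d (Pi.single k₁ 1) (cliqueAvg g U) = g k₁ := by
      refine wform_cliqueAvg_right hUne fun k hk => ?_
      have hne : k₁ ≠ k := fun h => hk₁U (h ▸ hk)
      rw [wform_single_single, if_neg hne, hKA k₁ hk₁ k (hUK hk) hne]
      push_cast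
      linear_combination (g k₁ : ℝ) * hgR k (hUK hk)
    have h5 : wform A d P (Pi.single k₁ 1) = b₁ * g k₁ := by
      rw [hPk k₁ hk₁, hb₁]
      linear_combination -((σ m : ℝ) * A (q m) k₁) * hgR k₁ hk₁
    have h6 : wform A d (Pi.single k₁ 1) (Pi.single k₁ 1) = θ := by
      rw [wform_single_single, if_pos rfl, hdq _ (hKv _ hk₁), h0]; simp
    rw [wform_self_add hA, wform_self_add hA] at h3
    simp only [LinearMap.BilinForm.smul_left, LinearMap.BilinForm.smul_right,
      LinearMap.BilinForm.add_left] at h3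
    rw [hPP, hPa, haa, h4, h5, h6, hb] at h3
    have h7 : (b₁ * g k₁) * (b₁ * g k₁) = 1 := by
      linear_combination (g k₁ : ℝ) ^ 2 * hb2 + hgR k₁ hk₁
    have h8 : b₁ * (b₁ * g k₁ * g k₁) = 1 := by linear_combination h7
    push_cast at h3
    nlinarith
  · have hb1 : b = 1 ∨ b = -1 := by
      obtain ⟨k, hk⟩ := hUne
      have h3 := hUb k hk
      have h4 : b ^ 2 ≤ 1 := by
        rw [← h3, mul_pow, mul_pow, hg2 k (hUK hk), hs m le_rfl, one_mul, mul_one,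
          sq_le_one_iff_abs_le_one]
        exact hle _ (hqS m le_rfl) _ (hKK k (hUK hk)).1
      rw [sq_le_one_iff_abs_le_one, abs_le] at h4
      omega
    have hb2 : (b : ℝ) ^ 2 = 1 := by rcases hb1 with h | h <;> simp [h]
    have hm1 : 1 ≤ m := by
      by_contra hm
      have hm : m = 0 := by omega
      have hUw : ∀ k ∈ U, k = w := by
        intro k hk
        by_contra hkw
        have h3 := hUb k hk
        simp only [hm, hq0, h2 k (hUS hk) hkw] at h3
        apply hb; rw [← h3]; ring
      have := Finset.card_le_one.2 fun a ha b hb => (hUw a ha).trans (hUw b hb).symm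
      omega
    have h3 := hgood (T ∪ U) (Finset.union_subset hTS hUS)
      (by have := Finset.card_union_le T U; omega) (P + (-(b : ℝ)) • cliqueAvg g U) (by
        intro x hx
        rw [Finset.mem_union, not_or] at hx
        simp [cliqueAvg_apply_eq_zero hx.2, hPdef, chainSum_apply_of_notMem hx.1])
    rw [wform_self_add hA] at h3
    simp only [LinearMap.BilinForm.smul_left, LinearMap.BilinForm.smul_right] at h3
    rw [hPP, hPa, haa] at h3
    have hm1R : (1 : ℝ) ≤ m := by exact_mod_cast hm1
    nlinarith

/-- Connected sets that are bad for the rooted form with root weight one have obstructions of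
bounded size for a root weight `X` and a threshold `θ`. -/
def RootBound (θ X : ℝ) (M : ℕ) : Prop :=
  ∀ {V : Type} [Fintype V] [DecidableEq V] {A : Matrix V V ℤ}, A.IsSymm → (∀ i, A i i = 0) →
    ∀ {v : V} {S : Finset V}, Conn A v S → ¬ PSDOn A (rootDiag v 1 (min θ 2)) S → Fails A θ X v S M

theorem sqrt_root_bounds {β : ℝ} (hβ : β ^ 3 = β + 1) :
    1.324 < β ∧ 1.15 < √β ∧ √β < 1.151 ∧ √β ^ 2 = β := by
  have h1 : 1.324 < β := by
    by_contra! h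
    have : β ^ 3 - β - 1 < 0 := by
      rcases le_or_gt β 1 with h' | h'
      · nlinarith [sq_nonneg (β + 1), sq_nonneg (β + 1/2), mul_nonneg (sub_nonneg.2 h') (sq_nonneg (β + 1/2)), mul_nonneg (sub_nonneg.2 h') (sq_nonneg (β))]
      · nlinarith [mul_nonneg (sub_nonneg.2 h) (sub_nonneg.2 h'.le), mul_nonneg (sub_nonneg.2 h) (sq_nonneg β)]
    linarith
  have h2 : β < 1.324801 := by
    by_contra! h
    nlinarith [mul_nonneg (sub_nonneg.2 h) (sq_nonneg β), mul_nonneg (sub_nonneg.2 h) (show (0 : ℝ) ≤ β by linarith)]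
  refine ⟨h1, ?_, ?_, Real.sq_sqrt (by linarith)⟩
  · exact Real.lt_sqrt_of_sq_lt (by norm_num; linarith)
  · rw [Real.sqrt_lt' (by norm_num)]; norm_num; linarith

theorem exists_rootBound_two {β : ℝ} (hβ : β ^ 3 = β + 1) {θ : ℝ} (h2 : 2 ≤ θ)
    (hθ : θ < √β + (√β)⁻¹) : θ < 2.0199 ∧ ∃ X M, 1 < X ∧ X < 1.151 ∧ θ < X + 1 / X ∧
      RootBound θ X M := by
  obtain ⟨h1, hb1, hb2, hb⟩ := sqrt_root_bounds hβ
  set b := √β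
  have hb0 : 0 < b := by linarith
  have hθ' : θ < 2.0199 := by
    have : b⁻¹ * b = 1 := inv_mul_cancel₀ hb0.ne'
    nlinarith [inv_pos.2 hb0]
  have h6 : b ^ 6 = b ^ 2 + 1 := by
    rw [hb, ← hβ, ← hb]; ring
  have hl : b + b⁻¹ = b ^ 5 := by
    field_simp; linarith
  have hk : θ < b ^ 5 := hl ▸ hθ
  have hT : b - 1 / θ - 1 / (θ - 1 / θ) < 0 := by
    have hθ0 : 0 < θ := by linarith
    have e1 : θ - 1 / θ = (θ ^ 2 - 1) / θ := by field_simp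
    have hp : 0 < θ ^ 2 - 1 := by nlinarith
    have e2 : b - 1 / θ - 1 / (θ - 1 / θ) = (b * θ * (θ ^ 2 - 1) - (2 * θ ^ 2 - 1)) / (θ * (θ ^ 2 - 1)) := by
      rw [e1]; field_simp; ring
    rw [e2]
    apply div_neg_of_neg_of_pos _ (by positivity)
    have hz : b * b ^ 5 * ((b ^ 5) ^ 2 - 1) - (2 * (b ^ 5) ^ 2 - 1) = 0 := by
      have : b * b ^ 5 * ((b ^ 5) ^ 2 - 1) - (2 * (b ^ 5) ^ 2 - 1)
        = (b ^ 6 - b ^ 2 - 1) * (b ^ 10 + b ^ 6 - b ^ 4 + b ^ 2 - 1) := by ring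
      rw [this, h6]; ring
    set t := b ^ 5
    have e3 : b * t * (t ^ 2 - 1) - (2 * t ^ 2 - 1) - (b * θ * (θ ^ 2 - 1) - (2 * θ ^ 2 - 1)) =
       (t - θ) * (b * (t ^ 2 + t * θ + θ ^ 2) - b - 2 * (t + θ)) := by ring
    have : 0 < b * (t ^ 2 + t * θ + θ ^ 2) - b - 2 * (t + θ) := by
      nlinarith [mul_pos hb0 (show 0 < t ^ 2 + t * θ + θ ^ 2 - 1 - 2 * (t + θ) by nlinarith)]
    nlinarith [mul_pos (sub_pos.2 hk) this]
  have hd : 0 < b + 1 / b - θ := by rw [one_div]; linarith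
  obtain ⟨L, hL⟩ := exists_nat_ge (θ / (b + 1 / b - θ))
  rw [div_le_iff₀ hd] at hL
  refine ⟨hθ', b, 7 + L, by linarith, hb2, by linarith, ?_⟩
  intro V _ _ A hA h0 v S hc hS
  rw [min_eq_right h2] at hS
  exact fails_of_not_psd_two hA h0 h2 hθ' (by linarith) hb2 hT (by linarith) (by linarith) hc hS

theorem exists_rootBound_one {θ : ℝ} (h1 : 1 ≤ θ) (hθ : θ < 2) :
    ∃ X M, 1 < X ∧ X < 1.151 ∧ RootBound θ X M := by
  obtain ⟨B, hB⟩ := exists_fails_one h1 hθ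
  obtain ⟨ε, hε, h⟩ := exists_pos_forall_card_le B 1 θ 1
  set X : ℝ := min (1 + ε) 1.15
  have hX1 : 1 < X := lt_min (by linarith) (by norm_num)
  have hX2 : X < 1.151 := (min_le_right _ _).trans_lt (by norm_num)
  refine ⟨X, max B 2, hX1, hX2, ?_⟩
  intro V _ _ A hA h0 v S hc hS
  rw [min_eq_left hθ.le] at hS
  by_cases hle : ∀ x ∈ S, ∀ y ∈ S, |A x y| ≤ 1
  · obtain ⟨U, hU, hM, hf⟩ := hB hA h0 hc hle hS
    refine ⟨U, hU, hM.trans (le_max_left _ _), fun hp => ?_⟩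
    refine h A v U hM (fun x hx y hy => hle x (hU hx) y (hU hy)) hf (hp.mono_diag fun x _ => ?_)
    by_cases hxv : x = v
    · subst hxv; simp [X]
    · simp [rootDiag_of_ne hxv, hε.le]
  · push Not at hle
    obtain ⟨x, hx, y, hy, hxy⟩ := hle
    have hne : x ≠ y := by rintro rfl; simp [h0] at hxy
    refine Fails.mono (Fails.of_pair hA h0 hne hx hy ?_) le_rfl subset_rfl (le_max_right _ _)
    have e : (2 : ℝ) ≤ |A x y| := by exact_mod_cast hxy
    have e2 : |((A x y : ℤ) : ℝ)| = ((|A x y| : ℤ) : ℝ) := by simp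
    have a : ∀ x, rootDiag v X θ x < 2 := fun x => by
      by_cases hxv : x = v
      · subst hxv; rw [rootDiag_self]; linarith
      · rwa [rootDiag_of_ne hxv]
    have a1 := a x
    have a2 := a y
    simp only [Int.cast_abs] at *
    linarith

section extend
variable {V : Type} {A : Matrix V V ℤ}

/-- The matrix with an additional vertex attached according to `b`. -/
def extendBy (A : Matrix V V ℤ) (b : V → ℤ) : Matrix (Option V) (Option V) ℤ :=
  Matrix.of fun x y => x.elim (y.elim 0 b) fun x' => y.elim (b x') (A x')

@[simp] theorem extendBy_none_none (b : V → ℤ) : extendBy A b none none = 0 := rfl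
@[simp] theorem extendBy_none_some (b : V → ℤ) (x : V) : extendBy A b none (some x) = b x := rfl
@[simp] theorem extendBy_some_none (b : V → ℤ) (x : V) : extendBy A b (some x) none = b x := rfl
@[simp] theorem extendBy_some_some (b : V → ℤ) (x y : V) :
    extendBy A b (some x) (some y) = A x y := rfl

theorem extendBy_isSymm (hA : A.IsSymm) (b : V → ℤ) : (extendBy A b).IsSymm :=
  Matrix.IsSymm.ext fun i j => by cases i <;> cases j <;> simp [hA.apply]

theorem Conn.extendBy [DecidableEq V] {b : V → ℤ} {S : Finset V} {z : V} (hc : Conn A z S) (hz : b z ≠ 0) :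
    Conn (extendBy A b) none (insert none (S.image some)) := by
  refine ⟨by simp, fun x hx => ?_⟩
  rcases x with _ | x
  · exact .refl
  have hx' : x ∈ S := by simpa using hx
  refine Relation.ReflTransGen.head (b := some z) ⟨by simp [hc.1], by simpa⟩ ?_
  exact (hc.2 x hx').lift some fun a c h => ⟨by simp [h.1], by simpa using h.2⟩

variable [Fintype V] [DecidableEq V]

/-- A family of nearly equal short vectors, almost all of which have integral products with any
given vertex, acts as an additional vertex of small weight. -/
theorem psdOn_of_family (hA : A.IsSymm) (h0 : ∀ i, A i i = 0) {θ X : ℝ} {M m c : ℕ}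
    (hR : RootBound θ X M) (hθ : θ < 2.1) {u : V} {S T : Finset V} (hc : Conn A u S)
    (hTS : T ⊆ S) (hTm : T.card ≤ m)
    (hgood : ∀ U ⊆ S, U.card ≤ M + m + 1 → PSDOn A (fun _ => θ) U)
    {ι : Type*} (J : Finset ι) (e : ι → V → ℝ) (he : ∀ l ∈ J, ∀ i, i ∉ T → e l i = 0)
    (hnorm : ∀ l ∈ J, wform A (fun _ => θ) (e l) (e l) ≤ X)
    (hdiff : ∀ l ∈ J, ∀ l' ∈ J, wform A (fun _ => θ) (e l - e l') (e l - e l') ≤ 1 / 4)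
    (E : V → Finset ι) (hE : ∀ z ∈ S, (E z).card ≤ c)
    (hmid : ∀ z ∈ S, ∀ l ∈ J, l ∉ E z →
      ∃ k : ℤ, wform A (fun _ => θ) (Pi.single z 1) (e l) = k)
    (hJ : c * (M + 1) < J.card) {z₀ : V} (hz₀ : z₀ ∈ S) {l₀ : ι} (hl₀ : l₀ ∈ J)
    (hlz : l₀ ∉ E z₀) (hne : wform A (fun _ => θ) (Pi.single z₀ 1) (e l₀) ≠ 0) :
    PSDOn A (fun _ => θ) S := by
  have hcons : ∀ z ∈ S, ∀ l ∈ J, ∀ l' ∈ J, ∀ k k' : ℤ,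
      wform A (fun _ => θ) (Pi.single z 1) (e l) = k →
      wform A (fun _ => θ) (Pi.single z 1) (e l') = k' → k = k' := by
    intro z hz l hl l' hl' k k' hk hk'
    by_contra hkk
    have hp : PSDOn A (fun _ => θ) (insert z T) :=
      hgood _ (Finset.insert_subset hz hTS) ((Finset.card_insert_le _ _).trans (by omega))
    have hv : ∀ t : ℝ, 0 ≤ θ + 2 * t * (k - k') + t ^ 2 * (1 / 4) := by
      intro t
      have := hp (Pi.single z 1 + t • (e l - e l')) fun i hi => by
        rw [Finset.mem_insert, not_or] at hi
        simp [hi.1, he l hl i hi.2, he l' hl' i hi.2]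
      rw [wform_self_add hA] at this
      simp only [map_smul, LinearMap.smul_apply] at this
      rw [map_sub (wform A (fun _ => θ) (Pi.single z 1)), hk, hk', wform_single_single] at this
      simp only [h0, smul_eq_mul] at this
      have h3 := mul_le_mul_of_nonneg_left (hdiff l hl l' hl') (sq_nonneg t)
      simp only [if_true, Int.cast_zero] at this
      linarith
    have h1 : (1 : ℝ) ≤ |(k : ℝ) - k'| := by
      have : 1 ≤ |k - k'| := Int.one_le_abs (sub_ne_zero.2 hkk)
      exact_mod_cast this
    rcases le_abs.1 h1 with h | h
    · have := hv (-2); linarith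
    · have := hv 2; linarith
  have hex : ∀ F : Finset V, F ⊆ S → F.card ≤ M + 1 → ∃ l ∈ J, ∀ z ∈ F, l ∉ E z := by
    intro F hF hFc
    by_contra! h
    have h1 : J ⊆ F.biUnion E := fun l hl => by
      obtain ⟨z, hz, h⟩ := h l hl
      exact Finset.mem_biUnion.2 ⟨z, hz, h⟩
    have h2 := (Finset.card_le_card h1).trans
      (Finset.card_biUnion_le_card_mul F E c fun z hz => hE z (hF hz))
    have := Nat.mul_le_mul_right c hFc
    linarith
  have hb : ∀ z, ∃ k : ℤ, z ∈ S → ∀ l ∈ J, l ∉ E z →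
      wform A (fun _ => θ) (Pi.single z 1) (e l) = k := by
    intro z
    by_cases hz : z ∈ S
    · obtain ⟨l, hl, hlE⟩ := hex {z} (by simpa) (by simp)
      obtain ⟨k, hk⟩ := hmid z hz l hl (hlE z (by simp))
      refine ⟨k, fun _ l' hl' hlE' => ?_⟩
      obtain ⟨k', hk'⟩ := hmid z hz l' hl' hlE'
      rw [hk', hcons z hz l' hl' l hl k' k hk' hk]
    · exact ⟨0, fun h => absurd h hz⟩
  choose b hb using hb
  have hbz : b z₀ ≠ 0 := fun h => hne (by rw [hb z₀ hz₀ l₀ hl₀ hlz, h]; simp)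
  have hconn : Conn (extendBy A b) none (insert none (S.image some)) := (hc.reroot hA hz₀).extendBy hbz
  have hA' := extendBy_isSymm hA b
  have h0' : ∀ i, extendBy A b i i = 0 := fun i => by cases i <;> simp [h0]
  by_cases hp : PSDOn (extendBy A b) (rootDiag none 1 (min θ 2)) (insert none (S.image some))
  · have h1 := hp.mono (Finset.subset_insert none (S.image some))
    rw [← psdOn_submatrix_iff (Option.some_injective V)] at h1
    have h2 : (extendBy A b).submatrix some some = A := rfl
    rw [h2] at h1
    exact h1.mono_diag fun i _ => by simp [rootDiag_of_ne]
  · exfalso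
    obtain ⟨U, hU, hUM, hf⟩ := hR hA' h0' hconn hp
    let F := S.filter fun z => some z ∈ U
    have hFU : (F.image some).card ≤ M := (Finset.card_le_card fun x hx => by
      obtain ⟨z, hz, rfl⟩ := Finset.mem_image.1 hx
      exact (Finset.mem_filter.1 hz).2).trans hUM
    rw [Finset.card_image_of_injective _ (Option.some_injective V)] at hFU
    have hmem : ∀ z, some z ∈ U → z ∈ F := fun z hz =>
      Finset.mem_filter.2 ⟨by simpa using hU hz, hz⟩
    have hFS : F ⊆ S := Finset.filter_subset _ _
    obtain ⟨l, hl, hlF⟩ := hex F hFS (by omega)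
    refine hf ((hgood (F ∪ T) (Finset.union_subset hFS hTS)
      ((Finset.card_union_le _ _).trans (by omega))).of_gram
      (fun w => w.elim (e l) fun z => Pi.single z 1) ?_ ?_ ?_)
    · intro w hw i hi
      rw [Finset.mem_union, not_or] at hi
      rcases w with _ | z
      · exact he l hl i hi.2
      · have : i ≠ z := by rintro rfl; exact hi.1 (hmem _ hw)
        simp [this]
    · intro w hw
      rcases w with _ | z
      · simpa using hnorm l hl
      · simp [wform_single_single, rootDiag_of_ne]
    · intro w hw w' hw' hww
      rcases w with _ | z <;> rcases w' with _ | z'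
      · exact absurd rfl hww
      · simp only [Option.elim, extendBy_none_some]
        rw [wform_symm hA]
        exact hb z' (hFS (hmem _ hw')) l hl (hlF _ (hmem _ hw'))
      · simp only [Option.elim, extendBy_some_none]
        exact hb z (hFS (hmem _ hw)) l hl (hlF _ (hmem _ hw))
      · simp only [Option.elim, extendBy_some_some]
        have : z ≠ z' := fun h => hww (by rw [h])
        simp [wform_single_single, this]

end extend

section clique
variable {V : Type} [Fintype V] [DecidableEq V] {A : Matrix V V ℤ} {d : V → ℝ}

theorem wform_cliqueAvg_disjoint (hA : A.IsSymm) {g : V → ℤ} {K U U' : Finset V} (hU : U.Nonempty)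
    (hU' : U'.Nonempty) (hUK : U ⊆ K) (hUK' : U' ⊆ K) (hdis : Disjoint U U')
    (hg : ∀ k ∈ K, g k ^ 2 = 1) (hK : ∀ x ∈ K, ∀ y ∈ K, x ≠ y → A x y = g x * g y) :
    wform A d (cliqueAvg g U) (cliqueAvg g U') = 1 := by
  have hgR : ∀ k ∈ K, (g k : ℝ) * g k = 1 := fun k hk => by rw [← sq]; exact_mod_cast hg k hk
  refine wform_cliqueAvg_right hU' fun k hk => ?_
  rw [wform_symm hA, wform_cliqueAvg_right hU (r := g k) fun k' hk' => ?_]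
  · exact hgR k (hUK' hk)
  have hne : k ≠ k' := fun h => Finset.disjoint_left.1 hdis hk' (h ▸ hk)
  rw [wform_single_single, if_neg hne, hK k (hUK' hk) k' (hUK hk') hne]
  push_cast
  linear_combination (g k : ℝ) * hgR k' (hUK hk')

theorem wform_cliqueAvg_sub (hA : A.IsSymm) (h0 : ∀ i, A i i = 0) {θ : ℝ} {g : V → ℤ}
    {K U U' : Finset V} {n : ℕ} (hn : 0 < n) (hU : U.card = n) (hU' : U'.card = n) (hUK : U ⊆ K)
    (hUK' : U' ⊆ K) (hdis : Disjoint U U') (hg : ∀ k ∈ K, g k ^ 2 = 1)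
    (hK : ∀ x ∈ K, ∀ y ∈ K, x ≠ y → A x y = g x * g y) :
    wform A (fun _ => θ) (cliqueAvg g U - cliqueAvg g U') (cliqueAvg g U - cliqueAvg g U')
      = 2 * (θ - 1) / n := by
  have hne : U.Nonempty := Finset.card_pos.1 (by omega)
  have hne' : U'.Nonempty := Finset.card_pos.1 (by omega)
  rw [LinearMap.BilinForm.sub_left, LinearMap.BilinForm.sub_right, LinearMap.BilinForm.sub_right,
    wform_cliqueAvg_disjoint hA hne hne' hUK hUK' hdis hg hK,
    wform_cliqueAvg_disjoint hA hne' hne hUK' hUK hdis.symm hg hK,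
    wform_cliqueAvg h0 hne (fun _ _ => rfl) (fun k hk => hg k (hUK hk))
      (fun x hx y hy => hK x (hUK hx) y (hUK hy)),
    wform_cliqueAvg h0 hne' (fun _ _ => rfl) (fun k hk => hg k (hUK' hk))
      (fun x hx y hy => hK x (hUK' hx) y (hUK' hy)), hU, hU']
  ring

theorem wform_single_cliqueAvg {g : V → ℤ} {U : Finset V} {z : V} (hz : z ∉ U) :
    wform A d (Pi.single z 1) (cliqueAvg g U) = ∑ k ∈ U, (g k : ℝ) * A z k / U.card := by
  rw [cliqueAvg, LinearMap.BilinForm.sum_right]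
  refine Finset.sum_congr rfl fun k hk => ?_
  have : z ≠ k := fun h => hz (h ▸ hk)
  rw [LinearMap.BilinForm.smul_right, wform_single_single, if_neg this]
  ring

/-- Only few disjoint pairs in a clique are distinguished by a given vertex. -/
theorem card_nonhomogeneous_lt (hA : A.IsSymm) (h0 : ∀ i, A i i = 0) {θ : ℝ} (hθ : θ < 2.1)
    {g : V → ℤ} {S K : Finset V} (hKS : K ⊆ S) (hg : ∀ k ∈ K, g k ^ 2 = 1)
    (hK : ∀ x ∈ K, ∀ y ∈ K, x ≠ y → A x y = g x * g y)
    (hgood : ∀ U ⊆ S, U.card ≤ 17 → PSDOn A (fun _ => θ) U) {z : V} (hz : z ∈ S)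
    {ι : Type*} (F : Finset ι) (a b : ι → V) (ha : ∀ l ∈ F, a l ∈ K) (hb : ∀ l ∈ F, b l ∈ K)
    (haz : ∀ l ∈ F, a l ≠ z) (hbz : ∀ l ∈ F, b l ≠ z)
    (hai : Set.InjOn a F) (hbi : Set.InjOn b F) (hab : ∀ l ∈ F, ∀ l' ∈ F, a l ≠ b l')
    (hlt : ∀ l ∈ F, g (b l) * A z (b l) < g (a l) * A z (a l)) : F.card < 8 := by
  by_contra! hF
  obtain ⟨F', hF', hc⟩ := Finset.exists_subset_card_eq hF
  have ca : (F'.image a).card = 8 := by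
    rw [Finset.card_image_of_injOn (hai.mono (by exact_mod_cast hF')), hc]
  have cb : (F'.image b).card = 8 := by
    rw [Finset.card_image_of_injOn (hbi.mono (by exact_mod_cast hF')), hc]
  have sa : F'.image a ⊆ K := by
    intro x hx; obtain ⟨l, hl, rfl⟩ := Finset.mem_image.1 hx; exact ha l (hF' hl)
  have sb : F'.image b ⊆ K := by
    intro x hx; obtain ⟨l, hl, rfl⟩ := Finset.mem_image.1 hx; exact hb l (hF' hl)
  have za : z ∉ F'.image a := by
    intro hx; obtain ⟨l, hl, h⟩ := Finset.mem_image.1 hx; exact haz l (hF' hl) h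
  have zb : z ∉ F'.image b := by
    intro hx; obtain ⟨l, hl, h⟩ := Finset.mem_image.1 hx; exact hbz l (hF' hl) h
  have dab : Disjoint (F'.image a) (F'.image b) := by
    rw [Finset.disjoint_left]
    intro x hx hx'
    obtain ⟨l, hl, rfl⟩ := Finset.mem_image.1 hx
    obtain ⟨l', hl', h⟩ := Finset.mem_image.1 hx'
    exact hab l (hF' hl) l' (hF' hl') h.symm
  have hw := wform_cliqueAvg_sub (θ := θ) hA h0 (by norm_num : 0 < 8) ca cb sa sb dab hg hK
  have hv : 1 ≤ wform A (fun _ => θ) (Pi.single z 1)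
      (cliqueAvg g (F'.image a) - cliqueAvg g (F'.image b)) := by
    rw [LinearMap.BilinForm.sub_right, wform_single_cliqueAvg za, wform_single_cliqueAvg zb, ca, cb,
      Finset.sum_image (hai.mono (by exact_mod_cast hF')),
      Finset.sum_image (hbi.mono (by exact_mod_cast hF')), ← Finset.sum_sub_distrib]
    calc (1 : ℝ) = ∑ l ∈ F', (1 / 8 : ℝ) := by rw [Finset.sum_const, hc]; norm_num
      _ ≤ _ := Finset.sum_le_sum fun l hl => by
        have h1 := hlt l (hF' hl)
        have h2 : (g (b l) : ℝ) * A z (b l) + 1 ≤ g (a l) * A z (a l) := by exact_mod_cast h1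
        push_cast
        linarith
  have hp := hgood (insert z (F'.image a ∪ F'.image b))
    (Finset.insert_subset hz (Finset.union_subset (sa.trans hKS) (sb.trans hKS)))
    ((Finset.card_insert_le _ _).trans (by have := Finset.card_union_le (F'.image a) (F'.image b); omega))
    (Pi.single z 1 + (-2 : ℝ) • (cliqueAvg g (F'.image a) - cliqueAvg g (F'.image b))) fun i hi => by
      rw [Finset.mem_insert, Finset.mem_union, not_or, not_or] at hi
      simp [hi.1, cliqueAvg_apply_eq_zero hi.2.1, cliqueAvg_apply_eq_zero hi.2.2]
  rw [wform_self_add hA] at hp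
  simp only [map_smul, LinearMap.smul_apply] at hp
  rw [hw, wform_single_single, h0] at hp
  simp only [smul_eq_mul, if_true, Int.cast_zero] at hp
  norm_num at hp hv
  linarith

theorem exists_psdOn_of_degree {θ X : ℝ} {M : ℕ} (hR : RootBound θ X M) (hX1 : 1 < X)
    (hθ : θ < 2.1) : ∃ D G : ℕ, ∀ {V : Type} [Fintype V] [DecidableEq V]
    {A : Matrix V V ℤ} {S S₀ : Finset V} {u : V}, A.IsSymm → (∀ i, A i i = 0) → S₀ ⊆ S →
    (∀ x ∈ S₀, ∀ y ∈ S₀, |A x y| ≤ 1) → Conn A u S → u ∈ S₀ →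
    (∀ U ⊆ S, U.card ≤ G → PSDOn A (fun _ => θ) U) →
    D ≤ (S₀.filter fun x => A u x ≠ 0).card → PSDOn A (fun _ => θ) S := by
  obtain ⟨m, hm⟩ : ∃ m : ℕ, 9 + 2 / (X - 1) < m := exists_nat_gt _
  have hXp : 0 < 2 / (X - 1) := div_pos two_pos (by linarith)
  have hm9 : (9 : ℝ) < m := by linarith
  have hm0 : 0 < m := by
    rcases Nat.eq_zero_or_pos m with h | h
    · subst h; norm_num at hm9
    · exact h
  set J : ℕ := 9 * (M + 1) + 1 with hJ
  obtain ⟨D, hD⟩ := exists_clique_of_degree (J * m)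
  refine ⟨D, M + J * m + 17, ?_⟩
  intro V _ _ A S S₀ u hA h0 hS₀ hle hc hu hgood hdeg
  obtain ⟨K, hKD, hcard, hK⟩ := hD hA h0 hθ hle
    (fun U hU hUc => hgood U (hU.trans hS₀) (by omega)) u hu
    (S₀.filter fun x => A u x ≠ 0) (Finset.filter_subset _ _)
    (fun x hx => (Finset.mem_filter.1 hx).2) hdeg
  have hKS₀ : K ⊆ S₀ := hKD.trans (Finset.filter_subset _ _)
  have hKS : K ⊆ S := hKS₀.trans hS₀
  set g : V → ℤ := fun x => A u x
  have hg : ∀ k ∈ K, g k ^ 2 = 1 := fun k hk =>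
    sq_eq_one_of_abs_le (hle u hu k (hKS₀ hk)) (Finset.mem_filter.1 (hKD hk)).2
  have huK : u ∉ K := fun h => (Finset.mem_filter.1 (hKD h)).2 (h0 u)
  obtain ⟨φ⟩ : Nonempty (Fin J × Fin m ≃ K) :=
    ⟨Fintype.equivOfCardEq (by simp [← hcard])⟩
  let f : Fin J → Fin m → V := fun l i => φ (l, i)
  have hfK : ∀ l i, f l i ∈ K := fun l i => (φ (l, i)).2
  have hf : ∀ l i l' i', f l i = f l' i' → l = l' ∧ i = i' := fun l i l' i' h => by
    have := φ.injective (Subtype.ext h)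
    simpa using this
  let B : Fin J → Finset V := fun l => Finset.univ.image (f l)
  have hBc : ∀ l, (B l).card = m := fun l => by
    rw [Finset.card_image_of_injective _ fun i i' h => (hf l i l i' h).2]; simp
  have hBK : ∀ l, B l ⊆ K := fun l x hx => by
    obtain ⟨i, -, rfl⟩ := Finset.mem_image.1 hx; exact hfK l i
  have hBne : ∀ l, (B l).Nonempty := fun l => Finset.card_pos.1 (by rw [hBc]; exact hm0)
  have hBd : ∀ l l', l ≠ l' → Disjoint (B l) (B l') := fun l l' h => by
    rw [Finset.disjoint_left]
    intro x hx hx'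
    obtain ⟨i, -, rfl⟩ := Finset.mem_image.1 hx
    obtain ⟨i', -, h'⟩ := Finset.mem_image.1 hx'
    exact h (hf _ _ _ _ h').1.symm
  let E1 : V → Finset (Fin J) := fun z => Finset.univ.filter fun l => z ∈ B l
  let E2 : V → Finset (Fin J) := fun z => Finset.univ.filter fun l => z ∉ B l ∧
    ∃ i i', g (f l i') * A z (f l i') < g (f l i) * A z (f l i)
  have hE2 : ∀ z ∈ S, (E2 z).card < 8 := by
    intro z hz
    have : ∀ l, ∃ i i', l ∈ E2 z →
        g (f l i') * A z (f l i') < g (f l i) * A z (f l i) := by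
      intro l
      by_cases hl : l ∈ E2 z
      · obtain ⟨-, -, i, i', h⟩ := Finset.mem_filter.1 hl
        exact ⟨i, i', fun _ => h⟩
      · exact ⟨⟨0, hm0⟩, ⟨0, hm0⟩, fun h => absurd h hl⟩
    choose i i' hi using this
    have hzf : ∀ l ∈ E2 z, ∀ j, f l j ≠ z := fun l hl j h =>
      (Finset.mem_filter.1 hl).2.1 (h ▸ Finset.mem_image_of_mem _ (Finset.mem_univ j))
    refine card_nonhomogeneous_lt hA h0 hθ hKS hg hK (fun U hU hUc => hgood U hU (by omega)) hz
      (E2 z) (fun l => f l (i l)) (fun l => f l (i' l)) (fun _ _ => hfK _ _) (fun _ _ => hfK _ _)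
      (fun l hl => hzf l hl _) (fun l hl => hzf l hl _) (fun _ _ _ _ h => (hf _ _ _ _ h).1)
      (fun _ _ _ _ h => (hf _ _ _ _ h).1) (fun l hl l' hl' h => ?_) hi
    obtain ⟨rfl, h2⟩ := hf _ _ _ _ h
    have := hi l hl
    rw [h2] at this
    exact lt_irrefl _ this
  have hE1 : ∀ z, (E1 z).card ≤ 1 := by
    intro z
    rw [Finset.card_le_one]
    intro l hl l' hl'
    by_contra h
    exact Finset.disjoint_left.1 (hBd l l' h) (Finset.mem_filter.1 hl).2 (Finset.mem_filter.1 hl').2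
  have hval : ∀ z, ∀ l, l ∉ E1 z ∪ E2 z → wform A (fun _ => θ) (Pi.single z 1) (cliqueAvg g (B l))
      = (g (f l ⟨0, hm0⟩) * A z (f l ⟨0, hm0⟩) : ℤ) := by
    intro z l hl
    rw [Finset.mem_union, not_or] at hl
    have hz : z ∉ B l := fun h => hl.1 (by simp [E1, h])
    have hom : ∀ i i', g (f l i) * A z (f l i) ≤ g (f l i') * A z (f l i') := by
      intro i i'
      by_contra! h
      exact hl.2 (by simp only [E2, Finset.mem_filter, Finset.mem_univ, true_and]; exact ⟨hz, i, i', h⟩)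
    refine wform_cliqueAvg_right (hBne l) fun k hk => ?_
    obtain ⟨i, -, rfl⟩ := Finset.mem_image.1 hk
    have : z ≠ f l i := fun h => hz (h ▸ hk)
    rw [wform_single_single, if_neg this, zero_add]
    exact_mod_cast le_antisymm (hom i ⟨0, hm0⟩) (hom ⟨0, hm0⟩ i)
  have hl0 : (⟨0, by omega⟩ : Fin J) ∉ E1 u ∪ E2 u := by
    rw [Finset.mem_union, not_or]
    refine ⟨fun h => huK (hBK _ (Finset.mem_filter.1 h).2), fun h => ?_⟩
    obtain ⟨-, -, i, i', h⟩ := Finset.mem_filter.1 h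
    have e1 := hg _ (hfK ⟨0, by omega⟩ i)
    have e2 := hg _ (hfK ⟨0, by omega⟩ i')
    rw [sq] at e1 e2
    change g _ * g _ < g _ * g _ at h
    rw [e1, e2] at h
    exact lt_irrefl _ h
  refine psdOn_of_family hA h0 (c := 9) (m := J * m) (z₀ := u) (l₀ := (⟨0, by omega⟩ : Fin J))
    hR hθ hc hKS hcard.ge (fun U hU hUc => hgood U hU (by omega))
    (Finset.univ : Finset (Fin J)) (fun l => cliqueAvg g (B l)) ?_ ?_ ?_ (fun z => E1 z ∪ E2 z) ?_ ?_ ?_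
    (hS₀ hu) (Finset.mem_univ _) hl0 ?_
  · exact fun l _ i hi => cliqueAvg_apply_eq_zero fun h => hi (hBK l h)
  · intro l _
    rw [wform_cliqueAvg h0 (hBne l) (fun _ _ => rfl) (fun k hk => hg k (hBK l hk))
      (fun x hx y hy => hK x (hBK l hx) y (hBK l hy)), hBc]
    have h3 : 2 / (X - 1) < m := by linarith
    rw [div_lt_iff₀ (by linarith)] at h3
    have : (θ - 1) / m ≤ X - 1 := by rw [div_le_iff₀ (by linarith)]; nlinarith
    linarith
  · intro l _ l' _
    by_cases h : l = l'
    · subst h; simp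
    · rw [wform_cliqueAvg_sub hA h0 hm0 (hBc l) (hBc l') (hBK l) (hBK l') (hBd l l' h) hg hK,
        div_le_iff₀ (by linarith)]
      linarith
  · intro z hz
    have := Finset.card_union_le (E1 z) (E2 z)
    have := hE1 z
    have := hE2 z hz
    omega
  · exact fun z _ l _ hl => ⟨_, hval z l hl⟩
  · simp [hJ]
  · rw [hval u _ hl0]
    have := hg _ (hfK ⟨0, by omega⟩ ⟨0, hm0⟩)
    rw [sq] at this
    change ((g _ * g _ : ℤ) : ℝ) ≠ 0
    rw [this]; norm_num

end clique

/-- The coefficients of a vector equal to one up to `l * L` and vanishing after `(l + 1) * L`. -/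
noncomputable def rampCoeff (L l i : ℕ) : ℝ := max 0 (min 1 ((l : ℝ) + 1 - i / L))

theorem rampCoeff_of_lt {L l i : ℕ} (hL : 0 < L) (h : i / L < l) : rampCoeff L l i = 1 := by
  have h1 : i < l * L := (Nat.div_lt_iff_lt_mul hL).1 h
  have hL' : (0 : ℝ) < L := by exact_mod_cast hL
  have h2 : (i : ℝ) / L ≤ l := by rw [div_le_iff₀ hL']; exact_mod_cast h1.le
  rw [rampCoeff, min_eq_left (by linarith), max_eq_right (by norm_num)]

theorem rampCoeff_of_gt {L l i : ℕ} (hL : 0 < L) (h : l < i / L) : rampCoeff L l i = 0 := by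
  have h1 : (l + 1) * L ≤ i := (Nat.le_div_iff_mul_le hL).1 h
  have hL' : (0 : ℝ) < L := by exact_mod_cast hL
  have h2 : (l : ℝ) + 1 ≤ (i : ℝ) / L := by rw [le_div_iff₀ hL']; exact_mod_cast h1
  rw [rampCoeff, min_eq_right (by linarith), max_eq_left (by linarith)]

theorem rampCoeff_sub (L l i : ℕ) : 0 ≤ rampCoeff L l i - rampCoeff L l (i + 1) ∧
    rampCoeff L l i - rampCoeff L l (i + 1) ≤ 1 / L := by
  have h : ((i + 1 : ℕ) : ℝ) / L = i / L + 1 / L := by push_cast; ring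
  have h1 : (0 : ℝ) ≤ 1 / L := by positivity
  unfold rampCoeff
  rw [h]
  constructor
  · have : min 1 ((l : ℝ) + 1 - (i / L + 1 / L)) ≤ min 1 ((l : ℝ) + 1 - i / L) :=
      min_le_min le_rfl (by linarith)
    linarith [max_le_max (le_refl (0 : ℝ)) this]
  · rw [sub_le_iff_le_add]
    refine max_le (by positivity) ?_
    have : min 1 ((l : ℝ) + 1 - i / L) ≤ 1 / L + min 1 ((l : ℝ) + 1 - (i / L + 1 / L)) := by
      rw [← min_add_add_left]
      exact min_le_min (by linarith) (by linarith)
    linarith [le_max_right 0 (min 1 ((l : ℝ) + 1 - (i / L + 1 / L)))]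

theorem sum_rampCoeff_sub_sq_le {L l n : ℕ} :
    ∑ i ∈ Finset.range n, (rampCoeff L l i - rampCoeff L l (i + 1)) ^ 2 ≤ 1 / L := by
  have h1 : ∑ i ∈ Finset.range n, (rampCoeff L l i - rampCoeff L l (i + 1)) ^ 2 ≤
      ∑ i ∈ Finset.range n, (rampCoeff L l i - rampCoeff L l (i + 1)) * (1 / L) :=
    Finset.sum_le_sum fun i _ => by
      rw [sq]; exact mul_le_mul_of_nonneg_left (rampCoeff_sub L l i).2 (rampCoeff_sub L l i).1
  rw [← Finset.sum_mul, Finset.sum_range_sub'] at h1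
  have h2 : rampCoeff L l 0 ≤ 1 := max_le (by norm_num) (min_le_left _ _)
  have h3 : 0 ≤ rampCoeff L l n := le_max_left _ _
  exact h1.trans (by
    have : (0 : ℝ) ≤ 1 / L := by positivity
    nlinarith)

section chain
variable {V : Type} [Fintype V] [DecidableEq V] {A : Matrix V V ℤ}

theorem wform_chainSum_two (hA : A.IsSymm) (h0 : ∀ i, A i i = 0) {n : ℕ} {p : ℕ → V}
    (hA1 : ∀ i < n, A (p i) (p (i + 1)) ^ 2 = 1) (hinj : ∀ i j, i < j → j ≤ n → p i ≠ p j)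
    (hind : ∀ i j, i + 1 < j → j ≤ n → A (p i) (p j) = 0) (c : ℕ → ℝ) :
    wform A (fun _ => 2) (chainSum A p c (n + 1)) (chainSum A p c (n + 1)) =
      c 0 ^ 2 + c n ^ 2 + ∑ i ∈ Finset.range n, (c i - c (i + 1)) ^ 2 := by
  rw [wform_chainSum hA h0 hA1 hinj hind c n le_rfl]
  clear hA1 hinj hind
  induction n with
  | zero => simp; ring
  | succ n ih =>
    rw [Finset.sum_range_succ, Finset.sum_range_succ (fun i => c i * c (i + 1)),
      Finset.sum_range_succ (fun i => (c i - c (i + 1)) ^ 2)]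
    linear_combination ih

theorem chainSum_sub (p : ℕ → V) (c c' : ℕ → ℝ) (k : ℕ) :
    chainSum A p c k - chainSum A p c' k = chainSum A p (fun i => c i - c' i) k := by
  simp only [chainSum]
  rw [← Finset.sum_sub_distrib]
  exact Finset.sum_congr rfl fun i _ => by rw [← sub_smul]; ring_nf

theorem exists_psdOn_of_chain {X : ℝ} {M : ℕ} (hR : RootBound 2 X M) (hX1 : 1 < X) :
    ∃ n G : ℕ, ∀ {V : Type} [Fintype V] [DecidableEq V]
    {A : Matrix V V ℤ} {S : Finset V} {u : V} {p : ℕ → V}, A.IsSymm → (∀ i, A i i = 0) →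
    (∀ x ∈ S, ∀ y ∈ S, |A x y| ≤ 1) → Conn A u S → (∀ i ≤ n, p i ∈ S) →
    (∀ i < n, A (p i) (p (i + 1)) ≠ 0) → (∀ i j, i < j → j ≤ n → p i ≠ p j) →
    (∀ i j, i + 1 < j → j ≤ n → A (p i) (p j) = 0) →
    (∀ U ⊆ S, U.card ≤ G → PSDOn A (fun _ => 2) U) → PSDOn A (fun _ => 2) S := by
  obtain ⟨L, hL⟩ : ∃ L : ℕ, 16 + 1 / (X - 1) < L := exists_nat_gt _
  have hXp : 0 < 1 / (X - 1) := div_pos one_pos (by linarith)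
  have hL16 : (16 : ℝ) < L := by linarith
  have hL16' : 16 < L := by exact_mod_cast hL16
  have hL0 : 0 < L := by omega
  set J : ℕ := 9 * (M + 1) + 1 with hJ
  set n : ℕ := (J + 2) * L with hn
  refine ⟨n, M + n + 6, ?_⟩
  intro V _ _ A S u p hA h0 hle hc hp hadj hinj hind hgood
  have hA1 : ∀ i < n, A (p i) (p (i + 1)) ^ 2 = 1 := fun i hi =>
    sq_eq_one_of_abs_le (hle _ (hp i hi.le) _ (hp (i + 1) hi)) (hadj i hi)
  have hn0 : 0 < n := Nat.mul_pos (by omega) hL0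
  let e : ℕ → V → ℝ := fun l => chainSum A p (rampCoeff L l) (n + 1)
  have hend : ∀ l ≤ J, rampCoeff L l n = 0 := fun l hl =>
    rampCoeff_of_gt hL0 (by rw [hn, Nat.mul_div_cancel _ hL0]; omega)
  have hbeg : ∀ l, 1 ≤ l → rampCoeff L l 0 = 1 := fun l hl =>
    rampCoeff_of_lt hL0 (by rw [Nat.zero_div]; omega)
  let N : V → Finset ℕ := fun z => (Finset.range (n + 1)).filter fun i => z = p i ∨ A z (p i) ≠ 0
  have hN : ∀ z ∈ S, (N z).card ≤ 9 := by
    intro z hz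
    have h1 : N z = ((Finset.range (n + 1)).filter fun i => z = p i) ∪
        ((Finset.range (n + 1)).filter fun i => A z (p i) ≠ 0) := Finset.filter_or _ _ _
    have h2 : ((Finset.range (n + 1)).filter fun i => z = p i).card ≤ 1 := by
      rw [Finset.card_le_one]
      intro i hi j hj
      obtain ⟨hi1, hi2⟩ := Finset.mem_filter.1 hi
      obtain ⟨hj1, hj2⟩ := Finset.mem_filter.1 hj
      rw [Finset.mem_range] at hi1 hj1
      rcases lt_trichotomy i j with h | h | h
      · exact absurd (hi2.symm.trans hj2) (hinj i j h (by omega))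
      · exact h
      · exact absurd (hj2.symm.trans hi2) (hinj j i h (by omega))
    have h3 := card_neighbours_path_le hA h0 (by norm_num : (2 : ℝ) < 2.1) hle
      (fun U hU hUc => hgood U hU (by omega)) hp hinj hind hz
    rw [h1]
    exact (Finset.card_union_le _ _).trans (by omega)
  have hw : ∀ z i, i ∈ Finset.range (n + 1) → i ∉ N z →
      wform A (fun _ => 2) (Pi.single z 1) (Pi.single (p i) 1) = 0 := by
    intro z i hi h
    have h' : ¬ (z = p i ∨ A z (p i) ≠ 0) := fun h' => h (Finset.mem_filter.2 ⟨hi, h'⟩)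
    rw [not_or, not_not] at h'
    rw [wform_single_single, if_neg h'.1, h'.2]; simp
  have hc01 : ∀ l i, i / L ≠ l → ∃ k : ℤ, rampCoeff L l i = k := by
    intro l i h
    rcases lt_or_gt_of_ne h with h | h
    · exact ⟨1, by rw [rampCoeff_of_lt hL0 h]; simp⟩
    · exact ⟨0, by rw [rampCoeff_of_gt hL0 h]; simp⟩
  have hp0 : ∀ i ∈ N (p 0), i ≤ 1 := by
    intro i hi
    obtain ⟨hi1, hi2⟩ := Finset.mem_filter.1 hi
    rw [Finset.mem_range] at hi1
    by_contra! h
    rcases hi2 with h' | h'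
    · exact hinj 0 i (by omega) (by omega) h'
    · exact h' (hind 0 i (by omega) (by omega))
  refine psdOn_of_family (T := (Finset.range (n + 1)).image p) hA h0 (c := 9) (m := n + 1)
    (z₀ := p 0) (l₀ := 1) hR (by norm_num) hc ?_ (Finset.card_image_le.trans (by simp))
    (fun U hU hUc => hgood U hU (by omega))
    (Finset.Icc 1 J) e ?_ ?_ ?_ (fun z => (N z).image (· / L)) ?_ ?_ ?_
    (hp 0 (by omega)) (by simp; omega) ?_ ?_
  · intro x hx
    obtain ⟨i, hi, rfl⟩ := Finset.mem_image.1 hx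
    exact hp i (by simpa [Nat.lt_succ_iff] using hi)
  · exact fun l _ x hx => chainSum_apply_eq_zero fun i hi h =>
      hx (h ▸ Finset.mem_image_of_mem _ (Finset.mem_range.2 hi))
  · intro l hl
    rw [Finset.mem_Icc] at hl
    rw [wform_chainSum_two hA h0 hA1 hinj hind, hend l hl.2, hbeg l hl.1]
    have h1 := sum_rampCoeff_sub_sq_le (L := L) (l := l) (n := n)
    have h2 : 1 / (X - 1) < L := by linarith
    have h3 : 1 / (L : ℝ) ≤ X - 1 := by
      rw [div_le_iff₀ (by linarith)]
      rw [div_lt_iff₀ (by linarith)] at h2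
      linarith
    linarith
  · intro l hl l' hl'
    rw [Finset.mem_Icc] at hl hl'
    rw [chainSum_sub, wform_chainSum_two hA h0 hA1 hinj hind, hend l hl.2, hbeg l hl.1,
      hend l' hl'.2, hbeg l' hl'.1]
    have h1 := sum_rampCoeff_sub_sq_le (L := L) (l := l) (n := n)
    have h2 := sum_rampCoeff_sub_sq_le (L := L) (l := l') (n := n)
    have h3 : ∑ i ∈ Finset.range n, (rampCoeff L l i - rampCoeff L l' i -
        (rampCoeff L l (i + 1) - rampCoeff L l' (i + 1))) ^ 2 ≤
        ∑ i ∈ Finset.range n, (2 * (rampCoeff L l i - rampCoeff L l (i + 1)) ^ 2 +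
          2 * (rampCoeff L l' i - rampCoeff L l' (i + 1)) ^ 2) :=
      Finset.sum_le_sum fun i _ => by
        nlinarith [sq_nonneg (rampCoeff L l i - rampCoeff L l (i + 1) +
          (rampCoeff L l' i - rampCoeff L l' (i + 1)))]
    rw [Finset.sum_add_distrib, ← Finset.mul_sum, ← Finset.mul_sum] at h3
    have h4 : 1 / (L : ℝ) ≤ 1 / 16 := one_div_le_one_div_of_le (by norm_num) hL16.le
    norm_num at h3 ⊢
    norm_num at h4 h1 h2
    linarith
  · exact fun z hz => Finset.card_image_le.trans (hN z hz)
  · intro z hz l _ hlE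
    have : ∀ i ∈ Finset.range (n + 1), ∃ k : ℤ, rampCoeff L l i * chainSign A p i *
        wform A (fun _ => 2) (Pi.single z 1) (Pi.single (p i) 1) = k := by
      intro i hi
      by_cases hiN : i ∈ N z
      · obtain ⟨k, hk⟩ := hc01 l i fun h => hlE (h ▸ Finset.mem_image_of_mem _ hiN)
        refine ⟨k * chainSign A p i * ((if z = p i then 2 else 0) + A z (p i)), ?_⟩
        rw [hk, wform_single_single]
        push_cast
        split_ifs <;> simp
      · exact ⟨0, by rw [hw z i hi hiN]; simp⟩
    choose! k hk using this
    refine ⟨∑ i ∈ Finset.range (n + 1), k i, ?_⟩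
    rw [wform_chainSum_right, Finset.sum_congr rfl hk]
    push_cast; rfl
  · simp [hJ]
  · intro h
    obtain ⟨i, hi, h⟩ := Finset.mem_image.1 h
    have := hp0 i hi
    have : i / L = 0 := Nat.div_eq_of_lt (by omega)
    omega
  · obtain ⟨n', hn'⟩ : ∃ n', n + 1 = n' + 1 + 1 := ⟨n - 1, by omega⟩
    rw [wform_chainSum_right, hn', Finset.sum_range_succ', Finset.sum_range_succ',
      Finset.sum_eq_zero, wform_single_single, wform_single_single, if_pos rfl,
      if_neg (hinj 0 (0 + 1) (by omega) (by omega)), h0,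
      rampCoeff_of_lt (l := 1) (i := 0) hL0 (by rw [Nat.zero_div]; omega),
      rampCoeff_of_lt (l := 1) (i := 0 + 1) hL0 (by rw [Nat.div_eq_of_lt (by omega)]; omega)]
    · have : (A (p 0) (p (0 + 1)) : ℝ) ^ 2 = 1 := by exact_mod_cast hA1 0 hn0
      simp only [chainSign]
      push_cast
      intro h
      nlinarith
    · intro i hi
      rw [Finset.mem_range] at hi
      rw [hw _ _ (Finset.mem_range.2 (by omega)) fun h => by have := hp0 _ h; omega]
      simp

end chain

/-- Minimal obstructions at `θ` have bounded size. -/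
def BoundedAt (θ : ℝ) (R : ℕ) : Prop :=
  ∀ {V : Type} [Fintype V] [DecidableEq V] {A : Matrix V V ℤ}, A.IsSymm → (∀ i, A i i = 0) →
    ∀ {S : Finset V}, ¬ PSDOn A (fun _ => θ) S → (∀ S', S' ⊂ S → PSDOn A (fun _ => θ) S') →
    S.card ≤ R

section bounded
variable {V : Type} [Fintype V] [DecidableEq V] {A : Matrix V V ℤ} {d : V → ℝ}

theorem psdOn_of_card_lt {S : Finset V} (hP : ∀ S', S' ⊂ S → PSDOn A d S') {U : Finset V}
    (hU : U ⊆ S) (hc : U.card < S.card) : PSDOn A d U :=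
  hP U (hU.ssubset_of_ne fun h => by rw [h] at hc; exact lt_irrefl _ hc)

theorem abs_lt_of_psdOn_pairs (hA : A.IsSymm) (h0 : ∀ i, A i i = 0) {θ : ℝ} {S : Finset V}
    (hgood : ∀ U ⊆ S, U.card ≤ 2 → PSDOn A (fun _ => θ) U) {x y : V} (hx : x ∈ S) (hy : y ∈ S)
    (hxy : x ≠ y) : |(A x y : ℝ)| ≤ θ := by
  by_contra! h
  exact not_psdOn_pair hA h0 hxy (S := {x, y}) (by simp) (by simp) (by linarith)
    (hgood _ (by simp [Finset.insert_subset_iff, hx, hy]) Finset.card_le_two)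

theorem boundedAt_lt_one {θ : ℝ} (hθ : θ < 1) : BoundedAt θ 2 := by
  intro V _ _ A hA h0 S hS hP
  by_contra! hc
  obtain ⟨v, hv⟩ : S.Nonempty := Finset.card_pos.1 (by omega)
  obtain ⟨x, hx, hxv⟩ := Finset.exists_mem_ne (by omega : 1 < S.card) v
  rcases Relation.ReflTransGen.cases_head ((Conn.of_minimal hA hS hP hv).2 x hx) with h | ⟨w, ⟨hw, hvw⟩, -⟩
  · exact hxv h.symm
  · have hne : v ≠ w := by rintro rfl; exact hvw (h0 v)
    have h1 := abs_lt_of_psdOn_pairs hA h0 (fun U hU hUc => psdOn_of_card_lt hP hU (by omega)) hv hw hne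
    have h2 : (1 : ℝ) ≤ |(A v w : ℝ)| := by exact_mod_cast Int.one_le_abs hvw
    linarith

theorem boundedAt_lt_two {θ : ℝ} (h1 : 1 ≤ θ) (h2 : θ < 2) : ∃ R, BoundedAt θ R := by
  obtain ⟨X, M, hX1, hX2, hR⟩ := exists_rootBound_one h1 h2
  obtain ⟨D, G, hD⟩ := exists_psdOn_of_degree hR hX1 (by linarith)
  obtain ⟨N, hN⟩ : ∃ N : ℕ, 2 / (2 - θ) < N := exists_nat_gt _
  rw [div_lt_iff₀ (by linarith)] at hN
  refine ⟨G + N + 2 + (D + 1) ^ N, ?_⟩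
  intro V _ _ A hA h0 S hS hP
  by_contra! hc
  have hpos : 0 < (D + 1) ^ N := by positivity
  obtain ⟨v, hv⟩ : S.Nonempty := Finset.card_pos.1 (by omega)
  have hconn := fun {u} => Conn.of_minimal (v := u) hA hS hP
  have hle : ∀ x ∈ S, ∀ y ∈ S, |A x y| ≤ 1 := by
    intro x hx y hy
    by_cases hxy : x = y
    · subst hxy; simp [h0]
    have := abs_lt_of_psdOn_pairs hA h0 (fun U hU hUc => psdOn_of_card_lt hP hU (by omega)) hx hy hxy
    have h3 : |(A x y : ℝ)| < 2 := by linarith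
    have h4 : |A x y| < 2 := by exact_mod_cast h3
    omega
  have hdeg : ∀ x ∈ S, (S.filter fun y => A x y ≠ 0).card ≤ D := by
    intro x hx
    by_contra! h
    exact hS (hD hA h0 subset_rfl hle (hconn hx) hx
      (fun U hU hUc => psdOn_of_card_lt hP hU (by omega)) h.le)
  obtain ⟨n, p, hn, -, hp, hadj, hinj, hind, -⟩ := exists_long_chain (L := N) (hconn hv)
    (Finset.mem_singleton_self v) (by simpa) hdeg (by simp; omega)
  exact not_long_chain (d := fun _ => θ) (S := S) hA h0 hN
    (fun U hU hUc => psdOn_of_card_lt hP hU (by omega)) (fun _ _ => rfl)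
    (fun i hi => hp i (by omega))
    (fun i hi => sq_eq_one_of_abs_le (hle _ (hp i (by omega)) _ (hp (i + 1) (by omega)))
      (hadj i (by omega)))
    (fun i j h h' => hinj i j h (by omega)) (fun i j h h' => hind i j h (by omega))

theorem abs_le_one_of_minimal_two (hA : A.IsSymm) (h0 : ∀ i, A i i = 0) {S : Finset V}
    (hS : ¬ PSDOn A (fun _ => 2) S) (hP : ∀ S', S' ⊂ S → PSDOn A (fun _ => 2) S')
    (hc : 4 ≤ S.card) : ∀ x ∈ S, ∀ y ∈ S, |A x y| ≤ 1 := by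
  intro x hx y hy
  by_cases hxy : x = y
  · subst hxy; simp [h0]
  have h2 := abs_lt_of_psdOn_pairs hA h0 (fun U hU hUc => psdOn_of_card_lt hP hU (by omega)) hx hy hxy
  have h3 : |A x y| ≤ 2 := by exact_mod_cast h2
  by_contra! h1
  have h4 : |A x y| = 2 := by omega
  obtain ⟨ε, hε, hAε⟩ : ∃ ε : ℤ, ε * ε = 1 ∧ A x y = 2 * ε := by
    rcases (abs_eq (by norm_num)).1 h4 with h | h
    · exact ⟨1, by norm_num, by rw [h]; norm_num⟩
    · exact ⟨-1, by norm_num, by rw [h]; norm_num⟩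
  have hε' : (ε : ℝ) * ε = 1 := by exact_mod_cast hε
  set n : V → ℝ := Pi.single x 1 - (ε : ℝ) • Pi.single y 1 with hn
  have hyx : y ≠ x := Ne.symm hxy
  have hnn : wform A (fun _ => 2) n n = 0 := by
    simp only [hn, LinearMap.BilinForm.sub_left, LinearMap.BilinForm.sub_right,
      LinearMap.BilinForm.smul_left, LinearMap.BilinForm.smul_right, wform_single_single, h0,
      hA.apply x y, hAε, hxy, hyx, if_true, if_false]
    push_cast
    linear_combination (-2 : ℝ) * hε'
  have horth : ∀ z ∈ S, wform A (fun _ => 2) (Pi.single z 1) n = 0 := by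
    intro z hz
    refine PSDOn.null hA (S := {z, x, y}) (psdOn_of_card_lt hP
      (by simp [Finset.insert_subset_iff, hx, hy, hz])
      (Finset.card_le_three.trans_lt (by omega))) ?_ ?_ hnn
    · intro i hi
      have : i ≠ z := fun h => hi (by simp [h])
      simp [this]
    · intro i hi
      have h1 : i ≠ x := fun h => hi (by simp [h])
      have h2 : i ≠ y := fun h => hi (by simp [h])
      simp [hn, h1, h2]
  refine hS fun z hz => ?_
  have hzn : wform A (fun _ => 2) z n = 0 := by
    have : z = ∑ i, z i • Pi.single i (1 : ℝ) := by
      ext j; simp [Finset.sum_apply, Pi.single_apply]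
    rw [this, LinearMap.BilinForm.sum_left]
    refine Finset.sum_eq_zero fun i _ => ?_
    rw [LinearMap.BilinForm.smul_left]
    by_cases hi : i ∈ S
    · rw [horth i hi, mul_zero]
    · rw [hz i hi, zero_mul]
  have h5 := hP (S.erase y) (Finset.erase_ssubset hy) (z + (ε * z y) • n) fun i hi => by
    rw [Finset.mem_erase, not_and_or, not_not] at hi
    rcases hi with rfl | hi
    · simp only [hn, Pi.add_apply, Pi.smul_apply, Pi.sub_apply, Pi.single_eq_same, smul_eq_mul,
        Pi.single_eq_of_ne hyx]
      linear_combination -z i * hε'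
    · have h1 : i ≠ x := fun h => hi (h ▸ hx)
      have h2 : i ≠ y := fun h => hi (h ▸ hy)
      simp [hn, h1, h2, hz i hi]
  rw [wform_self_add hA] at h5
  simp only [map_smul, LinearMap.smul_apply, hzn, hnn] at h5
  simpa using h5

theorem boundedAt_two {X : ℝ} {M : ℕ} (hR : RootBound 2 X M) (hX1 : 1 < X) :
    ∃ R, BoundedAt 2 R := by
  obtain ⟨D, G, hD⟩ := exists_psdOn_of_degree hR hX1 (by norm_num)
  obtain ⟨N, G', hN⟩ := exists_psdOn_of_chain hR hX1
  refine ⟨G + G' + 3 + (D + 1) ^ N, ?_⟩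
  intro V _ _ A hA h0 S hS hP
  by_contra! hc
  have hpos : 0 < (D + 1) ^ N := by positivity
  obtain ⟨v, hv⟩ : S.Nonempty := Finset.card_pos.1 (by omega)
  have hconn := fun {u} => Conn.of_minimal (v := u) hA hS hP
  have hle := abs_le_one_of_minimal_two hA h0 hS hP (by omega)
  have hdeg : ∀ x ∈ S, (S.filter fun y => A x y ≠ 0).card ≤ D := by
    intro x hx
    by_contra! h
    exact hS (hD hA h0 subset_rfl hle (hconn hx) hx
      (fun U hU hUc => psdOn_of_card_lt hP hU (by omega)) h.le)
  obtain ⟨n, p, hn, -, hp, hadj, hinj, hind, -⟩ := exists_long_chain (L := N) (hconn hv)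
    (Finset.mem_singleton_self v) (by simpa) hdeg (by simp; omega)
  exact hS (hN hA h0 hle (hconn hv) (fun i hi => hp i (by omega)) (fun i hi => hadj i (by omega))
    (fun i j h h' => hinj i j h (by omega)) (fun i j h h' => hind i j h (by omega))
    (fun U hU hUc => psdOn_of_card_lt hP hU (by omega)))

end bounded

section twins
variable {V : Type} [Fintype V] [DecidableEq V] {A : Matrix V V ℤ}

/-- The entries of `A + 2 I`. -/
def gramEntry (A : Matrix V V ℤ) (x y : V) : ℤ := (if x = y then 2 else 0) + A x y

theorem gramEntry_symm (hA : A.IsSymm) (x y : V) : gramEntry A x y = gramEntry A y x := by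
  simp only [gramEntry, hA.apply x y, eq_comm]

theorem wform_single_single_two (x y : V) :
    wform A (fun _ => 2) (Pi.single x 1) (Pi.single y 1) = gramEntry A x y := by
  rw [wform_single_single, gramEntry]; push_cast; split_ifs <;> simp

/-- `rep` sends every element of `S` to a proportional element of `S'`, with sign `η`. -/
structure TwinReps (A : Matrix V V ℤ) (S S' : Finset V) (rep : V → V) (η : V → ℤ) : Prop where
  sub : S' ⊆ S
  abs_le : ∀ x ∈ S', ∀ y ∈ S', |A x y| ≤ 1
  mem : ∀ s ∈ S, rep s ∈ S'
  sign : ∀ s ∈ S, η s * η s = 1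
  gram : ∀ s ∈ S, ∀ z ∈ S, gramEntry A z s = η s * gramEntry A z (rep s)

theorem twin_of_two (hA : A.IsSymm) (h0 : ∀ i, A i i = 0) {θ : ℝ} (hθ : θ < 2.1) {S : Finset V}
    (hgood : ∀ U ⊆ S, U.card ≤ 3 → PSDOn A (fun _ => θ) U) {s t : V} (hs : s ∈ S) (ht : t ∈ S)
    {ε : ℤ} (hε : ε * ε = 1) (hst : A s t = 2 * ε) {z : V} (hz : z ∈ S) :
    gramEntry A z s = ε * gramEntry A z t := by
  have hne : s ≠ t := by
    rintro rfl
    rw [h0] at hst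
    have : ε = 0 := by omega
    simp [this] at hε
  have hts : A t s = 2 * ε := by rw [hA.apply]; exact hst
  by_cases hzs : z = s
  · subst hzs
    simp only [gramEntry, if_true, h0, if_neg hne, hst]
    linear_combination -2 * hε
  by_cases hzt : z = t
  · subst hzt
    simp only [gramEntry, if_true, h0, if_neg hne.symm, hts]
    ring
  by_contra hD
  simp only [gramEntry, if_neg hzs, if_neg hzt, zero_add] at hD
  have hε' : (ε : ℝ) * ε = 1 := by exact_mod_cast hε
  set D : ℤ := A z s - ε * A z t with hDdef
  have hD1 : (1 : ℝ) ≤ |(D : ℝ)| := by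
    exact_mod_cast Int.one_le_abs (sub_ne_zero.2 hD : D ≠ 0)
  have hv : ∀ r : ℝ, 0 ≤ θ + 2 * r * D + r ^ 2 * (2 * θ - 4) := by
    intro r
    have h1 := hgood {z, s, t} (by simp [Finset.insert_subset_iff, hs, ht, hz]) Finset.card_le_three
      (Pi.single z 1 + r • (Pi.single s 1 - (ε : ℝ) • Pi.single t 1)) fun i hi => by
        have h1 : i ≠ z := fun h => hi (by simp [h])
        have h2 : i ≠ s := fun h => hi (by simp [h])
        have h3 : i ≠ t := fun h => hi (by simp [h])
        simp [h1, h2, h3]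
    rw [wform_self_add hA] at h1
    simp only [LinearMap.BilinForm.sub_left, LinearMap.BilinForm.sub_right,
      LinearMap.BilinForm.smul_left, LinearMap.BilinForm.smul_right, wform_single_single, h0,
      hst, hts, hzs, hzt, hne, hne.symm, if_true, if_false] at h1
    have e : (D : ℝ) = A z s - ε * A z t := by rw [hDdef]; push_cast; ring
    rw [e]
    push_cast at h1
    refine h1.trans (le_of_eq ?_)
    linear_combination (r ^ 2 * (θ - 4)) * hε'
  rcases le_abs.1 hD1 with h | h
  · have := hv (-2); linarith
  · have := hv 2; linarith

theorem exists_twinReps (hA : A.IsSymm) (h0 : ∀ i, A i i = 0) {θ : ℝ} (hθ : θ < 2.1)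
    {S : Finset V} (hgood : ∀ U ⊆ S, U.card ≤ 3 → PSDOn A (fun _ => θ) U) :
    ∃ S' rep η, TwinReps A S S' rep η := by
  obtain ⟨S', hS', hmax⟩ := Finset.exists_maximal
    (s := S.powerset.filter fun T => ∀ x ∈ T, ∀ y ∈ T, |A x y| ≤ 1) ⟨∅, by simp⟩
  obtain ⟨hS, hle⟩ := Finset.mem_filter.1 hS'
  rw [Finset.mem_powerset] at hS
  have key : ∀ s, ∃ (t : V) (ε : ℤ), s ∈ S → t ∈ S' ∧ ε * ε = 1 ∧
      ∀ z ∈ S, gramEntry A z s = ε * gramEntry A z t := by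
    intro s
    by_cases hs : s ∈ S
    swap
    · exact ⟨s, 1, fun h => absurd h hs⟩
    by_cases hs' : s ∈ S'
    · exact ⟨s, 1, fun _ => ⟨hs', by norm_num, by simp⟩⟩
    obtain ⟨t, ht, h2⟩ : ∃ t ∈ S', 1 < |A s t| := by
      by_contra! hcon
      have h3 : insert s S' ∈ S.powerset.filter fun T => ∀ x ∈ T, ∀ y ∈ T, |A x y| ≤ 1 := by
        refine Finset.mem_filter.2 ⟨Finset.mem_powerset.2 (Finset.insert_subset hs hS), ?_⟩
        intro x hx y hy
        rcases Finset.mem_insert.1 hx with h1 | h1 <;> rcases Finset.mem_insert.1 hy with h2 | h2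
        · simp [h1, h2, h0]
        · rw [h1]; exact hcon y h2
        · rw [h2, hA.apply]; exact hcon x h1
        · exact hle x h1 y h2
      exact hs' (hmax h3 (Finset.subset_insert _ _) (Finset.mem_insert_self _ _))
    have hne : s ≠ t := by rintro rfl; exact hs' ht
    have h3 := abs_lt_of_psdOn_pairs hA h0 (fun U hU hUc => hgood U hU (by omega)) hs (hS ht) hne
    have h4 : |A s t| < 3 := by
      have : |(A s t : ℝ)| < 3 := by linarith
      exact_mod_cast this
    obtain ⟨ε, hε, hAε⟩ : ∃ ε : ℤ, ε * ε = 1 ∧ A s t = 2 * ε := by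
      rcases (abs_eq (by norm_num)).1 (show |A s t| = 2 by omega) with h | h
      · exact ⟨1, by norm_num, by rw [h]; norm_num⟩
      · exact ⟨-1, by norm_num, by rw [h]; norm_num⟩
    exact ⟨t, ε, fun _ => ⟨ht, hε, fun z hz => twin_of_two hA h0 hθ hgood hs (hS ht) hε hAε hz⟩⟩
  choose rep η h using key
  exact ⟨S', rep, η, hS, hle, fun s hs => (h s hs).1, fun s hs => (h s hs).2.1,
    fun s hs => (h s hs).2.2⟩

/-- Replacement of every vertex by its representative. -/
noncomputable def repSum (S : Finset V) (rep : V → V) (η : V → ℤ) (z : V → ℝ) : V → ℝ :=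
  ∑ s ∈ S, (z s * η s) • Pi.single (rep s) (1 : ℝ)

theorem repSum_apply (S : Finset V) (rep : V → V) (η : V → ℤ) (z : V → ℝ) (c : V) :
    repSum S rep η z c = ∑ s ∈ S.filter fun s => rep s = c, z s * η s := by
  rw [repSum, Finset.sum_apply, Finset.sum_filter]
  refine Finset.sum_congr rfl fun s _ => ?_
  by_cases h : rep s = c
  · subst h; simp
  · simp [h, Ne.symm h]

variable {S S' : Finset V} {rep : V → V} {η : V → ℤ}

theorem TwinReps.gram' (h : TwinReps A S S' rep η) (hA : A.IsSymm) {s t : V} (hs : s ∈ S)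
    (ht : t ∈ S) : gramEntry A s t = η s * η t * gramEntry A (rep s) (rep t) := by
  rw [h.gram t ht s hs, gramEntry_symm hA s, h.gram s hs _ (h.sub (h.mem t ht)), gramEntry_symm hA]
  ring

theorem TwinReps.repSum_eq_zero (h : TwinReps A S S' rep η) (z : V → ℝ) {c : V} (hc : c ∉ S') :
    repSum S rep η z c = 0 := by
  rw [repSum_apply]
  refine Finset.sum_eq_zero fun s hs => ?_
  obtain ⟨h1, rfl⟩ := Finset.mem_filter.1 hs
  exact absurd (h.mem s h1) hc

theorem TwinReps.wform_repSum (h : TwinReps A S S' rep η) (hA : A.IsSymm) {z : V → ℝ}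
    (hz : ∀ i, i ∉ S → z i = 0) :
    wform A (fun _ => 2) (repSum S rep η z) (repSum S rep η z) = wform A (fun _ => 2) z z := by
  have e : z = ∑ s ∈ S, z s • Pi.single s (1 : ℝ) := by
    ext j
    rw [Finset.sum_apply]
    by_cases hj : j ∈ S
    · rw [Finset.sum_eq_single j] <;> simp +contextual [hj, eq_comm]
    · rw [Finset.sum_eq_zero, hz j hj]
      intro s hs
      have : j ≠ s := by rintro rfl; exact hj hs
      simp [this]
  conv_rhs => rw [e]
  rw [repSum]
  simp only [LinearMap.BilinForm.sum_left, LinearMap.BilinForm.sum_right,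
    LinearMap.BilinForm.smul_left, LinearMap.BilinForm.smul_right, wform_single_single_two]
  simp only [Finset.mul_sum]
  refine Finset.sum_congr rfl fun s hs => Finset.sum_congr rfl fun t ht => ?_
  rw [h.gram' hA ht hs]
  push_cast; ring

theorem TwinReps.psdOn_two (h : TwinReps A S S' rep η) (hA : A.IsSymm)
    (hp : PSDOn A (fun _ => 2) S') : PSDOn A (fun _ => 2) S := fun z hz => by
  rw [← h.wform_repSum hA hz]
  exact hp _ fun i hi => h.repSum_eq_zero z hi

theorem TwinReps.psdOn_of_fibers (h : TwinReps A S S' rep η) (hA : A.IsSymm) {θ : ℝ} (hθ : 2 ≤ θ)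
    (hp : PSDOn A (fun c => 2 + (θ - 2) / (S.filter fun s => rep s = c).card) S') :
    PSDOn A (fun _ => θ) S := by
  intro z hz
  have h1 := hp _ fun i hi => h.repSum_eq_zero z hi
  rw [wform_diag_change (d := fun _ => 2), h.wform_repSum hA hz] at h1
  rw [wform_diag_change (d := fun _ => 2)]
  refine h1.trans (add_le_add_right ?_ _)
  have h2 : ∑ i, (θ - 2) * z i * z i = (θ - 2) * ∑ s ∈ S, z s ^ 2 := by
    rw [Finset.mul_sum, ← Finset.sum_subset (Finset.subset_univ S)]
    · exact Finset.sum_congr rfl fun i _ => by ring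
    · intro i _ hi; rw [hz i hi]; ring
  rw [h2, ← Finset.sum_fiberwise S rep, Finset.mul_sum]
  refine Finset.sum_le_sum fun c _ => ?_
  rw [repSum_apply]
  set F := S.filter fun s => rep s = c
  have h3 := sq_sum_le_card_mul_sum_sq (s := F) (f := fun s => z s * (η s : ℝ))
  have h4 : ∑ s ∈ F, (z s * (η s : ℝ)) ^ 2 = ∑ s ∈ F, z s ^ 2 :=
    Finset.sum_congr rfl fun s hs => by
      have : (η s : ℝ) * η s = 1 := by exact_mod_cast h.sign s (Finset.mem_filter.1 hs).1
      linear_combination z s ^ 2 * this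
  rw [h4] at h3
  rcases Nat.eq_zero_or_pos F.card with hF | hF
  · rw [hF, Finset.card_eq_zero.1 hF]; simp
  · have hF' : (0 : ℝ) < F.card := by exact_mod_cast hF
    have : (2 + (θ - 2) / F.card - 2) * (∑ s ∈ F, z s * η s) * (∑ s ∈ F, z s * η s)
        = (θ - 2) * ((∑ s ∈ F, z s * η s) ^ 2 / F.card) := by ring
    rw [this]
    refine mul_le_mul_of_nonneg_left ?_ (by linarith)
    rw [div_le_iff₀ hF']
    linarith

theorem TwinReps.psdOn_fibers (h : TwinReps A S S' rep η) (hA : A.IsSymm) {θ : ℝ}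
    {U : Finset V} (hUS : U ⊆ S) (hU : ∀ c ∈ S', 1 ≤ (U.filter fun s => rep s = c).card)
    (hp : PSDOn A (fun _ => θ) U) :
    PSDOn A (fun c => 2 + (θ - 2) / (U.filter fun s => rep s = c).card) S' := by
  intro y hy
  set f : V → ℝ := fun c => ((U.filter fun s => rep s = c).card : ℝ) with hf
  set z : V → ℝ := fun s => if s ∈ U then η s * y (rep s) / f (rep s) else 0 with hz
  have hzU : ∀ i, i ∉ U → z i = 0 := fun i hi => if_neg hi
  have hzS : ∀ i, i ∉ S → z i = 0 := fun i hi => if_neg fun h' => hi (hUS h')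
  have hη : ∀ s ∈ U, (η s : ℝ) * η s = 1 := fun s hs => by exact_mod_cast h.sign s (hUS hs)
  have hf0 : ∀ c ∈ S', f c ≠ 0 := fun c hc => by
    have := hU c hc
    simp only [hf]; positivity
  have hπ : repSum S rep η z = y := by
    ext c
    by_cases hc : c ∈ S'
    swap
    · rw [h.repSum_eq_zero z hc, hy c hc]
    rw [repSum_apply, ← Finset.sum_subset (Finset.filter_subset_filter _ hUS)]
    · rw [Finset.sum_congr rfl fun s hs => ?_, Finset.sum_const (y c / f c), nsmul_eq_mul]
      · exact mul_div_cancel₀ _ (hf0 c hc)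
      · obtain ⟨h1, rfl⟩ := Finset.mem_filter.1 hs
        simp only [hz, if_pos h1]
        linear_combination (y (rep s) / f (rep s)) * hη s h1
    · intro s hs hs'
      rw [hzU s fun h' => hs' (Finset.mem_filter.2 ⟨h', (Finset.mem_filter.1 hs).2⟩), zero_mul]
  have h1 := hp z hzU
  rw [wform_diag_change (d := fun _ => 2), ← h.wform_repSum hA hzS, hπ] at h1
  rw [wform_diag_change (d := fun _ => 2)]
  refine h1.trans (add_le_add_right (le_of_eq ?_) _)
  have h2 : ∑ i, (θ - 2) * z i * z i = (θ - 2) * ∑ s ∈ U, z s ^ 2 := by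
    rw [Finset.mul_sum, ← Finset.sum_subset (Finset.subset_univ U)]
    · exact Finset.sum_congr rfl fun i _ => by ring
    · intro i _ hi; rw [hzU i hi]; ring
  rw [h2, ← Finset.sum_fiberwise U rep, Finset.mul_sum]
  refine Finset.sum_congr rfl fun c _ => ?_
  rw [Finset.sum_congr rfl (g := fun _ => y c ^ 2 / f c ^ 2) fun s hs => ?_, Finset.sum_const,
    nsmul_eq_mul]
  · change (θ - 2) * (f c * (y c ^ 2 / f c ^ 2)) = (2 + (θ - 2) / f c - 2) * y c * y c
    by_cases hc : c ∈ S'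
    · have := hf0 c hc
      field_simp; ring
    · rw [hy c hc]; simp
  · obtain ⟨h1, rfl⟩ := Finset.mem_filter.1 hs
    simp only [hz, if_pos h1]
    rw [div_pow, mul_pow, sq (η s : ℝ), hη s h1, one_mul]

end twins

theorem exists_le_sum_le_of_prop {k : Type*} [Fintype k] (P : (k → ℕ) → Prop) :
    ∃ N : ℕ, ∀ m, P m → ∃ f ≤ m, P f ∧ ∑ i, f i ≤ N := by
  have hfin : {f | Minimal P f}.Finite :=
    (setOfPred_minimal_antichain P).finite_of_partiallyWellOrderedOn
      (Set.isPWO_of_wellQuasiOrderedLE _)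
  obtain ⟨N, hN⟩ := (hfin.image fun f => ∑ i, f i).bddAbove
  refine ⟨N, fun m hm => ?_⟩
  obtain ⟨f, hf, hmin⟩ := exists_minimal_le_of_wellFoundedLT P m hm
  exact ⟨f, hf, hmin.prop, hN ⟨f, hmin, rfl⟩⟩

/-- Failure with fiber weights persists for weights of bounded total size. -/
theorem exists_weights_sum_le (R : ℕ) (θ : ℝ) : ∃ N : ℕ, ∀ {V : Type} [Fintype V] [DecidableEq V]
    {A : Matrix V V ℤ} {S : Finset V} {m : V → ℕ}, S.card ≤ R →
    (∀ x ∈ S, ∀ y ∈ S, |A x y| ≤ 1) → (∀ c ∈ S, 1 ≤ m c) →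
    ¬ PSDOn A (fun c => 2 + (θ - 2) / m c) S →
    ∃ f : V → ℕ, (∀ c ∈ S, 1 ≤ f c ∧ f c ≤ m c) ∧ ∑ c ∈ S, f c ≤ N ∧
      ¬ PSDOn A (fun c => 2 + (θ - 2) / f c) S := by
  let ι := Σ k : Fin (R + 1), (Fin k → Fin k → Set.Icc (-1 : ℤ) 1)
  have key : ∀ i : ι, ∃ N : ℕ, ∀ m : Fin i.1 → ℕ,
      ((∀ c, 1 ≤ m c) ∧ ¬ PSDOn (Matrix.of fun a b => (i.2 a b : ℤ))
        (fun c => 2 + (θ - 2) / m c) Finset.univ) → ∃ f ≤ m, ((∀ c, 1 ≤ f c) ∧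
        ¬ PSDOn (Matrix.of fun a b => (i.2 a b : ℤ)) (fun c => 2 + (θ - 2) / f c)
          Finset.univ) ∧ ∑ c, f c ≤ N :=
    fun i => exists_le_sum_le_of_prop _
  choose N hN using key
  refine ⟨∑ i, N i, fun {V} _ _ A S m hS hA hm hbad => ?_⟩
  let g : Fin S.card → V := fun i => (S.equivFin.symm i : V)
  have hg : Function.Injective g := fun i j hij => by simpa [g] using hij
  have hgS : ∀ i, g i ∈ S := fun i => (S.equivFin.symm i).2
  have him : Finset.univ.image g = S := by
    apply Finset.eq_of_subset_of_card_le
    · intro x hx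
      obtain ⟨i, _, rfl⟩ := Finset.mem_image.1 hx
      exact hgS i
    · rw [Finset.card_image_of_injective _ hg]; simp
  have hsum : ∀ F : V → ℕ, ∑ c ∈ S, F c = ∑ j, F (g j) := fun F => by
    conv_lhs => rw [← him]
    exact Finset.sum_image fun a _ b _ h => hg h
  let i : ι := ⟨⟨S.card, by omega⟩,
    fun a b => ⟨A (g a) (g b), abs_le.1 (hA _ (hgS a) _ (hgS b))⟩⟩
  have htr : ∀ h : V → ℕ, PSDOn (A.submatrix g g) (fun c => 2 + (θ - 2) / h (g c)) Finset.univ ↔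
      PSDOn A (fun c => 2 + (θ - 2) / h c) S := fun h => by
    rw [psdOn_submatrix_iff (d := fun c => 2 + (θ - 2) / h c) hg, him]
  obtain ⟨f, hfm, ⟨hf1, hfb⟩, hfN⟩ := hN i (fun c => m (g c))
    ⟨fun c => hm _ (hgS c), fun h => hbad ((htr m).1 h)⟩
  have hinv : ∀ c, Function.extend g f 0 (g c) = f c := fun c => hg.extend_apply f 0 c
  refine ⟨Function.extend g f 0, fun c hc => ?_, ?_, fun h => hfb ?_⟩
  · rw [← him] at hc
    obtain ⟨j, -, rfl⟩ := Finset.mem_image.1 hc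
    rw [hinv]
    exact ⟨hf1 j, hfm j⟩
  · rw [hsum]
    simp only [hinv]
    exact hfN.trans (Finset.single_le_sum (f := N) (fun _ _ => Nat.zero_le _) (Finset.mem_univ i))
  · have := (htr _).2 h
    simp only [hinv] at this
    exact this

section chain
variable {V : Type} [Fintype V] [DecidableEq V] {A : Matrix V V ℤ}

theorem Fails.along_chain (hA : A.IsSymm) (h0 : ∀ i, A i i = 0) {θ X δ : ℝ} {M n : ℕ}
    (hX : 1 ≤ X) (hδ : 0 ≤ δ) (hδX : θ ≤ X + 1 / X - δ) {S₀ : Finset V} {p : ℕ → V}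
    (h : Fails A θ X (p 0) (insert (p 0) S₀) M)
    (hadj : ∀ i < n, A (p i) (p (i + 1)) ^ 2 = 1)
    (hfar : ∀ i, 0 < i → i ≤ n → p i ∉ S₀ ∧ ∀ s ∈ S₀, A s (p i) = 0)
    (hinj : ∀ i j, i < j → j ≤ n → p i ≠ p j)
    (hind : ∀ i j, i + 1 < j → j ≤ n → A (p i) (p j) = 0) :
    ∀ i ≤ n, Fails A θ (X + i * δ) (p i) (S₀ ∪ (Finset.range (i + 1)).image p) (M + i) := by
  intro i
  induction i with
  | zero =>
    intro _
    refine h.mono (by simp) ?_ (by simp)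
    simp
  | succ i ih =>
    intro hi
    have hs : 1 ≤ X + (i + 1 : ℕ) * δ := by nlinarith [(Nat.cast_nonneg (i + 1) : (0 : ℝ) ≤ _)]
    have hXs : X ≤ X + (i + 1 : ℕ) * δ := by nlinarith [(Nat.cast_nonneg (i + 1) : (0 : ℝ) ≤ _)]
    have hmem : p i ∈ S₀ ∪ (Finset.range (i + 1)).image p :=
      Finset.mem_union_right _ (Finset.mem_image_of_mem _ (by simp))
    have hf := Fails.step hA h0 (v := p (i + 1)) (t' := X + (i + 1 : ℕ) * δ) ?_ hmem
      (by rw [hA.apply]; exact hadj i hi) ?_ (by linarith) ?_ (ih (by omega))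
    · refine hf.mono le_rfl ?_ (by omega)
      rw [Finset.range_add_one (n := i + 1), Finset.image_insert, Finset.union_insert]
    · intro hm
      rcases Finset.mem_union.1 hm with hm | hm
      · exact (hfar (i + 1) (by omega) hi).1 hm
      · obtain ⟨j, hj, he⟩ := Finset.mem_image.1 hm
        exact hinj j (i + 1) (Finset.mem_range.1 hj) hi he
    · intro x hx hne
      rw [← hA.apply]
      rcases Finset.mem_union.1 hx with hm | hm
      · exact (hfar (i + 1) (by omega) hi).2 x hm
      · obtain ⟨j, hj, rfl⟩ := Finset.mem_image.1 hm
        have hji : j ≠ i := fun h => hne (h ▸ rfl)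
        have := Finset.mem_range.1 hj
        exact hind j (i + 1) (by omega) hi
    · set s := X + (i + 1 : ℕ) * δ
      have h1 : X + 1 / X ≤ s + 1 / s := by
        have : s + 1 / s - (X + 1 / X) = (s - X) * (s * X - 1) / (s * X) := by
          have : X ≠ 0 := by linarith
          have : s ≠ 0 := by linarith
          field_simp; ring
        have h2 : 1 ≤ s * X := by nlinarith
        have h3 : 0 ≤ (s - X) * (s * X - 1) / (s * X) :=
          div_nonneg (mul_nonneg (by linarith) (by linarith)) (by linarith)
        linarith
      have h2 : X + (i : ℝ) * δ = s - δ := by simp only [s]; push_cast; ring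
      rw [h2]; linarith

variable {S S' : Finset V} {rep : V → V} {η : V → ℤ}

theorem TwinReps.rep_eq (h : TwinReps A S S' rep η) (h0 : ∀ i, A i i = 0) {c : V}
    (hc : c ∈ S') : rep c = c := by
  by_contra hne
  have hcS := h.sub hc
  have h1 := h.gram c hcS c hcS
  have h2 := _root_.abs_le.1 (h.abs_le c hc _ (h.mem c hcS))
  simp only [gramEntry, if_true, h0, if_neg (Ne.symm hne), zero_add, add_zero] at h1
  rcases mul_self_eq_one_iff.1 (h.sign c hcS) with h3 | h3 <;> rw [h3] at h1 <;> omega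

theorem TwinReps.conn (h : TwinReps A S S' rep η) (hA : A.IsSymm) (h0 : ∀ i, A i i = 0) {v : V}
    (hc : Conn A v S) : Conn A (rep v) S' := by
  refine ⟨h.mem v hc.1, fun x hx => ?_⟩
  have key := hc.of_step (P := fun x => x ∈ S ∧
    Relation.ReflTransGen (fun a b => b ∈ S' ∧ A a b ≠ 0) (rep v) (rep x)) ⟨hc.1, .refl⟩ ?_
  · have := (key x (h.sub hx)).2
    rwa [h.rep_eq h0 hx] at this
  · rintro a b ⟨ha, hp⟩ hb hab
    refine ⟨hb, ?_⟩
    by_cases hr : rep a = rep b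
    · rwa [← hr]
    have hne : a ≠ b := by rintro rfl; exact hr rfl
    have h1 := h.gram' hA ha hb
    simp only [gramEntry, if_neg hne, if_neg hr, zero_add] at h1
    refine hp.tail ⟨h.mem b hb, fun h2 => hab ?_⟩
    rw [h1, h2, mul_zero]

theorem exists_subset_of_fibers {ι : Type} [DecidableEq ι] (S : Finset V) (T : Finset ι)
    (rep : V → ι) (f : ι → ℕ)
    (hf : ∀ c ∈ T, f c ≤ (S.filter fun s => rep s = c).card) :
    ∃ U ⊆ S, U.card ≤ ∑ c ∈ T, f c ∧ ∀ c ∈ T, (U.filter fun s => rep s = c).card = f c := by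
  have : ∀ c, ∃ F : Finset V, c ∈ T → F ⊆ S.filter (fun s => rep s = c) ∧ F.card = f c := by
    intro c
    by_cases hc : c ∈ T
    · obtain ⟨F, h1, h2⟩ := Finset.exists_subset_card_eq (hf c hc)
      exact ⟨F, fun _ => ⟨h1, h2⟩⟩
    · exact ⟨∅, fun h => absurd h hc⟩
  choose F hF using this
  refine ⟨T.biUnion F, ?_, ?_, fun c hc => ?_⟩
  · exact Finset.biUnion_subset.2 fun c hc => (hF c hc).1.trans (Finset.filter_subset _ _)
  · exact Finset.card_biUnion_le.trans (Finset.sum_le_sum fun c hc => (hF c hc).2.le)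
  · rw [← (hF c hc).2]
    congr 1
    ext s
    simp only [Finset.mem_filter, Finset.mem_biUnion]
    constructor
    · rintro ⟨⟨a, ha, hs⟩, hr⟩
      have := (Finset.mem_filter.1 ((hF a ha).1 hs)).2
      rwa [← hr, this]
    · intro hs
      exact ⟨⟨c, hc, hs⟩, (Finset.mem_filter.1 ((hF c hc).1 hs)).2⟩

theorem boundedAt_gt_two {θ X X₂ : ℝ} {M M₂ : ℕ} (hθ : 2 < θ) (hθ' : θ < 2.1)
    (hR : RootBound θ X M) (hX : 1 < X) (hθX : θ < X + 1 / X)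
    (hR₂ : RootBound 2 X₂ M₂) (hX₂ : 1 < X₂) : ∃ R, BoundedAt θ R := by
  obtain ⟨D, G, hD⟩ := exists_psdOn_of_degree hR hX hθ'
  obtain ⟨R₂, hB⟩ := boundedAt_two hR₂ hX₂
  obtain ⟨δ, hδ⟩ : ∃ δ, δ = X + 1 / X - θ := ⟨_, rfl⟩
  have hδ0 : 0 < δ := by linarith
  obtain ⟨L, hL⟩ : ∃ L : ℕ, θ / δ < L := exists_nat_gt _
  rw [div_lt_iff₀ hδ0] at hL
  set R' := (R₂ * (D + 1)) * (D + 1) ^ (L + 1) with hR'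
  obtain ⟨N, hN⟩ := exists_weights_sum_le R' θ
  refine ⟨G + N + (M + L) + 3, ?_⟩
  intro V _ _ A hA h0 S hS hP
  by_contra! hc
  have hgood : ∀ U ⊆ S, U.card ≤ G + N + (M + L) + 3 → PSDOn A (fun _ => θ) U :=
    fun U hU hUc => psdOn_of_card_lt hP hU (by omega)
  obtain ⟨S', rep, η, h⟩ := exists_twinReps hA h0 hθ' fun U hU hUc => hgood U hU (by omega)
  obtain ⟨v, hv⟩ : S.Nonempty := Finset.card_pos.1 (by omega)
  have hconn := fun {u} => Conn.of_minimal (v := u) hA hS hP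
  have hconn' := h.conn hA h0 (hconn hv)
  have hbad : ¬ PSDOn A (fun _ => 2) S' := fun hp =>
    hS ((h.psdOn_two hA hp).mono_diag fun _ _ => hθ.le)
  have hdeg : ∀ x ∈ S', (S'.filter fun y => A x y ≠ 0).card ≤ D := by
    intro x hx
    by_contra! hlt
    exact hS (hD hA h0 h.sub h.abs_le (hconn (h.sub hx)) hx
      (fun U hU hUc => hgood U hU (by omega)) hlt.le)
  by_cases hcard : S'.card ≤ R'
  · obtain ⟨f, hf, hfN, hfb⟩ := hN (m := fun c => (S.filter fun s => rep s = c).card) hcard h.abs_le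
      (fun c hc => Finset.card_pos.2 ⟨c, Finset.mem_filter.2 ⟨h.sub hc, h.rep_eq h0 hc⟩⟩)
      (fun hp => hS (h.psdOn_of_fibers hA hθ.le hp))
    obtain ⟨U, hU, hUc, hUf⟩ := exists_subset_of_fibers S S' rep f fun c hc => (hf c hc).2
    refine hfb ((h.psdOn_fibers hA hU (fun c hc => ?_) (hgood U hU (by omega))).congr_diag
      fun c hc => ?_)
    · rw [hUf c hc]; exact (hf c hc).1
    · rw [hUf c hc]
  push Not at hcard
  obtain ⟨S₀, hS₀, hb₀, hm₀⟩ := exists_minimal_not_psdOn hbad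
  have hc₀ : S₀.card ≤ R₂ := hB hA h0 hb₀ hm₀
  obtain ⟨s₀, hs₀⟩ : S₀.Nonempty := by
    by_contra hne
    rw [Finset.not_nonempty_iff_eq_empty] at hne
    refine hb₀ fun z hz => ?_
    have : z = 0 := funext fun i => hz i (by simp [hne])
    simp [this]
  set P := S₀ ∪ S₀.biUnion fun s => S'.filter fun y => A s y ≠ 0 with hPdef
  have hPS : P ⊆ S' := Finset.union_subset hS₀
    (Finset.biUnion_subset.2 fun s _ => Finset.filter_subset _ _)
  have hPc : P.card ≤ R₂ * (D + 1) := by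
    refine (Finset.card_union_le _ _).trans ?_
    have h1 : (S₀.biUnion fun s => S'.filter fun y => A s y ≠ 0).card ≤ S₀.card * D :=
      Finset.card_biUnion_le_card_mul _ _ _ fun s hs => hdeg s (hS₀ hs)
    calc _ ≤ S₀.card + S₀.card * D := by omega
      _ = S₀.card * (D + 1) := by ring
      _ ≤ _ := Nat.mul_le_mul_right _ hc₀
  obtain ⟨n, p, hn, hp0, hp, hadj, hinj, hind, hnP⟩ := exists_long_chain (L := L + 1)
    (hconn'.reroot hA (hS₀ hs₀)) (Finset.mem_union_left _ hs₀) hPS hdeg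
    ((Nat.mul_le_mul_right _ hPc).trans_lt hcard)
  have hfar : ∀ i, 0 < i → i ≤ n → p i ∉ S₀ ∧ ∀ s ∈ S₀, A s (p i) = 0 := by
    intro i hi hin
    refine ⟨fun hm => hnP i hi hin (Finset.mem_union_left _ hm), fun s hs => ?_⟩
    by_contra hne
    exact hnP i hi hin (Finset.mem_union_right _
      (Finset.mem_biUnion.2 ⟨s, hs, Finset.mem_filter.2 ⟨hp i hin, hne⟩⟩))
  have hp0' : p 0 ∉ S₀ := fun hm =>
    hadj 0 (by omega) ((hfar 1 one_pos (by omega)).2 _ hm)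
  have hroot : Fails A θ X (p 0) (insert (p 0) S₀) M := by
    refine hR hA h0 ⟨Finset.mem_insert_self _ _, ?_⟩ fun hq => hb₀ ?_
    · rcases Finset.mem_union.1 hp0 with hm | hm
      · exact absurd hm hp0'
      obtain ⟨s, hs, hs'⟩ := Finset.mem_biUnion.1 hm
      have hsp : A (p 0) s ≠ 0 := by rw [hA.apply]; exact (Finset.mem_filter.1 hs').2
      intro x hx
      rcases Finset.mem_insert.1 hx with rfl | hx
      · exact .refl
      · refine Relation.ReflTransGen.head ⟨Finset.mem_insert_of_mem hs, hsp⟩ ?_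
        exact Relation.ReflTransGen.mono
          (fun a b hab => ⟨Finset.mem_insert_of_mem hab.1, hab.2⟩) _ _
          ((Conn.of_minimal hA hb₀ hm₀ hs).2 x hx)
    · refine (hq.mono (Finset.subset_insert _ _)).congr_diag fun i hi => ?_
      have : i ≠ p 0 := by rintro rfl; exact hp0' hi
      rw [rootDiag_of_ne this, min_eq_right hθ.le]
  obtain ⟨U, hU, hUc, hUb⟩ := Fails.along_chain hA h0 hX.le hδ0.le (by linarith) hroot
    (fun i hi => sq_eq_one_of_abs_le (h.abs_le _ (hp i (by omega)) _ (hp (i + 1) (by omega)))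
      (hadj i hi)) hfar hinj hind L (by omega)
  refine hUb ((hgood U (hU.trans (Finset.union_subset (hS₀.trans h.sub) ?_)) (by omega)).mono_diag
    fun i _ => ?_)
  · intro x hx
    obtain ⟨j, hj, rfl⟩ := Finset.mem_image.1 hx
    exact h.sub (hp j (by have := Finset.mem_range.1 hj; omega))
  · by_cases hi : i = p L
    · subst hi; rw [rootDiag_self]; linarith
    · rw [rootDiag_of_ne hi]

end chain

theorem exists_boundedAt {β θ : ℝ} (hβ : β ^ 3 = β + 1) (hθ : θ < √β + (√β)⁻¹) :
    ∃ R, BoundedAt θ R := by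
  obtain ⟨-, hb1, hb2, -⟩ := sqrt_root_bounds hβ
  have h2 : 2 < √β + (√β)⁻¹ := by
    have h3 : √β * (√β)⁻¹ = 1 := mul_inv_cancel₀ (by linarith)
    nlinarith [inv_pos.2 (by linarith : 0 < √β), sq_nonneg (√β - 1)]
  rcases lt_or_ge θ 1 with h | h
  · exact ⟨2, boundedAt_lt_one h⟩
  rcases lt_trichotomy θ 2 with h' | rfl | h'
  · exact boundedAt_lt_two h h'
  · obtain ⟨-, X, M, hX, -, -, hR⟩ := exists_rootBound_two hβ le_rfl h2
    exact boundedAt_two hR hX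
  · obtain ⟨hθ', X, M, hX, -, hθX, hR⟩ := exists_rootBound_two hβ h'.le hθ
    obtain ⟨-, X₂, M₂, hX₂, -, -, hR₂⟩ := exists_rootBound_two hβ le_rfl h2
    exact boundedAt_gt_two h' (by linarith) hR hX hθX hR₂ hX₂

theorem exists_order_bound {β θ : ℝ} (hβ : β ^ 3 = β + 1) (hθ : θ < √β + (√β)⁻¹) : ∃ n : ℕ,
    ∀ (N : ℕ) (A : Matrix (Fin N) (Fin N) ℤ), A.IsSymm → (∀ i, A i i = 0) →
      (∃ μ : ℝ, IsEigenvalue (A.map (Int.cast : ℤ → ℝ)) μ ∧ μ < -θ) →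
      ∃ (k : ℕ) (f : Fin k → Fin N), k ≤ n ∧ Function.Injective f ∧
        ∃ μ : ℝ, IsEigenvalue ((A.submatrix f f).map (Int.cast : ℤ → ℝ)) μ ∧ μ < -θ := by
  obtain ⟨R, hR⟩ := exists_boundedAt hβ hθ
  refine ⟨R, fun N A hA h0 hμ => ?_⟩
  obtain ⟨S, -, hS, hP⟩ := exists_minimal_not_psdOn ((exists_eigenvalue_lt_iff hA θ).1 hμ)
  let f : Fin S.card → Fin N := fun i => S.equivFin.symm i
  have hf : Function.Injective f := fun i j hij => by simpa [f] using hij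
  refine ⟨S.card, f, hR hA h0 hS hP, hf, (exists_eigenvalue_lt_iff (hA.submatrix f) θ).2 ?_⟩
  rw [psdOn_submatrix_iff (d := fun _ => θ) hf]
  convert hS
  apply Finset.eq_of_subset_of_card_le
  · intro x hx
    obtain ⟨i, _, rfl⟩ := Finset.mem_image.1 hx
    exact (S.equivFin.symm i).2
  · rw [Finset.card_image_of_injective _ hf]; simp

theorem wform_self_apply {V : Type*} [Fintype V] [DecidableEq V] (A : Matrix V V ℤ) (θ : ℝ)
    (x : V → ℝ) : wform A (fun _ => θ) x x =
      θ * ∑ i, x i ^ 2 + ∑ i, ∑ j, (A i j : ℝ) * x i * x j := by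
  rw [wform_apply, Finset.mul_sum]
  congr 1
  exact Finset.sum_congr rfl fun i _ => by ring

/-- The disjoint union of `A` and `C`, with the vertex `v` of `A` joined to all of `C`. -/
def glue {V W : Type} [DecidableEq V] (A : Matrix V V ℤ) (v : V) (C : Matrix W W ℤ) :
    Matrix (V ⊕ W) (V ⊕ W) ℤ :=
  Matrix.fromBlocks A (fun i _ => if i = v then 1 else 0) (fun _ i => if i = v then 1 else 0) C

theorem wform_glue {V W : Type} [Fintype V] [DecidableEq V] [Fintype W] [DecidableEq W]
    (A : Matrix V V ℤ) (v : V) (C : Matrix W W ℤ) (θ : ℝ) (x : V ⊕ W → ℝ) :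
    wform (glue A v C) (fun _ => θ) x x =
      wform A (fun _ => θ) (fun i => x (.inl i)) (fun i => x (.inl i)) +
        2 * x (.inl v) * ∑ j, x (.inr j) +
        wform C (fun _ => θ) (fun j => x (.inr j)) (fun j => x (.inr j)) := by
  have e11 : ∀ i j, glue A v C (.inl i) (.inl j) = A i j := fun _ _ => rfl
  have e12 : ∀ i j, glue A v C (.inl i) (.inr j) = if i = v then 1 else 0 := fun _ _ => rfl
  have e21 : ∀ i j, glue A v C (.inr i) (.inl j) = if j = v then 1 else 0 := fun _ _ => rfl
  have e22 : ∀ i j, glue A v C (.inr i) (.inr j) = C i j := fun _ _ => rfl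
  have h1 : ∑ i, ∑ j, ((if i = v then 1 else 0 : ℤ) : ℝ) * x (.inl i) * x (.inr j) =
      x (.inl v) * ∑ j, x (.inr j) := by
    rw [Finset.sum_eq_single v, Finset.mul_sum] <;> simp +contextual
  have h2 : ∑ j, ∑ i, ((if i = v then 1 else 0 : ℤ) : ℝ) * x (.inr j) * x (.inl i) =
      x (.inl v) * ∑ j, x (.inr j) := by
    rw [← h1, Finset.sum_comm]
    exact Finset.sum_congr rfl fun i _ => Finset.sum_congr rfl fun j _ => by ring
  simp only [wform_self_apply, Fintype.sum_sum_type, e11, e12, e21, e22, Finset.sum_add_distrib,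
    h1, h2]
  ring

theorem glue_isSymm {V W : Type} [DecidableEq V] {A : Matrix V V ℤ} {v : V} {C : Matrix W W ℤ}
    (hA : A.IsSymm) (hC : C.IsSymm) : (glue A v C).IsSymm :=
  Matrix.IsSymm.fromBlocks hA rfl hC

theorem glue_self {V W : Type} [DecidableEq V] {A : Matrix V V ℤ} {v : V} {C : Matrix W W ℤ}
    (hA : ∀ i, A i i = 0) (hC : ∀ i, C i i = 0) : ∀ i, glue A v C i i = 0
  | .inl i => hA i
  | .inr i => hC i

/-- The adjacency matrix of a complete graph. -/
def cliqueMatrix (n : ℕ) : Matrix (Fin n) (Fin n) ℤ := fun i j => if i = j then 0 else 1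

theorem wform_cliqueMatrix (n : ℕ) (θ : ℝ) (z : Fin n → ℝ) :
    wform (cliqueMatrix n) (fun _ => θ) z z = (θ - 1) * ∑ i, z i ^ 2 + (∑ i, z i) ^ 2 := by
  have h : ∀ i j, ((cliqueMatrix n i j : ℤ) : ℝ) * z i * z j =
      z i * z j - if i = j then z i * z j else 0 := fun i j => by
    by_cases hij : i = j <;> simp [cliqueMatrix, hij]
  have h2 : ∑ i, z i * z i = ∑ i, z i ^ 2 := Finset.sum_congr rfl fun i _ => by ring
  simp only [wform_self_apply, h, Finset.sum_sub_distrib, Finset.sum_ite_eq, Finset.mem_univ,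
    if_true, h2, sq (∑ i, z i), Finset.sum_mul_sum]
  ring

/-- A form at level `θ` whose minimum over vectors with value `1` at the root is `t`, attained by a
vector of square norm at least `N`. -/
def HasRootedForm (θ t N : ℝ) : Prop :=
  ∃ (V : Type) (_ : Fintype V) (_ : DecidableEq V) (A : Matrix V V ℤ) (v : V), A.IsSymm ∧
    (∀ i, A i i = 0) ∧ (∀ x, t * x v ^ 2 ≤ wform A (fun _ => θ) x x) ∧
    ∃ y : V → ℝ, y v = 1 ∧ wform A (fun _ => θ) y y ≤ t ∧ N ≤ ∑ i, y i ^ 2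

theorem hasRootedForm_single (θ : ℝ) : HasRootedForm θ θ 0 := by
  refine ⟨Unit, inferInstance, inferInstance, 0, (), Matrix.isSymm_zero, fun _ => rfl, fun x => ?_,
    fun _ => 1, rfl, ?_, ?_⟩
  · simp [wform_self_apply]
  · simp [wform_self_apply]
  · simp

theorem HasRootedForm.pendant {θ t N : ℝ} (hθ : 0 < θ) (h : HasRootedForm θ t N) :
    HasRootedForm θ (t - 1 / θ) N := by
  obtain ⟨V, _, _, A, v, hA, h0, hQ, y, hyv, hyQ, hN⟩ := h
  have hw : ∀ x : V ⊕ Unit → ℝ, wform (glue A v (0 : Matrix Unit Unit ℤ)) (fun _ => θ) x x =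
      wform A (fun _ => θ) (fun i => x (.inl i)) (fun i => x (.inl i)) +
        2 * x (.inl v) * x (.inr ()) + θ * x (.inr ()) ^ 2 := by
    intro x
    rw [wform_glue, wform_self_apply (0 : Matrix Unit Unit ℤ)]
    simp
  refine ⟨V ⊕ Unit, inferInstance, inferInstance, glue A v 0, .inl v,
    glue_isSymm hA Matrix.isSymm_zero, glue_self h0 fun _ => rfl, fun x => ?_,
    Sum.elim y fun _ => -1 / θ, hyv, ?_, ?_⟩
  · rw [hw]
    have h1 := hQ fun i => x (.inl i)
    have h2 : 0 ≤ θ * (x (.inr ()) + x (.inl v) / θ) ^ 2 := by positivity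
    have h3 : θ * (x (.inr ()) + x (.inl v) / θ) ^ 2 = θ * x (.inr ()) ^ 2 +
      2 * x (.inl v) * x (.inr ()) + 1 / θ * x (.inl v) ^ 2 := by field_simp; ring
    linarith
  · rw [hw]
    simp only [Sum.elim_inl, Sum.elim_inr, hyv]
    have : 2 * 1 * (-1 / θ) + θ * (-1 / θ) ^ 2 = - (1 / θ) := by field_simp; ring
    linarith
  · rw [Fintype.sum_sum_type]
    simp only [Sum.elim_inl, Sum.elim_inr]
    have : 0 ≤ ∑ _x : Unit, (-1 / θ) ^ 2 := Finset.sum_nonneg fun _ _ => sq_nonneg _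
    linarith

theorem HasRootedForm.pendants {θ t N : ℝ} (hθ : 0 < θ) (h : HasRootedForm θ t N) (k : ℕ) :
    HasRootedForm θ (t - k / θ) N := by
  induction k with
  | zero => simpa
  | succ k ih =>
    have := ih.pendant hθ
    rwa [show t - k / θ - 1 / θ = t - (k + 1 : ℕ) / θ by push_cast; ring] at this

theorem HasRootedForm.clique {θ t N c : ℝ} (hθ : 1 < θ) (h : HasRootedForm θ t N) (a : ℕ)
    (hc : c = a / (θ - 1 + a)) (hct : c < t) :
    HasRootedForm θ (θ - c - (1 - c) ^ 2 / (t - c)) (((1 - c) / (t - c)) ^ 2 * N + 1) := by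
  obtain ⟨V, _, _, A, v, hA, h0, hQ, y, hyv, hyQ, hN⟩ := h
  have hκ : 0 < θ - 1 + a := by have : (0 : ℝ) ≤ a := Nat.cast_nonneg a; linarith
  have hct' : 0 < t - c := by linarith
  have hw : ∀ x : V ⊕ Fin (a + 1) → ℝ, wform (glue A v (cliqueMatrix (a + 1))) (fun _ => θ) x x =
      wform A (fun _ => θ) (fun i => x (.inl i)) (fun i => x (.inl i)) - t * x (.inl v) ^ 2 +
        (θ - 1) * (∑ j : Fin a, (x (.inr j.succ) + (x (.inl v) + x (.inr 0)) / (θ - 1 + a)) ^ 2) +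
        (∑ j : Fin a, x (.inr j.succ) + a * ((x (.inl v) + x (.inr 0)) / (θ - 1 + a))) ^ 2 +
        (t - c) * (x (.inl v) + (1 - c) / (t - c) * x (.inr 0)) ^ 2 +
        (θ - c - (1 - c) ^ 2 / (t - c)) * x (.inr 0) ^ 2 := by
    intro x
    rw [wform_glue, wform_cliqueMatrix, Fin.sum_univ_succ, Fin.sum_univ_succ]
    have e1 : ∀ m : ℝ, ∑ j : Fin a, (x (.inr j.succ) + m) ^ 2 =
        ∑ j : Fin a, x (.inr j.succ) ^ 2 + 2 * m * ∑ j : Fin a, x (.inr j.succ) + a * m ^ 2 := by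
      intro m
      simp only [add_sq, Finset.sum_add_distrib, Finset.mul_sum, Finset.sum_const,
        Finset.card_univ, Fintype.card_fin, nsmul_eq_mul]
      congr 2
      exact Finset.sum_congr rfl fun _ _ => by ring
    rw [e1]
    have e2 : (t - c) * (x (.inl v) + (1 - c) / (t - c) * x (.inr 0)) ^ 2 +
        (θ - c - (1 - c) ^ 2 / (t - c)) * x (.inr 0) ^ 2 = (t - c) * x (.inl v) ^ 2 +
        2 * (1 - c) * x (.inl v) * x (.inr 0) + (θ - c) * x (.inr 0) ^ 2 := by
      have := hct'.ne'
      field_simp; ring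
    conv_rhs => rw [add_assoc, e2, hc]
    have := hκ.ne'
    field_simp
    ring
  refine ⟨V ⊕ Fin (a + 1), inferInstance, inferInstance, glue A v (cliqueMatrix (a + 1)), .inr 0,
    glue_isSymm hA (Matrix.IsSymm.ext fun i j => by simp [cliqueMatrix, eq_comm]),
    glue_self h0 fun i => by simp [cliqueMatrix], fun x => ?_,
    Sum.elim (fun i => -((1 - c) / (t - c)) * y i) (Fin.cons 1 fun _ =>
      -((-((1 - c) / (t - c)) + 1) / (θ - 1 + a))), rfl, ?_, ?_⟩
  · rw [hw]
    have h1 := hQ fun i => x (.inl i)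
    have h2 : 0 ≤ (θ - 1) * (∑ j : Fin a,
      (x (.inr j.succ) + (x (.inl v) + x (.inr 0)) / (θ - 1 + a)) ^ 2) :=
        mul_nonneg (by linarith) (Finset.sum_nonneg fun _ _ => sq_nonneg _)
    have h3 := mul_nonneg hct'.le (sq_nonneg (x (.inl v) + (1 - c) / (t - c) * x (.inr 0)))
    have h4 := sq_nonneg
      (∑ j : Fin a, x (.inr j.succ) + a * ((x (.inl v) + x (.inr 0)) / (θ - 1 + a)))
    linarith
  · have e : (fun i => -((1 - c) / (t - c)) * y i) = (-((1 - c) / (t - c))) • y := by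
      ext i; simp
    rw [hw]
    simp only [Sum.elim_inl, Sum.elim_inr, Fin.cons_zero, Fin.cons_succ, mul_one, e]
    rw [LinearMap.BilinForm.smul_left, LinearMap.BilinForm.smul_right]
    simp only [Finset.sum_const, Finset.card_univ, Fintype.card_fin, nsmul_eq_mul, Pi.smul_apply,
      hyv, smul_eq_mul, mul_one, neg_add_cancel]
    have := mul_le_mul_of_nonneg_left hyQ (sq_nonneg ((1 - c) / (t - c)))
    ring_nf at this ⊢
    linarith
  · rw [Fintype.sum_sum_type, Fin.sum_univ_succ]
    simp only [Sum.elim_inl, Sum.elim_inr, Fin.cons_zero, mul_pow, ← Finset.mul_sum, neg_sq]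
    have h1 := mul_le_mul_of_nonneg_left hN (sq_nonneg ((1 - c) / (t - c)))
    have h2 : 0 ≤ ∑ j : Fin a, (Fin.cons 1 (fun _ =>
      -((-((1 - c) / (t - c)) + 1) / (θ - 1 + a))) : Fin (a + 1) → ℝ) j.succ ^ 2 :=
      Finset.sum_nonneg fun _ _ => sq_nonneg _
    linarith

theorem HasRootedForm.weaken {θ t N N' : ℝ} (h : HasRootedForm θ t N) (hN : N' ≤ N) :
    HasRootedForm θ t N' := by
  obtain ⟨V, i1, i2, A, v, hA, h0, hQ, y, hyv, hyQ, hy⟩ := h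
  exact ⟨V, i1, i2, A, v, hA, h0, hQ, y, hyv, hyQ, hN.trans hy⟩

/-- There are rooted forms at level `θ` with minimum in `[0, 1]` and arbitrarily long minimizers. -/
def HasUnboundedForms (θ : ℝ) : Prop :=
  ∀ N : ℕ, ∃ t, 0 ≤ t ∧ t ≤ 1 ∧ HasRootedForm θ t N

theorem HasUnboundedForms.of_invariant {θ t₀ : ℝ} {I : ℝ → Prop} (hI : ∀ t, I t → 0 ≤ t ∧ t ≤ 1)
    (hstep : ∀ t N, 0 ≤ N → I t → HasRootedForm θ t N → ∃ t', I t' ∧ HasRootedForm θ t' (N + 1))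
    (h₀ : I t₀) (hf : HasRootedForm θ t₀ 0) : HasUnboundedForms θ := by
  have key : ∀ N : ℕ, ∃ t, I t ∧ HasRootedForm θ t N := by
    intro N
    induction N with
    | zero => exact ⟨t₀, h₀, by simpa⟩
    | succ N ih =>
      obtain ⟨t, ht, hN⟩ := ih
      obtain ⟨t', ht', hN'⟩ := hstep t N (Nat.cast_nonneg N) ht hN
      exact ⟨t', ht', by simpa⟩
  intro N
  obtain ⟨t, ht, hN⟩ := key N
  exact ⟨t, (hI t ht).1, (hI t ht).2, hN⟩

theorem HasUnboundedForms.exists_psdOn {θ θ' : ℝ} (h : HasUnboundedForms θ) (hθ : θ' < θ) :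
    ∃ (V : Type) (_ : Fintype V) (_ : DecidableEq V) (A : Matrix V V ℤ), A.IsSymm ∧
      (∀ i, A i i = 0) ∧ PSDOn A (fun _ => θ) Finset.univ ∧
      ¬ PSDOn A (fun _ => θ') Finset.univ := by
  obtain ⟨N, hN⟩ : ∃ N : ℕ, 1 / (θ - θ') < N := exists_nat_gt _
  rw [div_lt_iff₀ (by linarith)] at hN
  obtain ⟨t, ht0, ht1, V, i1, i2, A, v, hA, h0, hQ, y, -, hyQ, hy⟩ := h N
  refine ⟨V, i1, i2, A, hA, h0, fun z _ => (mul_nonneg ht0 (sq_nonneg _)).trans (hQ z),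
    fun hp => ?_⟩
  have h1 := hp y fun i hi => absurd (Finset.mem_univ i) hi
  rw [wform_self_apply] at h1 hyQ
  nlinarith

theorem HasRootedForm.path {θ t N : ℝ} (hθ : 1 < θ) (h : HasRootedForm θ t N) (ht : 0 < t) :
    HasRootedForm θ (θ - 1 / t) (1 / t ^ 2 * N + 1) := by
  have := h.clique hθ 0 (c := 0) (by simp) ht
  simpa using this

theorem exists_nat_sub_mem {x r h : ℝ} (hh : 0 < h) (hx : r ≤ x) :
    ∃ k : ℕ, r ≤ x - k * h ∧ x - k * h < r + h := by
  refine ⟨⌊(x - r) / h⌋₊, ?_, ?_⟩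
  · have := Nat.floor_le (div_nonneg (by linarith : 0 ≤ x - r) hh.le)
    rw [le_div_iff₀ hh] at this
    linarith
  · have := Nat.lt_floor_add_one ((x - r) / h)
    rw [div_lt_iff₀ hh] at this
    linarith

theorem hasUnboundedForms_of_large {θ : ℝ} (hθ : 2.35 ≤ θ) : HasUnboundedForms θ := by
  have hθ0 : 0 < θ := by linarith
  have hp : 0 < 1 / θ := by positivity
  have hp1 : 1 / θ * θ = 1 := by field_simp
  have hp2 : 1 / θ ≤ 1 / 2.35 := one_div_le_one_div_of_le (by norm_num) hθ
  obtain ⟨p, hpe⟩ : ∃ p, p = 1 / θ := ⟨_, rfl⟩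
  have hp3 : p < 0.426 := by rw [hpe]; refine hp2.trans_lt ?_; norm_num
  rw [← hpe] at hp hp1
  have hr : 0 < 1 - p := by linarith
  have hfix : 1 - p ≤ θ - 1 / (1 - p) := by
    rw [le_sub_iff_add_le, ← le_sub_iff_add_le', div_le_iff₀ hr]
    nlinarith
  have hadj : ∀ x N, 1 - p ≤ x → HasRootedForm θ x N →
      ∃ t, (1 - p ≤ t ∧ t ≤ 1) ∧ HasRootedForm θ t N := by
    intro x N hx hf
    obtain ⟨k, h1, h2⟩ := exists_nat_sub_mem hp hx
    refine ⟨_, ⟨h1, by linarith⟩, ?_⟩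
    have := hf.pendants hθ0 k
    rwa [show x - k * p = x - k / θ by rw [hpe]; ring]
  obtain ⟨t₀, ht₀, hf₀⟩ := hadj θ 0 (by linarith) (hasRootedForm_single θ)
  refine .of_invariant (I := fun t => 1 - p ≤ t ∧ t ≤ 1) (fun t ht => ⟨by linarith [ht.1], ht.2⟩)
    ?_ ht₀ hf₀
  rintro t N hN ⟨h1, h2⟩ hf
  have ht : 0 < t := by linarith
  refine hadj (θ - 1 / t) (N + 1) ?_ ((hf.path (by linarith) ht).weaken ?_)
  · have := one_div_le_one_div_of_le hr h1
    linarith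
  · have : 1 ≤ 1 / t ^ 2 := by rw [le_div_iff₀ (by positivity)]; nlinarith
    nlinarith

theorem hasUnboundedForms_of_start {θ t₀ : ℝ} (h2 : 2 < θ) (h3 : θ ≤ 2.5)
    (hf : HasRootedForm θ t₀ 0) (ht₁ : t₀ < 1) (ht₀ : t₀ ^ 2 - θ * t₀ + 1 ≤ 0) :
    HasUnboundedForms θ := by
  obtain ⟨δ, hδ⟩ : ∃ δ, δ = θ - 2 := ⟨_, rfl⟩
  have hδ0 : 0 < δ := by linarith
  have hδ1 : δ ≤ 0.5 := by linarith
  obtain ⟨z, hz1, hz⟩ : ∃ z : ℝ, 1 ≤ z ∧ δ * z * (z + 1) = 1 := by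
    have hs := Real.sq_sqrt (by positivity : 0 ≤ 1 + 4 / δ)
    have h8 : 8 ≤ 4 / δ := by rw [le_div_iff₀ hδ0]; linarith
    have hs3 : 3 ≤ √(1 + 4 / δ) := Real.le_sqrt_of_sq_le (by linarith)
    refine ⟨(√(1 + 4 / δ) - 1) / 2, by linarith, ?_⟩
    set s := √(1 + 4 / δ)
    have : δ * ((s - 1) / 2) * ((s - 1) / 2 + 1) = δ * (s ^ 2 - 1) / 4 := by ring
    rw [this, hs]; field_simp; ring
  have hκ : 0 < θ - 1 := by linarith
  refine .of_invariant (I := fun t => ∃ w, z + 1 ≤ w ∧ t = 1 - 1 / w) ?_ ?_ (t₀ := t₀) ?_ hf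
  · rintro t ⟨w, hw, rfl⟩
    have : 1 / w ≤ 1 := by rw [div_le_one (by linarith)]; linarith
    have : 0 < 1 / w := by apply one_div_pos.2; linarith
    constructor <;> linarith
  · rintro t N hN ⟨w, hw, rfl⟩ hf
    have hw0 : 0 < w := by linarith
    obtain ⟨a, Y, hY, hzY, hYδ⟩ : ∃ (a : ℕ) (Y : ℝ), Y = w - 1 - a / (θ - 1) ∧ z ≤ Y ∧ Y * δ < 1 := by
      by_cases hs : (w - 1) * δ < 1
      · exact ⟨0, w - 1, by simp, by linarith, hs⟩
      have hh : 0 < 1 / (θ - 1) := by positivity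
      have hh1 : 1 / (θ - 1) ≤ 1 := by rw [div_le_one hκ]; linarith
      have hδz : 1 / δ = z * (z + 1) := by rw [div_eq_iff hδ0.ne']; linarith
      have hr : 1 / δ - 1 / (θ - 1) ≤ w - 1 := by
        have : 1 / δ ≤ w - 1 := by rw [div_le_iff₀ hδ0]; linarith
        linarith
      obtain ⟨a, h4, h5⟩ := exists_nat_sub_mem hh hr
      refine ⟨a, w - 1 - a * (1 / (θ - 1)), by ring, by nlinarith, ?_⟩
      rw [sub_add_cancel, lt_div_iff₀ hδ0] at h5
      exact h5
    have hY0 : 0 < Y := by linarith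
    obtain ⟨c, hc⟩ : ∃ c, c = a / (θ - 1 + a) := ⟨_, rfl⟩
    have ha : (0 : ℝ) ≤ a := Nat.cast_nonneg a
    have hκa : θ - 1 + a ≠ 0 := by positivity
    have e1 : (1 - 1 / w) - c = (1 - c) * (Y / w) := by
      rw [hc, hY]; field_simp; ring
    have hc1 : 0 < 1 - c := by
      rw [hc, sub_pos, div_lt_one (by positivity)]; linarith
    have e2 : 0 < (1 - c) * (Y / w) := by positivity
    have hf' := hf.clique (by linarith) a hc (by linarith)
    have e3 : (1 - c) / (1 - 1 / w - c) = w / Y := by rw [e1]; field_simp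
    have e4 : θ - c - (1 - c) ^ 2 / (1 - 1 / w - c) = θ - 1 - 1 / Y := by
      have : (1 - c) ^ 2 / (1 - 1 / w - c) = (1 - c) * (w / Y) := by rw [← e3]; ring
      rw [this, hc, eq_sub_iff_add_eq]
      have : w = Y + 1 + a / (θ - 1) := by rw [hY]; ring
      rw [this]; field_simp; ring
    rw [e3, e4] at hf'
    refine ⟨_, ⟨1 / (1 / Y - δ), ?_, ?_⟩, hf'.weaken ?_⟩
    · have h1 : 0 < 1 / Y - δ := by rw [sub_pos, lt_div_iff₀ hY0]; linarith
      rw [le_div_iff₀ h1]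
      have : 1 / Y ≤ 1 / z := one_div_le_one_div_of_le (by linarith) hzY
      have h4 : 1 / z = δ * (z + 1) := by rw [div_eq_iff (by linarith)]; linarith
      nlinarith
    · rw [one_div_one_div, hδ]; ring
    · have : 1 ≤ w / Y := by
        rw [le_div_iff₀ hY0]
        have : 0 ≤ a / (θ - 1) := by positivity
        linarith
      nlinarith [one_le_pow₀ (n := 2) this]
  · refine ⟨1 / (1 - t₀), ?_, by rw [one_div_one_div]; ring⟩
    rw [le_div_iff₀ (by linarith)]
    by_contra! hlt
    have h4 : t₀ * (z + 1) < z := by linarith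
    have h5 : 0 < (z - t₀ * (z + 1)) * (z + 1 - t₀ * z) :=
      mul_pos (by linarith) (by nlinarith)
    have h6 : θ = 2 + δ := by linarith
    nlinarith

theorem hasUnboundedForms_of_small {θ : ℝ} (h2 : 2 < θ) (h3 : θ ≤ 2.09)
    (hq : 0 ≤ θ ^ 6 - 5 * θ ^ 4 + 4 * θ ^ 2 - 1) : HasUnboundedForms θ := by
  have h0 : 0 < θ := by linarith
  have h1 : 0 < θ - 1 / θ := by
    have : 1 / θ ≤ 1 := by rw [div_le_one h0]; linarith
    linarith
  have h4 : θ ^ 2 - 1 ≠ 0 := by nlinarith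
  have h4' : 0 < θ ^ 2 - 1 := by nlinarith
  have e : θ - 1 / (θ - 1 / θ) - 1 / θ = θ - (2 * θ ^ 2 - 1) / (θ * (θ ^ 2 - 1)) := by
    have h5 : θ - 1 / θ = (θ ^ 2 - 1) / θ := by field_simp
    rw [h5]; field_simp; ring
  obtain ⟨s, hs⟩ : ∃ s, s = (2 * θ ^ 2 - 1) / (θ * (θ ^ 2 - 1)) := ⟨_, rfl⟩
  have hs' : s * (θ * (θ ^ 2 - 1)) = 2 * θ ^ 2 - 1 := by rw [hs]; field_simp
  refine hasUnboundedForms_of_start (t₀ := θ - s) h2 (by linarith) ?_ ?_ ?_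
  · rw [hs, ← e]
    exact ((((hasRootedForm_single θ).path (by linarith) h0).path (by linarith) h1).pendant
      h0).weaken (by positivity)
  · have h5 : θ - 1 < s := by
      rw [hs, lt_div_iff₀ (by positivity)]
      nlinarith [mul_nonneg (sub_nonneg.2 h2.le) (sub_nonneg.2 h3), pow_pos h0 2, pow_pos h0 3]
    linarith
  · have h5 : 1 ≤ s * (θ - s) := by
      have h6 : θ - s = (θ ^ 4 - 3 * θ ^ 2 + 1) / (θ * (θ ^ 2 - 1)) := by
        rw [hs]; field_simp; ring
      rw [h6, hs, div_mul_div_comm, le_div_iff₀ (by positivity)]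
      nlinarith
    nlinarith

theorem hasUnboundedForms_of_middle {θ m : ℝ} (h2 : 2 < θ) (h3 : θ ≤ 2.5) (a : ℕ)
    (hm : m = a + 1) (h4 : (θ - 1) * (θ * (θ + a)) < (θ + a) + m * θ)
    (h5 : (θ * (θ + a)) ^ 2 ≤ ((θ + a) + m * θ) * (θ * (θ * (θ + a)) - ((θ + a) + m * θ))) :
    HasUnboundedForms θ := by
  have h0 : 0 < θ := by linarith
  have ha : (0 : ℝ) ≤ a := Nat.cast_nonneg a
  have hκ : 0 < θ - 1 + a := by linarith
  have hP : 0 < θ * (θ + a) := by positivity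
  obtain ⟨c, hc⟩ : ∃ c, c = a / (θ - 1 + a) := ⟨_, rfl⟩
  have hc1 : c < 1 := by rw [hc, div_lt_one hκ]; linarith
  have hf := ((hasRootedForm_single θ).clique (by linarith) a hc (by linarith)).pendant h0
  obtain ⟨s, hs⟩ : ∃ s, s = ((θ + a) + m * θ) / (θ * (θ + a)) := ⟨_, rfl⟩
  have e : θ - c - (1 - c) ^ 2 / (θ - c) - 1 / θ = θ - s := by
    have h6 : θ - c = (θ - 1) * (θ + a) / (θ - 1 + a) := by rw [hc]; field_simp; ring
    have h7 : 1 - c = (θ - 1) / (θ - 1 + a) := by rw [hc]; field_simp; ring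
    have h8 : θ - 1 ≠ 0 := by linarith
    rw [h7, h6, hs, hm]; field_simp; ring
  rw [e] at hf
  refine hasUnboundedForms_of_start h2 h3 (hf.weaken (by positivity)) ?_ ?_
  · have : θ - 1 < s := by rw [hs, lt_div_iff₀ hP]; linarith
    linarith
  · have : 1 ≤ s * (θ - s) := by
      have h6 : θ - s = (θ * (θ * (θ + a)) - ((θ + a) + m * θ)) / (θ * (θ + a)) := by
        rw [hs]; field_simp
      rw [h6, hs, div_mul_div_comm, le_div_iff₀ (by positivity)]
      linarith
    nlinarith

theorem hasUnboundedForms {β θ : ℝ} (hβ : β ^ 3 = β + 1) (hθ : √β + (√β)⁻¹ < θ) :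
    HasUnboundedForms θ := by
  obtain ⟨-, hb1, hb2, hb⟩ := sqrt_root_bounds hβ
  have hb0 : 0 < √β := by linarith
  have hinv : √β * (√β)⁻¹ = 1 := mul_inv_cancel₀ hb0.ne'
  have h2 : 2 < √β + (√β)⁻¹ := by
    nlinarith [inv_pos.2 hb0, sq_nonneg (√β - 1)]
  have h2' : 2 < θ := h2.trans hθ
  rcases le_or_gt θ 2.09 with h | h
  · refine hasUnboundedForms_of_small h2' h ?_
    obtain ⟨l, hl⟩ : ∃ l, l = √β + (√β)⁻¹ := ⟨_, rfl⟩
    have hl2 : l ^ 2 = β ^ 2 + β + 1 := by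
      have : (√β)⁻¹ ^ 2 = β ^ 2 - 1 := by
        have h5 : β * (√β)⁻¹ ^ 2 = 1 := by
          have h7 : (√β * (√β)⁻¹) ^ 2 = 1 := by rw [hinv, one_pow]
          rwa [mul_pow, hb] at h7
        have h6 : β * (β ^ 2 - 1) = 1 := by linarith
        have hβ0 : β ≠ 0 := by rintro rfl; norm_num at hβ
        exact mul_left_cancel₀ hβ0 (h5.trans h6.symm)
      rw [hl]; linear_combination hb + 2 * hinv + this
    have hroot : (l ^ 2) ^ 3 - 5 * (l ^ 2) ^ 2 + 4 * l ^ 2 - 1 = 0 := by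
      rw [hl2]
      linear_combination (β ^ 3 + 3 * β ^ 2 + 2 * β + 1) * hβ
    rw [← hl] at hθ h2
    have hle : l ^ 2 ≤ θ ^ 2 := by nlinarith
    have h4 : 4 ≤ l ^ 2 := by nlinarith
    obtain ⟨u, hu⟩ : ∃ u, u = l ^ 2 := ⟨_, rfl⟩
    obtain ⟨q, hq⟩ : ∃ q, q = θ ^ 2 := ⟨_, rfl⟩
    rw [← hu] at hroot hle h4
    rw [← hq] at hle
    have : θ ^ 6 - 5 * θ ^ 4 + 4 * θ ^ 2 - 1 = (q - u) * (q ^ 2 + q * u + u ^ 2 - 5 * (q + u) + 4) := by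
      rw [hq]; linear_combination hroot
    rw [this]
    refine mul_nonneg (by linarith) ?_
    nlinarith [mul_nonneg (by linarith : 0 ≤ q - 4) (by linarith : 0 ≤ u - 4)]
  rcases le_or_gt θ 2.15 with h' | h'
  · refine hasUnboundedForms_of_middle (m := 3) h2' (by linarith) 2 (by norm_num) ?_ ?_
    · norm_num; nlinarith [mul_nonneg (sub_nonneg.2 h.le) (sub_nonneg.2 h'),
        mul_nonneg (mul_nonneg (sub_nonneg.2 h.le) (sub_nonneg.2 h')) (by linarith : 0 ≤ θ)]
    · norm_num; nlinarith [mul_nonneg (sub_nonneg.2 h.le) (sub_nonneg.2 h')]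
  rcases le_or_gt θ 2.35 with h'' | h''
  · refine hasUnboundedForms_of_middle (m := 20) h2' (by linarith) 19 (by norm_num) ?_ ?_
    · norm_num; nlinarith [mul_nonneg (sub_nonneg.2 h'.le) (sub_nonneg.2 h''),
        mul_nonneg (mul_nonneg (sub_nonneg.2 h'.le) (sub_nonneg.2 h'')) (by linarith : 0 ≤ θ)]
    · norm_num; nlinarith [mul_nonneg (sub_nonneg.2 h'.le) (sub_nonneg.2 h'')]
  · exact hasUnboundedForms_of_large h''.le

/-- Small principal submatrices of a matrix that is positive semidefinite at a level slightly
above `θ` are positive semidefinite at level `θ`. -/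
theorem exists_pos_psdOn_of_card_le (n : ℕ) (θ : ℝ) : ∃ ε > 0, ∀ {N : ℕ}
    (A : Matrix (Fin N) (Fin N) ℤ), A.IsSymm → (∀ i, A i i = 0) →
    PSDOn A (fun _ => θ + ε) Finset.univ → ∀ (k : ℕ) (f : Fin k → Fin N), k ≤ n →
    Function.Injective f → PSDOn (A.submatrix f f) (fun _ => θ) Finset.univ := by
  obtain ⟨C, hC⟩ : ∃ C : ℕ, θ + 1 ≤ C := exists_nat_ge _
  let ι := Σ k : Fin (n + 1), (Fin k → Fin k → Set.Icc (-C : ℤ) C)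
  obtain ⟨ε, hε, h⟩ := exists_pos_forall_not_psdOn_add (ι := ι) (W := fun i => Fin i.1)
    (fun i => Matrix.of fun a b => (i.2 a b : ℤ)) (fun _ _ => θ)
  refine ⟨min ε 1, by positivity, fun {N} A hA h0 hpsd k f hk hf => ?_⟩
  have hAC : ∀ x y, |A x y| ≤ C := by
    intro x y
    rcases eq_or_ne x y with rfl | hxy
    · simp [h0]
    have h1 := abs_lt_of_psdOn_pairs hA h0 (S := Finset.univ)
      (fun U hU _ => hpsd.mono hU) (Finset.mem_univ x) (Finset.mem_univ y) hxy
    have h2 : |(A x y : ℝ)| ≤ C := by linarith [min_le_right ε 1]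
    exact_mod_cast h2
  by_contra hn
  refine h ⟨⟨k, by omega⟩, fun a b => ⟨A (f a) (f b), abs_le.1 (hAC _ _)⟩⟩ hn ?_
  have h3 : PSDOn (A.submatrix f f) (fun _ => θ + min ε 1) Finset.univ :=
    (psdOn_submatrix_iff (d := fun _ => θ + min ε 1) hf).2 (hpsd.mono (Finset.subset_univ _))
  exact h3.mono_diag fun _ _ => by linarith [min_le_left ε 1]

theorem exists_forall_submatrix_le {β θ : ℝ} (hβ : β ^ 3 = β + 1)
    (hθ : √β + (√β)⁻¹ ≤ θ) (n : ℕ) :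
    ∃ (N : ℕ) (A : Matrix (Fin N) (Fin N) ℤ), A.IsSymm ∧ (∀ i, A i i = 0) ∧
      (∃ μ : ℝ, IsEigenvalue (A.map (Int.cast : ℤ → ℝ)) μ ∧ μ < -θ) ∧
      ∀ (k : ℕ) (f : Fin k → Fin N), k ≤ n → Function.Injective f →
        ∀ μ : ℝ, IsEigenvalue ((A.submatrix f f).map (Int.cast : ℤ → ℝ)) μ → -θ ≤ μ := by
  obtain ⟨ε, hε, h⟩ := exists_pos_psdOn_of_card_le n θ
  obtain ⟨V, _, _, A, hA, h0, hpsd, hn⟩ :=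
    (hasUnboundedForms hβ (by linarith : √β + (√β)⁻¹ < θ + ε)).exists_psdOn
      (by linarith : θ < θ + ε)
  let e := (Fintype.equivFin V).symm
  have hB : (A.submatrix e e).IsSymm := hA.submatrix _
  have key : ∀ c : ℝ, PSDOn (A.submatrix e e) (fun _ => c) Finset.univ ↔
      PSDOn A (fun _ => c) Finset.univ := fun c => by
    have := psdOn_submatrix_iff (A := A) (d := fun _ => c) e.injective (T := Finset.univ)
    rwa [Finset.image_univ_of_surjective e.surjective] at this
  refine ⟨_, A.submatrix e e, hB, fun i => h0 _,
    (exists_eigenvalue_lt_iff hB θ).2 (mt (key θ).1 hn), fun k f hk hf μ hμ => ?_⟩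
  by_contra! hlt
  exact (exists_eigenvalue_lt_iff (hB.submatrix f) θ).1 ⟨μ, hμ, hlt⟩
    (h _ hB (fun i => h0 _) ((key _).2 hpsd) k f hk hf)

/-- For `λ < λ*` there is a uniform bound `n` such that any symmetric integer matrix with
zero diagonal having an eigenvalue less than `-λ` already has a principal submatrix of order
at most `n` with an eigenvalue less than `-λ`; for `λ ≥ λ*` this fails. -/
theorem integer_matrix_principal_submatrix
    (βs lamStar : ℝ) (hβs : βs ^ 3 = βs + 1)
    (hstar : lamStar = Real.sqrt βs + (Real.sqrt βs)⁻¹) :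
    (∀ lam : ℝ, lam < lamStar → ∃ n : ℕ,
      ∀ (N : ℕ) (A : Matrix (Fin N) (Fin N) ℤ), A.IsSymm → (∀ i, A i i = 0) →
        (∃ μ : ℝ, IsEigenvalue (A.map (Int.cast : ℤ → ℝ)) μ ∧ μ < -lam) →
        ∃ (k : ℕ) (f : Fin k → Fin N), k ≤ n ∧ Function.Injective f ∧
          ∃ μ : ℝ, IsEigenvalue ((A.submatrix f f).map (Int.cast : ℤ → ℝ)) μ ∧ μ < -lam) ∧
    (∀ lam : ℝ, lamStar ≤ lam → ∀ n : ℕ,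
      ∃ (N : ℕ) (A : Matrix (Fin N) (Fin N) ℤ), A.IsSymm ∧ (∀ i, A i i = 0) ∧
        (∃ μ : ℝ, IsEigenvalue (A.map (Int.cast : ℤ → ℝ)) μ ∧ μ < -lam) ∧
        ∀ (k : ℕ) (f : Fin k → Fin N), k ≤ n → Function.Injective f →
          ∀ μ : ℝ, IsEigenvalue ((A.submatrix f f).map (Int.cast : ℤ → ℝ)) μ → -lam ≤ μ) := by
  subst hstar
  exact ⟨fun _ h => exists_order_bound hβs h, fun _ h n => exists_forall_submatrix_le hβs h n⟩
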